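/- arXiv:2003.12379 — 2 statements merged into one kernel-verified Lean document; each statement's English description precedes it below -/
import Mathlib

section
/- Let K be a field of characteristic 0 and let S = K[x_1,…,x_11]. Let I(D_1) be the ideal generated by x_1x_3, x_1x_4, x_1x_7, x_1x_10, x_1x_11^2, x_2x_4, x_2x_5, x_2x_8, x_2x_10, x_2x_11^2, x_3x_5, x_3x_6, x_3x_8, x_3x_11^2, x_4x_6, x_4x_9, x_4x_11^2, x_5x_7, x_5x_9, x_5x_11, x_6x_8, x_6x_9, x_7x_9, x_7x_10, x_8x_10, and let I(G) be the ideal generated by the corresponding squarefree monomials x_1x_3, x_1x_4, x_1x_7, x_1x_10, x_1x_11, x_2x_4, x_2x_5, x_2x_8, x_2x_10, x_2x_11, x_3x_5, x_3x_6, x_3x_8, x_3x_11, x_4x_6, x_4x_9, x_4x_11, x_5x_7, x_5x_9, x_5x_11, x_6x_8, x_6x_9, x_7x_9, x_7x_10, x_8x_10. Then S/I(G) is Cohen-Macaulay and I(D_1) is unmixed, but S/I(D_1) is not Cohen-Macaulay. -/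
universe u

/-- The height of an ideal `p` (intended: a prime ideal), i.e. the Krull dimension of the
set of prime ideals contained in `p`. -/
noncomputable def idealHeight {R : Type*} [CommRing R] (p : Ideal R) : WithBot ℕ∞ :=
  Order.krullDim {q : PrimeSpectrum R // q.asIdeal ≤ p}

/-- An ideal `I ⊆ R` is unmixed if all associated primes of `R ⧸ I` have the same height. -/
def IsUnmixedIdeal {R : Type*} [CommRing R] (I : Ideal R) : Prop :=
  ∀ p ∈ associatedPrimes R (R ⧸ I), ∀ q ∈ associatedPrimes R (R ⧸ I),
    idealHeight p = idealHeight q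

open CategoryTheory in
/-- The Ext module `Ext_R^n(M, N)`. -/
noncomputable def ExtMod (R : Type u) [CommRing R] (n : ℕ) (M N : Type u)
    [AddCommGroup M] [Module R M] [AddCommGroup N] [Module R N] : ModuleCat R :=
  ((Ext R (ModuleCat R) n).obj (Opposite.op (ModuleCat.of R M))).obj (ModuleCat.of R N)

/-- The depth of a local ring `R`, defined via vanishing of the Ext modules
`Ext_R^n(k, R)`, where `k` is the residue field of `R`. -/
noncomputable def localRingDepth (R : Type u) [CommRing R] [IsLocalRing R] : ℕ∞ :=
  sInf {n : ℕ∞ | ∃ m : ℕ, n = m ∧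
    Nontrivial (ExtMod R m (IsLocalRing.ResidueField R) R)}

/-- A commutative ring is Cohen-Macaulay if for every maximal ideal `p`, the depth of the
localization at `p` equals its Krull dimension. -/
def IsCohenMacaulayRing (R : Type u) [CommRing R] : Prop :=
  ∀ (p : Ideal R) [p.IsMaximal],
    (localRingDepth (Localization.AtPrime p) : WithBot ℕ∞) =
      ringKrullDim (Localization.AtPrime p)

/-- Serre's condition `(S_k)` for a commutative ring: for every prime ideal `p`, the depth
of the localization at `p` is at least the minimum of its Krull dimension and `k`. -/
def SerreCondition (k : ℕ) (R : Type u) [CommRing R] : Prop :=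
  ∀ (p : Ideal R) [p.IsPrime],
    min (ringKrullDim (Localization.AtPrime p)) (k : WithBot ℕ∞) ≤
      (localRingDepth (Localization.AtPrime p) : WithBot ℕ∞)

section

section ExtComparison

open CategoryTheory Abelian

variable {R : Type u} [CommRing R]

theorem CategoryTheory.ProjectiveResolution.subsingleton_ext_iff {X Y : ModuleCat.{u} R}
    (P : ProjectiveResolution X) (n : ℕ) :
    Subsingleton (Abelian.Ext X Y n) ↔ (P.complex.linearYonedaObj R Y).ExactAt n := by
  cases n with
  | zero =>
    have hex : (P.complex.linearYonedaObj R Y).ExactAt 0 ↔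
        ∀ f : P.complex.X 0 ⟶ Y, P.complex.d 1 0 ≫ f = 0 → f = 0 := by
      rw [HomologicalComplex.exactAt_iff' _ 0 0 1 (by simp) (by simp),
        ShortComplex.moduleCat_exact_iff]
      constructor
      · intro h f hf
        obtain ⟨g, hg⟩ := h f hf
        have hz : P.complex.d 0 0 ≫ (show P.complex.X 0 ⟶ Y from g) = 0 := by
          rw [P.complex.shape 0 0 (by simp), Limits.zero_comp]
        exact hg.symm.trans hz
      · intro h f hf
        exact ⟨0, by rw [map_zero]; exact (h f hf).symm⟩
    rw [hex, Ext.addEquiv₀.toEquiv.subsingleton_congr]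
    constructor
    · intro h f hf
      have hd : (show X ⟶ Y from P.exact₀.desc f hf) = 0 := Subsingleton.elim _ _
      exact (P.exact₀.g_desc f hf).symm.trans
        ((congrArg (P.π.f 0 ≫ ·) hd).trans Limits.comp_zero)
    · intro h
      refine ⟨fun f g => ?_⟩
      rw [← sub_eq_zero]
      have key : ∀ g : ((ChainComplex.single₀ (ModuleCat R)).obj X).X 0 ⟶ Y, g = 0 := fun g =>
        (cancel_epi (P.π.f 0)).1 ((h (P.π.f 0 ≫ g) (by
          rw [← Category.assoc, P.complex_d_comp_π_f_zero, Limits.zero_comp])).trans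
            Limits.comp_zero.symm)
      exact key (f - g)
  | succ p =>
    rw [HomologicalComplex.exactAt_iff' _ p (p + 1) (p + 2) (by simp) (by simp),
      ShortComplex.moduleCat_exact_iff]
    constructor
    · intro h f hf
      exact (P.extMk_eq_zero_iff f (p + 2) rfl hf p rfl).1 (Subsingleton.elim _ _)
    · intro h
      refine ⟨fun a b => ?_⟩
      rw [← sub_eq_zero]
      obtain ⟨f, hf, hfab⟩ := P.extMk_surjective (a - b) (p + 2) rfl
      rw [← hfab]
      exact (P.extMk_eq_zero_iff f (p + 2) rfl hf p rfl).2 (h f hf)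

theorem nontrivial_extMod_iff (n : ℕ) (M N : Type u)
    [AddCommGroup M] [Module R M] [AddCommGroup N] [Module R N] :
    Nontrivial (ExtMod R n M N) ↔
      Nontrivial (Abelian.Ext (ModuleCat.of R M) (ModuleCat.of R N) n) := by
  rw [← not_iff_not, not_nontrivial_iff_subsingleton, not_nontrivial_iff_subsingleton]
  let P := projectiveResolution (ModuleCat.of R M)
  rw [P.subsingleton_ext_iff, HomologicalComplex.exactAt_iff_isZero_homology,
    ← (P.isoExt (R := R) n (ModuleCat.of R N)).isZero_iff]
  exact (ModuleCat.isZero_iff_subsingleton (M := ExtMod R n M N)).symm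

end ExtComparison

end

section

section Depth

open CategoryTheory Abelian Limits RingTheory.Sequence IsLocalRing Pointwise

theorem QuotSMulTop.subsingleton_ext {R : Type u} [CommRing R] {n : ℕ}
    (N M : ModuleCat.{u} R) {x : R}
    (hx : IsSMulRegular M x) (h : ∀ i < n + 1, Subsingleton (Abelian.Ext N M i)) :
    ∀ i < n, Subsingleton (Abelian.Ext N (ModuleCat.of R (QuotSMulTop x M)) i) := by
  intro i hi
  have zero1 := AddCommGrpCat.isZero_of_iff_subsingleton.mpr (h i (by lia))
  have zero2 := AddCommGrpCat.isZero_of_iff_subsingleton.mpr (h (i + 1) (by lia))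
  exact AddCommGrpCat.subsingleton_of_isZero <| ShortComplex.Exact.isZero_of_both_zeros
    ((Ext.covariant_sequence_exact₃' N hx.smulShortComplex_shortExact) i (i + 1) rfl)
    (zero1.eq_zero_of_src _) (zero2.eq_zero_of_tgt _)

variable {R : Type u} [CommRing R] [IsLocalRing R]

theorem subsingleton_ext_of_lt_localRingDepth {m : ℕ} (h : (m : ℕ∞) < localRingDepth R) :
    Subsingleton (Abelian.Ext (ModuleCat.of R (ResidueField R)) (ModuleCat.of R R) m) := by
  rw [← not_nontrivial_iff_subsingleton, ← nontrivial_extMod_iff]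
  intro hn
  exact absurd (sInf_le ⟨m, rfl, hn⟩ : localRingDepth R ≤ m) (not_le.2 h)

theorem le_localRingDepth {n : ℕ} (h : ∀ m < n,
    Subsingleton (Abelian.Ext (ModuleCat.of R (ResidueField R)) (ModuleCat.of R R) m)) :
    (n : ℕ∞) ≤ localRingDepth R := by
  refine le_sInf ?_
  rintro _ ⟨m, rfl, hm⟩
  rw [nontrivial_extMod_iff, ← not_subsingleton_iff_nontrivial] at hm
  by_contra hlt
  exact hm (h m (by exact_mod_cast not_le.1 hlt))

theorem IsLocalRing.support_residueField : Module.support R (ResidueField R) =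
    PrimeSpectrum.zeroLocus (maximalIdeal R : Set R) := by
  change Module.support R (R ⧸ maximalIdeal R) = _
  rw [Module.support_eq_zeroLocus, Ideal.annihilator_quotient]

theorem maximalIdeal_smul_top_lt : maximalIdeal R • (⊤ : Submodule R R) < ⊤ := by
  rw [smul_eq_mul, Ideal.mul_top]
  exact lt_top_iff_ne_top.2 (Ideal.IsPrime.ne_top inferInstance)

variable [IsNoetherianRing R]

instance : Module.Finite R (ResidueField R) :=
  inferInstanceAs (Module.Finite R (R ⧸ maximalIdeal R))

theorem localRingDepth_eq_ringKrullDim_of_isRegular (rs : List R)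
    (hrs : ∀ r ∈ rs, r ∈ maximalIdeal R) (hreg : IsRegular R rs)
    (hdim : ringKrullDim R ≤ rs.length) :
    (localRingDepth R : WithBot ℕ∞) = ringKrullDim R := by
  have hge (ss : List R) (hss : IsRegular R ss) : (ss.length : WithBot ℕ∞) ≤ ringKrullDim R := by
    rw [← ringKrullDim_add_length_eq_ringKrullDim_of_isRegular ss hss]
    have : Nontrivial (R ⧸ Ideal.ofList ss) := by
      refine Ideal.Quotient.nontrivial_iff.2 fun h => hss.top_ne_smul ?_
      rw [h, smul_eq_mul, Ideal.mul_top]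
    exact le_add_of_nonneg_left ringKrullDim_nonneg_of_nontrivial
  have hdim' := le_antisymm hdim (hge rs hreg)
  rw [hdim']
  have hle : ((rs.length : ℕ) : ℕ∞) ≤ localRingDepth R := le_localRingDepth fun m hm =>
    ModuleCat.subsingleton_ext_of_exists_isRegular (maximalIdeal R) _
      IsLocalRing.support_residueField.subset (ModuleCat.of R R) maximalIdeal_smul_top_lt
      rs hrs hreg m hm
  have hle' : localRingDepth R ≤ (rs.length : ℕ) := by
    by_contra hlt
    obtain ⟨ss, hlen, hmem, hss⟩ := ModuleCat.exists_isRegular_of_exists_subsingleton_ext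
      (maximalIdeal R) (rs.length + 1) (ModuleCat.of R R) maximalIdeal_smul_top_lt
      (ModuleCat.of R (ResidueField R)) IsLocalRing.support_residueField
      fun i hi => subsingleton_ext_of_lt_localRingDepth
        (lt_of_le_of_lt (by exact_mod_cast Nat.lt_succ_iff.1 hi) (not_le.1 hlt))
    have := (hge ss hss).trans hdim
    rw [hlen] at this
    exact absurd this (by
      rw [not_le]; exact_mod_cast Nat.lt_succ_self _)
  rw [le_antisymm hle' hle]
  rfl

theorem exists_regular_mod_pair (hdepth : 3 ≤ localRingDepth R) {a b : R}
    (ha : ∀ f, a * f = 0 → f = 0) (hb : ∀ f g, b * f = a * g → f ∈ Ideal.span {a}) :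
    ∃ r ∈ maximalIdeal R, ∀ f, r * f ∈ Ideal.span {a, b} → f ∈ Ideal.span {a, b} := by
  have mk_eq_zero {M : Type u} [AddCommGroup M] [Module R M] (x : R) (f : M) :
      (Submodule.Quotient.mk f : QuotSMulTop x M) = 0 ↔ ∃ g, x • g = f := by
    rw [Submodule.Quotient.mk_eq_zero, Submodule.mem_smul_pointwise_iff_exists]
    simp
  have ha' : IsSMulRegular R a := isSMulRegular_iff_right_eq_zero_of_smul.2 ha
  have hb' : IsSMulRegular (QuotSMulTop a R) b := by
    refine isSMulRegular_iff_right_eq_zero_of_smul.2 fun x hx => ?_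
    obtain ⟨f, rfl⟩ := Submodule.Quotient.mk_surjective _ x
    rw [← Submodule.Quotient.mk_smul, mk_eq_zero] at hx
    obtain ⟨g, hg⟩ := hx
    obtain ⟨c, hc⟩ := Ideal.mem_span_singleton'.1 (hb f g hg.symm)
    exact (mk_eq_zero a f).2 ⟨c, by rw [← hc, smul_eq_mul, mul_comm]⟩
  let k := ModuleCat.of R (ResidueField R)
  have h0 : ∀ i < 3, Subsingleton (Abelian.Ext k (ModuleCat.of R R) i) := fun i hi =>
    subsingleton_ext_of_lt_localRingDepth (lt_of_lt_of_le (by exact_mod_cast hi) hdepth)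
  have h1 := QuotSMulTop.subsingleton_ext k _ ha' h0
  have h2 := QuotSMulTop.subsingleton_ext k _ hb' h1
  have h3 : Subsingleton (k ⟶ ModuleCat.of R (QuotSMulTop b (QuotSMulTop a R))) :=
    Ext.addEquiv₀.subsingleton_congr.mp (h2 0 one_pos)
  have h4 : Subsingleton (ResidueField R →ₗ[R] QuotSMulTop b (QuotSMulTop a R)) :=
    (ModuleCat.homAddEquiv (M := k)
      (N := ModuleCat.of R (QuotSMulTop b (QuotSMulTop a R)))).symm.subsingleton
  obtain ⟨r, hr, hreg⟩ := IsSMulRegular.subsingleton_linearMap_iff.1 h4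
  have hann : Module.annihilator R (ResidueField R) = maximalIdeal R :=
    Ideal.annihilator_quotient
  refine ⟨r, hann ▸ hr, fun f hf => ?_⟩
  have mem_iff (f : R) : f ∈ Ideal.span {a, b} ↔ (Submodule.Quotient.mk
      (Submodule.Quotient.mk f : QuotSMulTop a R) : QuotSMulTop b (QuotSMulTop a R)) = 0 := by
    rw [mk_eq_zero, Ideal.mem_span_pair]
    constructor
    · rintro ⟨c, d, rfl⟩
      refine ⟨Submodule.Quotient.mk d, ?_⟩
      rw [← Submodule.Quotient.mk_smul, ← sub_eq_zero, ← Submodule.Quotient.mk_sub, mk_eq_zero]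
      exact ⟨-c, by simp; ring⟩
    · rintro ⟨x, hx⟩
      obtain ⟨d, rfl⟩ := Submodule.Quotient.mk_surjective _ x
      rw [← Submodule.Quotient.mk_smul, ← sub_eq_zero, ← Submodule.Quotient.mk_sub,
        mk_eq_zero] at hx
      obtain ⟨c, hc⟩ := hx
      simp only [smul_eq_mul] at hc
      exact ⟨-c, d, by linear_combination -hc⟩
  rw [mem_iff] at hf ⊢
  refine (isSMulRegular_iff_right_eq_zero_of_smul.1 hreg) _ ?_
  rw [← hf]; rfl

end Depth

end

section

section RegularSequences

open RingTheory.Sequence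

/-- Every maximal ideal of `R` contains a weakly regular sequence of length `n`. -/
def MaximalIdealsContainRegular (R : Type*) [CommRing R] (n : ℕ) : Prop :=
  ∀ P : Ideal R, P.IsMaximal →
    ∃ rs : List R, rs.length = n ∧ (∀ r ∈ rs, r ∈ P) ∧ IsWeaklyRegular R rs

namespace MaximalIdealsContainRegular

theorem of_ringEquiv {R S : Type*} [CommRing R] [CommRing S] (e : R ≃+* S) {n : ℕ}
    (h : MaximalIdealsContainRegular R n) : MaximalIdealsContainRegular S n := by
  intro P hP
  obtain ⟨rs, hlen, hmem, hreg⟩ := h (P.comap e) (Ideal.comap_isMaximal_of_equiv e)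
  refine ⟨rs.map e, by simpa using hlen, by simpa using hmem, ?_⟩
  refine (AddEquiv.isWeaklyRegular_congr (e := e.toAddEquiv) (as := rs) ?_).1 hreg
  rw [List.forall₂_map_right_iff]
  exact List.forall₂_same.2 fun r _ x => by simp

theorem polynomial {R : Type*} [CommRing R] [Nontrivial R] [IsJacobsonRing R] {n : ℕ}
    (h : MaximalIdealsContainRegular R n) :
    MaximalIdealsContainRegular (Polynomial R) (n + 1) := by
  intro P hP
  have hq : (P.comap Polynomial.C).IsMaximal :=
    Polynomial.isMaximal_comap_C_of_isJacobsonRing P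
  have hne : P ≠ (P.comap Polynomial.C).map Polynomial.C := by
    intro heq
    have hmax : ((P.comap Polynomial.C).map Polynomial.C).IsMaximal := heq ▸ hP
    exact Polynomial.not_isField (R ⧸ P.comap Polynomial.C)
      (MulEquiv.isField (Ideal.Quotient.field _).toIsField
        (Ideal.polynomialQuotientEquivQuotientPolynomial (P.comap Polynomial.C)).toMulEquiv)
  obtain ⟨y, hy, hyP⟩ := Polynomial.exists_monic_span_sup_map_eq R P hq hne
  obtain ⟨rs, hlen, hmem, hreg⟩ := h _ hq
  refine ⟨rs.map (algebraMap R (Polynomial R)) ++ [y], by simp [hlen], ?_, ?_⟩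
  · intro r hr
    rw [List.mem_append, List.mem_map, List.mem_singleton] at hr
    rcases hr with ⟨s, hs, rfl⟩ | rfl
    · exact hmem s hs
    · rw [hyP]
      exact Ideal.mem_sup_right (Ideal.mem_span_singleton_self _)
  · rw [isWeaklyRegular_append_iff, isWeaklyRegular_singleton_iff]
    refine ⟨hreg.of_flat, isSMulRegular_iff_right_eq_zero_of_smul.2 fun x hx => ?_⟩
    obtain ⟨f, rfl⟩ := Submodule.Quotient.mk_surjective _ x
    rw [← Submodule.Quotient.mk_smul, Submodule.Quotient.mk_eq_zero] at hx
    rw [Submodule.Quotient.mk_eq_zero]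
    have hI : (Ideal.ofList (rs.map (algebraMap R (Polynomial R))) • ⊤ :
        Submodule (Polynomial R) (Polynomial R)) =
        RingHom.ker (Polynomial.mapRingHom (Ideal.Quotient.mk (Ideal.ofList rs))) := by
      rw [smul_eq_mul, Ideal.mul_top, ← Ideal.map_ofList, Polynomial.ker_mapRingHom,
        Ideal.mk_ker]
      rfl
    rw [hI, RingHom.mem_ker] at hx ⊢
    rw [smul_eq_mul, map_mul] at hx
    exact (hy.map _).mul_right_eq_zero_iff.1 hx

theorem mvPolynomial (K : Type*) [Field K] (n : ℕ) :
    MaximalIdealsContainRegular (MvPolynomial (Fin n) K) n := by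
  induction n with
  | zero => exact fun P _ => ⟨[], rfl, by simp, IsWeaklyRegular.nil _ _⟩
  | succ n ih => exact ih.polynomial.of_ringEquiv (MvPolynomial.finSuccEquiv K n).symm.toRingEquiv

end MaximalIdealsContainRegular

theorem ringKrullDim_le_of_isIntegral (R S : Type*) [CommRing R] [CommRing S] [Algebra R S]
    [Algebra.IsIntegral R S] : ringKrullDim S ≤ ringKrullDim R := by
  refine Order.krullDim_le_of_strictMono (PrimeSpectrum.comap (algebraMap R S)) fun p q hpq => ?_
  exact Ideal.IsIntegral.comap_lt_comap hpq

theorem isCohenMacaulayRing_of_finite_flat {T A : Type u} [CommRing T] [CommRing A] [Algebra T A]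
    [IsNoetherianRing A] [Module.Finite T A] [Module.Flat T A] {n : ℕ}
    (hT : MaximalIdealsContainRegular T n) (hdim : ringKrullDim T ≤ n) :
    IsCohenMacaulayRing A := by
  intro p hp
  obtain ⟨rs, hlen, hmem, hreg⟩ := hT (p.comap (algebraMap T A))
    (Ideal.isMaximal_comap_of_isIntegral_of_isMaximal p)
  have hregA : IsWeaklyRegular A (rs.map (algebraMap T A)) := hreg.of_flat
  have hregp := hregA.isRegular_of_isLocalization_of_mem (Localization.AtPrime p) p
    (by simpa using hmem)
  refine localRingDepth_eq_ringKrullDim_of_isRegular _ (fun r hr => ?_) hregp ?_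
  · obtain ⟨s, hs, rfl⟩ := List.mem_map.1 hr
    obtain ⟨t, ht, rfl⟩ := List.mem_map.1 hs
    exact (IsLocalization.AtPrime.to_map_mem_maximal_iff _ p _).2 (hmem t ht)
  · rw [List.length_map, List.length_map, hlen, IsLocalization.AtPrime.ringKrullDim_eq_height p]
    exact (Ideal.height_le_ringKrullDim_of_ne_top hp.ne_top).trans
      ((ringKrullDim_le_of_isIntegral T A).trans hdim)

end RegularSequences

end

section

theorem coeff_eq_zero_of_separating {T D M ι : Type*} [CommRing T] [CommRing D] [IsDomain D]
    [AddCommGroup M] [Module T M] [Fintype ι] [DecidableEq ι] {y m : ι → M}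
    {ψ : ι → M →ₗ[T] T} {c : ι → T} (hψ : ∀ i j, ψ i (m j) = if i = j then c i else 0)
    (hm : ∀ j, m j ∈ Submodule.span T (Set.range y)) (ρ : T →+* D) (hc : ∀ i, ρ (c i) ≠ 0)
    (t : ι → T) (ht : ∀ i, ρ (ψ i (∑ j, t j • y j)) = 0) (j : ι) : ρ (t j) = 0 := by
  choose n hn using fun j => (Submodule.mem_span_range_iff_exists_fun T).1 (hm j)
  let Y : Matrix ι ι T := Matrix.of fun i j => ψ i (y j)
  let N : Matrix ι ι T := Matrix.of fun k j => n j k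
  have hYN : Y * N = Matrix.diagonal c := by
    ext i j
    rw [Matrix.mul_apply, Matrix.diagonal_apply, ← hψ, ← hn j, map_sum]
    exact Finset.sum_congr rfl fun k _ => by simp [Y, N, mul_comm]
  have hdet : (Y.map ρ).det ≠ 0 := by
    have h := congrArg Matrix.det (congrArg (fun A : Matrix ι ι T => A.map ρ) hYN)
    rw [Matrix.map_mul, Matrix.det_mul, Matrix.diagonal_map (map_zero ρ),
      Matrix.det_diagonal] at h
    intro h0
    rw [h0, zero_mul] at h
    exact Finset.prod_ne_zero_iff.2 (fun i _ => hc i) h.symm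
  have hmul : (Y.map ρ).mulVec (fun j => ρ (t j)) = 0 := by
    ext i
    rw [Matrix.mulVec, dotProduct, Pi.zero_apply, ← ht i, map_sum, map_sum]
    exact Finset.sum_congr rfl fun k _ => by simp [Y, mul_comm]
  exact congrFun (Matrix.eq_zero_of_mulVec_eq_zero hdet hmul) j

end

section

/-! ### The flag triangulation of the projective plane -/

/-- The edges of the graph `G`, i.e. the missing edges of the triangulation. -/
def nonEdges : List (Fin 11 × Fin 11) :=
  [(0, 2), (0, 3), (0, 6), (0, 9), (0, 10), (1, 3), (1, 4), (1, 7), (1, 9), (1, 10), (2, 4),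
    (2, 5), (2, 7), (2, 10), (3, 5), (3, 8), (3, 10), (4, 6), (4, 8), (4, 10), (5, 7), (5, 8),
    (6, 8), (6, 9), (7, 9)]

/-- A proper colouring of the vertices of the triangulation with four colours. -/
def color : Fin 11 → Fin 4 := ![0, 1, 0, 2, 3, 2, 3, 1, 2, 1, 0]

/-- The faces of the triangulation are the independent sets of `G`. -/
def IsFace (E : Finset (Fin 11)) : Prop := ∀ p ∈ nonEdges, ¬ (p.1 ∈ E ∧ p.2 ∈ E)

instance : DecidablePred IsFace := fun _ => inferInstanceAs (Decidable (∀ p ∈ nonEdges, _))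

theorem mem_nonEdges_of_color_eq : ∀ i j, color i = color j → i ≠ j →
    (i, j) ∈ nonEdges ∨ (j, i) ∈ nonEdges := by decide

theorem IsFace.mono {E F : Finset (Fin 11)} (hF : IsFace F) (h : E ⊆ F) : IsFace E :=
  fun p hp hpE => hF p hp ⟨h hpE.1, h hpE.2⟩

/-- Sets of vertices are encoded as natural numbers, with bit `i` corresponding to vertex `i`. -/
def faceOf (m : ℕ) : Finset (Fin 11) := {i | m.testBit i}

/-- The code of the set of the vertices in a list. -/
def mask (l : List ℕ) : ℕ := l.foldr (fun i m => m ||| 1 <<< i) 0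

/-- The code of `E ∪ {k}`. -/
def addVertex (m k : ℕ) : ℕ := m ||| 1 <<< k

/-- Whether a number encodes a face. -/
def isFaceMask (m : ℕ) : Bool := nonEdges.all fun p => !(m.testBit p.1 && m.testBit p.2)

theorem mem_faceOf {m : ℕ} {i : Fin 11} : i ∈ faceOf m ↔ m.testBit i = true := by simp [faceOf]

theorem insert_faceOf (m : ℕ) (k : Fin 11) : insert k (faceOf m) = faceOf (addVertex m k) := by
  ext i
  rw [Finset.mem_insert, mem_faceOf, mem_faceOf, addVertex, Nat.testBit_or, Nat.shiftLeft_eq,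
    one_mul, Nat.testBit_two_pow, Bool.or_eq_true, decide_eq_true_iff, Fin.ext_iff]
  grind

theorem isFace_faceOf {m : ℕ} : IsFace (faceOf m) ↔ isFaceMask m = true := by
  simp [IsFace, isFaceMask, mem_faceOf, imp_iff_not_or]

/-- The codes of the edges and vertices of the triangulation, and of the empty face. -/
def smallMasks : List ℕ :=
  0 :: (List.range 11).map (1 <<< ·) ++
    ([(0, 1), (0, 4), (0, 5), (0, 7), (0, 8), (1, 2), (1, 5), (1, 6), (1, 8), (2, 3), (2, 6),
    (2, 8), (2, 9), (3, 4), (3, 6), (3, 7), (3, 9), (4, 5), (4, 7), (4, 9), (5, 6), (5, 9), (5, 10),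
    (6, 7), (6, 10), (7, 8), (7, 10), (8, 9), (8, 10), (9, 10)] :
    List (ℕ × ℕ)).map fun p => mask [p.1, p.2]

/-- The codes of the facets of the triangulation. -/
def facetMasks : List ℕ :=
  [mask [0, 1, 5], mask [0, 1, 8], mask [0, 4, 5], mask [0, 4, 7], mask [0, 7, 8], mask [1, 2, 6],
    mask [1, 2, 8], mask [1, 5, 6], mask [2, 3, 6], mask [2, 3, 9], mask [2, 8, 9], mask [3, 4, 7],
    mask [3, 4, 9], mask [3, 6, 7], mask [4, 5, 9], mask [5, 6, 10], mask [5, 9, 10],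
    mask [6, 7, 10], mask [7, 8, 10], mask [8, 9, 10]]

/-- The facets of the triangulation. -/
def facet (i : Fin 20) : Finset (Fin 11) := faceOf (facetMasks.getD i 0)

/-- The colour which does not occur in a facet. -/
def missingColor : Fin 20 → Fin 4 :=
  ![3, 3, 1, 2, 3, 2, 3, 0, 1, 3, 3, 0, 0, 0, 0, 1, 3, 2, 3, 3]

theorem IsFace.exists_mask {E : Finset (Fin 11)} (hE : IsFace E) :
    ∃ m ∈ smallMasks ++ facetMasks, faceOf m = E := by
  induction E using Finset.induction_on with
  | empty => exact ⟨0, List.mem_cons_self, by simp [faceOf]⟩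
  | insert k E _ ih =>
    obtain ⟨m, hm, rfl⟩ := ih (hE.mono (Finset.subset_insert k E))
    rw [insert_faceOf] at hE ⊢
    refine ⟨_, ?_, rfl⟩
    have h : ∀ m ∈ smallMasks ++ facetMasks, ∀ k : Fin 11, isFaceMask (addVertex m k) →
        addVertex m k ∈ smallMasks ++ facetMasks := by decide +kernel
    exact h m hm k (isFace_faceOf.1 hE)

theorem IsFace.card_le {E : Finset (Fin 11)} (hE : IsFace E) : E.card ≤ 3 := by
  obtain ⟨m, hm, rfl⟩ := hE.exists_mask
  have h : ∀ m ∈ smallMasks ++ facetMasks, (faceOf m).card ≤ 3 := by decide +kernel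
  exact h m hm

theorem isFace_facet (i : Fin 20) : IsFace (facet i) := by
  have h : ∀ i : Fin 20, isFaceMask (facetMasks.getD i 0) := by decide +kernel
  exact isFace_faceOf.2 (h i)

section FaceMonomials

variable {A : Type*} [CommRing A]

/-- The product of the variables in `E`. -/
def faceMonomial (x : Fin 11 → A) (E : Finset (Fin 11)) : A := ∏ i ∈ E, x i

/-- The sum of the variables of colour `p`. -/
def colorSum (x : Fin 11 → A) (p : Fin 4) : A := ∑ i with color i = p, x i

variable {x : Fin 11 → A} (hx : ∀ p ∈ nonEdges, x p.1 * x p.2 = 0)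

include hx

theorem faceMonomial_eq_zero {E : Finset (Fin 11)} (hE : ¬ IsFace E) : faceMonomial x E = 0 := by
  simp only [IsFace, not_forall, not_not] at hE
  obtain ⟨p, hp, h1, h2⟩ := hE
  have hne : p.1 ≠ p.2 := by
    exact (by decide +kernel : ∀ p ∈ nonEdges, p.1 ≠ p.2) p hp
  have hdvd : ∏ i ∈ {p.1, p.2}, x i ∣ faceMonomial x E :=
    Finset.prod_dvd_prod_of_subset _ _ _ (by
      intro i hi
      rcases Finset.mem_insert.1 hi with rfl | hi
      · exact h1
      · rw [Finset.mem_singleton.1 hi]; exact h2)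
  rw [Finset.prod_pair hne, hx p hp] at hdvd
  exact zero_dvd_iff.1 hdvd

theorem faceMonomial_mul_colorSum {E : Finset (Fin 11)} {p : Fin 4} (hE : ∀ i ∈ E, color i ≠ p) :
    faceMonomial x E * colorSum x p =
      ∑ k with color k = p ∧ IsFace (insert k E), faceMonomial x (insert k E) := by
  rw [colorSum, Finset.mul_sum, ← Finset.filter_filter,
    Finset.sum_filter (fun k => IsFace (insert k E))]
  refine Finset.sum_congr rfl fun k hk => ?_
  have hkE : k ∉ E := fun h => hE k h (Finset.mem_filter.1 hk).2
  have : faceMonomial x E * x k = faceMonomial x (insert k E) := by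
    rw [faceMonomial, faceMonomial, Finset.prod_insert hkE, mul_comm]
  rw [this]
  split_ifs with h
  · rfl
  · exact faceMonomial_eq_zero hx h

theorem faceMonomial_mul_colorSum_color {E : Finset (Fin 11)} {k : Fin 11} (hk : k ∈ E) :
    faceMonomial x E * colorSum x (color k) = faceMonomial x E * x k := by
  rw [colorSum, Finset.mul_sum]
  refine Finset.sum_eq_single_of_mem k (by simp) fun j hj hjk => ?_
  obtain ⟨c, hc⟩ : x k ∣ faceMonomial x E := Finset.dvd_prod_of_mem x hk
  have hkj : x k * x j = 0 := by
    rcases mem_nonEdges_of_color_eq j k (Finset.mem_filter.1 hj).2 hjk with h | h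
    · rw [mul_comm]; exact hx _ h
    · exact hx _ h
  rw [hc, mul_right_comm, hkj, zero_mul]

theorem faceMonomial_mul_mem {B : Finset (Fin 11)} (W : AddSubgroup A)
    (hW : ∀ E, IsFace E → B ⊆ E → faceMonomial x E ∈ W)
    (hθ : ∀ w ∈ W, ∀ p q, w * (colorSum x p - colorSum x q) ∈ W)
    {E : Finset (Fin 11)} (hE : IsFace E) (hB : B ⊆ E) (k : Fin 11) :
    faceMonomial x E * x k ∈ W := by
  by_cases hk : k ∈ E
  · obtain ⟨q, hq⟩ : ∃ q, q ∉ E.image color := by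
      by_contra! h
      have := Finset.card_le_card (fun q _ => h q : Finset.univ ⊆ E.image color)
      rw [Finset.card_univ, Fintype.card_fin] at this
      have h2 := Finset.card_image_le (s := E) (f := color)
      have h3 := hE.card_le
      lia
    have h1 := hθ _ (hW E hE hB) (color k) q
    have hq' : ∀ i ∈ E, color i ≠ q := fun i hi h => hq (h ▸ Finset.mem_image_of_mem _ hi)
    rw [mul_sub, faceMonomial_mul_colorSum_color hx hk, faceMonomial_mul_colorSum hx hq'] at h1
    refine (sub_add_cancel (faceMonomial x E * x k) _) ▸ W.add_mem h1 (W.sum_mem fun j hj => ?_)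
    exact hW _ (Finset.mem_filter.1 hj).2.2 (hB.trans (Finset.subset_insert _ _))
  · have : faceMonomial x E * x k = faceMonomial x (insert k E) := by
      rw [faceMonomial, faceMonomial, Finset.prod_insert hk, mul_comm]
    rw [this]
    by_cases h : IsFace (insert k E)
    · exact hW _ h (hB.trans (Finset.subset_insert _ _))
    · rw [faceMonomial_eq_zero hx h]
      exact W.zero_mem

/-- If all but one of the terms of `x_E (σ_p - σ_q)` lie in `W`, then so does the last one. -/
theorem faceMonomial_mem_of_others (W : AddSubgroup A) {E : Finset (Fin 11)} {k : Fin 11}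
    {q : Fin 4} (hE : ∀ i ∈ E, color i ≠ color k ∧ color i ≠ q) (hq : color k ≠ q)
    (hθ : faceMonomial x E * (colorSum x (color k) - colorSum x q) ∈ W)
    (hW : ∀ j, j ≠ k → (color j = color k ∨ color j = q) → IsFace (insert j E) →
      faceMonomial x (insert j E) ∈ W) : faceMonomial x (insert k E) ∈ W := by
  by_cases hk : IsFace (insert k E)
  swap
  · rw [faceMonomial_eq_zero hx hk]; exact W.zero_mem
  rw [mul_sub, faceMonomial_mul_colorSum hx fun i hi => (hE i hi).1,
    faceMonomial_mul_colorSum hx fun i hi => (hE i hi).2] at hθ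
  have h1 := W.add_mem hθ (W.sum_mem (f := fun j => faceMonomial x (insert j E))
    (t := {j | color j = q ∧ IsFace (insert j E)}) fun j hj => ?_)
  · rw [sub_add_cancel, ← Finset.add_sum_erase _ _ (a := k) (by simp [hk])] at h1
    refine (W.add_mem_cancel_right (W.sum_mem fun j hj => ?_)).1 h1
    simp only [Finset.mem_erase, Finset.mem_filter] at hj
    exact hW j hj.1 (Or.inl hj.2.2.1) hj.2.2.2
  · simp only [Finset.mem_filter] at hj
    exact hW j (by rintro rfl; exact hq hj.2.1) (Or.inr hj.2.1) hj.2.2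

end FaceMonomials

end

section

/-- Codes of faces whose monomials form a basis of the face ring over its parameter ring. -/
def basisMasks : List ℕ :=
  [mask [], mask [0], mask [1], mask [2], mask [3], mask [4], mask [5], mask [6], mask [7],
    mask [0, 7], mask [2, 6], mask [4, 7], mask [4, 5], mask [1, 2], mask [0, 1], mask [7, 10],
    mask [3, 6], mask [7, 8], mask [5, 9], mask [0, 5]]

/-- Codes of faces whose monomials generate the ideal of the vertex `4`. -/
def starMasksFour : List ℕ :=
  [mask [4], mask [0, 4], mask [4, 9], mask [4, 5], mask [0, 4, 5]]

/-- Codes of faces whose monomials generate the ideal of the vertex `10`. -/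
def starMasksTen : List ℕ :=
  [mask [10], mask [6, 10], mask [5, 10], mask [7, 10], mask [5, 6, 10]]

/-- A step `(E, k, q)` deduces `x_{E ∪ {k}}` from the relation `x_E (σ_p - σ_q)`, where `p` is the
colour of `k`; it is valid if all the other monomials occurring in the relation are known. -/
def stepsValid : List ℕ → List (ℕ × Fin 11 × Fin 4) → Bool
  | _, [] => true
  | known, (m, k, q) :: steps =>
    known.contains m &&
    (List.finRange 11).all (fun i => !m.testBit i || (color i != color k && color i != q)) &&
    (color k != q) &&
    (List.finRange 11).all (fun j => j == k || !(color j == color k || color j == q) ||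
      !isFaceMask (addVertex m j) || known.contains (addVertex m j)) &&
    stepsValid (addVertex m k :: known) steps

/-- The codes obtained by a list of steps. -/
def stepsOutput (steps : List (ℕ × Fin 11 × Fin 4)) : List ℕ :=
  steps.map fun s => addVertex s.1 s.2.1

section

variable {A : Type*} [CommRing A] {x : Fin 11 → A} (hx : ∀ p ∈ nonEdges, x p.1 * x p.2 = 0)

include hx

theorem faceMonomial_mem_of_stepsValid (W : AddSubgroup A)
    (hθ : ∀ w ∈ W, ∀ p q, w * (colorSum x p - colorSum x q) ∈ W) :
    ∀ (steps : List (ℕ × Fin 11 × Fin 4)) (known : List ℕ),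
      stepsValid known steps = true → (∀ m ∈ known, faceMonomial x (faceOf m) ∈ W) →
      ∀ m ∈ known ++ stepsOutput steps, faceMonomial x (faceOf m) ∈ W
  | [], known, _, hk, m, hm => hk m (by simpa [stepsOutput] using hm)
  | (m, k, q) :: steps, known, hv, hk, n, hn => by
    simp only [stepsValid, Bool.and_eq_true, List.all_eq_true, List.mem_finRange, true_imp_iff,
      Bool.or_eq_true, Bool.not_eq_true', bne_iff_ne, beq_iff_eq, List.contains_iff_mem] at hv
    obtain ⟨⟨⟨⟨h1, h2⟩, h3⟩, h4⟩, h5⟩ := hv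
    refine faceMonomial_mem_of_stepsValid W hθ steps (addVertex m k :: known) h5 ?_ n ?_
    · intro l hl
      rcases List.mem_cons.1 hl with rfl | hl
      · rw [← insert_faceOf]
        refine faceMonomial_mem_of_others hx W (q := q) (fun i hi => ?_) h3 (hθ _ (hk m h1) _ _)
          fun j hjk hj hf => ?_
        · have := h2 i
          rw [mem_faceOf.1 hi] at this
          simpa using this
        · rw [insert_faceOf] at hf ⊢
          rw [isFace_faceOf] at hf
          refine hk _ (((h4 j).resolve_left ?_))
          rintro ((h | h) | h)
          · exact hjk h
          · simp at h
            tauto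
          · simp [h] at hf
      · exact hk l hl
    · simp only [stepsOutput, List.map_cons, List.mem_append, List.mem_cons] at hn ⊢
      tauto

theorem faceMonomial_sub_mem (W : AddSubgroup A) (m : ℕ) (k l : Fin 11)
    (hθ : ∀ p q, faceMonomial x (faceOf m) * (colorSum x p - colorSum x q) ∈ W)
    (hm : ∀ i : Fin 11, m.testBit i → color i ≠ color k ∧ color i ≠ color l)
    (hk : ∀ j, color j = color k ∧ isFaceMask (addVertex m j) ↔ j = k)
    (hl : ∀ j, color j = color l ∧ isFaceMask (addVertex m j) ↔ j = l) :
    faceMonomial x (faceOf (addVertex m k)) - faceMonomial x (faceOf (addVertex m l)) ∈ W := by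
  have h := hθ (color k) (color l)
  rw [mul_sub, faceMonomial_mul_colorSum hx fun i hi => (hm i (mem_faceOf.1 hi)).1,
    faceMonomial_mul_colorSum hx fun i hi => (hm i (mem_faceOf.1 hi)).2] at h
  simpa only [insert_faceOf, isFace_faceOf, hk, hl, Finset.filter_eq', Finset.mem_univ, if_true,
    Finset.sum_singleton] using h

theorem faceMonomial_add_mem (W : AddSubgroup A) (m : ℕ) (k l : Fin 11) (q : Fin 4)
    (hθ : ∀ p q, faceMonomial x (faceOf m) * (colorSum x p - colorSum x q) ∈ W)
    (hm : ∀ i : Fin 11, m.testBit i → color i ≠ color k ∧ color i ≠ q) (hkl : k ≠ l)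
    (hk : ∀ j, color j = color k ∧ isFaceMask (addVertex m j) ↔ j = k ∨ j = l)
    (hl : ∀ j, ¬ (color j = q ∧ isFaceMask (addVertex m j))) :
    faceMonomial x (faceOf (addVertex m k)) + faceMonomial x (faceOf (addVertex m l)) ∈ W := by
  have h := hθ (color k) q
  rw [mul_sub, faceMonomial_mul_colorSum hx fun i hi => (hm i (mem_faceOf.1 hi)).1,
    faceMonomial_mul_colorSum hx fun i hi => (hm i (mem_faceOf.1 hi)).2] at h
  simpa only [insert_faceOf, isFace_faceOf, hk, hl, Finset.filter_false, Finset.sum_empty, sub_zero,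
    Finset.filter_or, Finset.filter_eq', Finset.mem_univ, if_true, Finset.singleton_union,
    Finset.sum_pair hkl] using h

/-- Walking around an orientation reversing loop of triangles. -/
theorem two_mul_faceMonomial_mem (W : AddSubgroup A)
    (hθ : ∀ m ∈ smallMasks, 2 ≤ (faceOf m).card → ∀ p q,
      faceMonomial x (faceOf m) * (colorSum x p - colorSum x q) ∈ W) :
    2 * faceMonomial x (faceOf (mask [0, 1, 5])) ∈ W := by
  have h1 := faceMonomial_add_mem hx W (mask [0, 1]) 5 8 3
    (hθ _ (by decide +kernel) (by decide +kernel)) (by decide +kernel)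
    (by decide +kernel) (by decide +kernel) (by decide +kernel)
  have h2 := faceMonomial_add_mem hx W (mask [0, 8]) 1 7 3
    (hθ _ (by decide +kernel) (by decide +kernel)) (by decide +kernel)
    (by decide +kernel) (by decide +kernel) (by decide +kernel)
  have h3 := faceMonomial_add_mem hx W (mask [7, 8]) 0 10 3
    (hθ _ (by decide +kernel) (by decide +kernel)) (by decide +kernel)
    (by decide +kernel) (by decide +kernel) (by decide +kernel)
  have h4 := faceMonomial_sub_mem hx W (mask [7, 10]) 8 6
    (hθ _ (by decide +kernel) (by decide +kernel))
    (by decide +kernel) (by decide +kernel) (by decide +kernel)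
  have h5 := faceMonomial_sub_mem hx W (mask [6, 10]) 7 5
    (hθ _ (by decide +kernel) (by decide +kernel))
    (by decide +kernel) (by decide +kernel) (by decide +kernel)
  have h6 := faceMonomial_sub_mem hx W (mask [5, 6]) 10 1
    (hθ _ (by decide +kernel) (by decide +kernel))
    (by decide +kernel) (by decide +kernel) (by decide +kernel)
  have h7 := faceMonomial_sub_mem hx W (mask [1, 5]) 6 0
    (hθ _ (by decide +kernel) (by decide +kernel))
    (by decide +kernel) (by decide +kernel) (by decide +kernel)
  convert W.sub_mem h1 (W.sub_mem h2 (W.sub_mem h3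
    (W.add_mem h4 (W.add_mem h5 (W.add_mem h6 h7))))) using 1
  have e (a b : ℕ) (h : a = b) : faceMonomial x (faceOf a) = faceMonomial x (faceOf b) := by rw [h]
  rw [e (addVertex (mask [0, 8]) (1 : Fin 11)) (addVertex (mask [0, 1]) (8 : Fin 11)) rfl,
    e (addVertex (mask [7, 8]) (0 : Fin 11)) (addVertex (mask [0, 8]) (7 : Fin 11)) rfl,
    e (addVertex (mask [7, 10]) (8 : Fin 11)) (addVertex (mask [7, 8]) (10 : Fin 11)) rfl,
    e (addVertex (mask [6, 10]) (7 : Fin 11)) (addVertex (mask [7, 10]) (6 : Fin 11)) rfl,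
    e (addVertex (mask [5, 6]) (10 : Fin 11)) (addVertex (mask [6, 10]) (5 : Fin 11)) rfl,
    e (addVertex (mask [1, 5]) (6 : Fin 11)) (addVertex (mask [5, 6]) (1 : Fin 11)) rfl,
    e (addVertex (mask [1, 5]) (0 : Fin 11)) (mask [0, 1, 5]) rfl,
    e (addVertex (mask [0, 1]) (5 : Fin 11)) (mask [0, 1, 5]) rfl]
  ring

theorem faceMonomial_mem_of_basisMasks (W : AddSubgroup A) (h2 : ∀ w, 2 * w ∈ W → w ∈ W)
    (hθ : ∀ w ∈ W, ∀ p q, w * (colorSum x p - colorSum x q) ∈ W)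
    (hW : ∀ m ∈ basisMasks, faceMonomial x (faceOf m) ∈ W) {E : Finset (Fin 11)}
    (hE : IsFace E) : faceMonomial x E ∈ W := by
  have hs : ∀ m ∈ smallMasks, faceMonomial x (faceOf m) ∈ W := fun m hm =>
    faceMonomial_mem_of_stepsValid hx W hθ
      [(mask [], 8, 3), (mask [], 9, 2), (mask [], 10, 1), (mask [0], 4, 1), (mask [0], 8, 1),
      (mask [1], 6, 0), (mask [2], 9, 3), (mask [4], 3, 0), (mask [4], 9, 0), (mask [7], 3, 0),
      (mask [7], 6, 0), (mask [3], 2, 3), (mask [3], 9, 0), (mask [6], 5, 1), (mask [6], 10, 1),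
      (mask [9], 8, 3), (mask [9], 10, 2), (mask [2], 8, 1), (mask [5], 1, 3), (mask [5], 10, 1),
      (mask [8], 1, 3), (mask [8], 10, 1)]
      basisMasks (by decide +kernel) hW m
      ((by decide +kernel : smallMasks ⊆ basisMasks ++ stepsOutput _) hm)
  have h3 := h2 _ (two_mul_faceMonomial_mem hx W fun m hm _ => hθ _ (hs m hm))
  obtain ⟨m, hm, rfl⟩ := hE.exists_mask
  refine faceMonomial_mem_of_stepsValid hx W hθ
    [(mask [0, 1], 8, 3), (mask [0, 5], 4, 1), (mask [0, 4], 7, 2), (mask [0, 7], 8, 3),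
    (mask [1, 5], 6, 0), (mask [1, 6], 2, 2), (mask [1, 8], 2, 3), (mask [2, 6], 3, 1),
    (mask [2, 8], 9, 3), (mask [2, 9], 3, 3), (mask [3, 6], 7, 0), (mask [3, 7], 4, 0),
    (mask [3, 9], 4, 0), (mask [4, 5], 9, 0), (mask [5, 6], 10, 1), (mask [5, 9], 10, 3),
    (mask [6, 7], 10, 2), (mask [7, 8], 10, 3), (mask [8, 9], 10, 3)]
    (mask [0, 1, 5] :: smallMasks) (by decide +kernel) (List.forall_mem_cons.2 ⟨h3, hs⟩) m ?_
  exact (by decide +kernel : smallMasks ++ facetMasks ⊆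
    mask [0, 1, 5] :: smallMasks ++ stepsOutput _) hm

theorem faceMonomial_mem_of_star_four (W : AddSubgroup A)
    (hθ : ∀ w ∈ W, ∀ p q, w * (colorSum x p - colorSum x q) ∈ W)
    (hW : ∀ m ∈ starMasksFour, faceMonomial x (faceOf m) ∈ W) {E : Finset (Fin 11)} (hE : IsFace E)
    (h : 4 ∈ E) : faceMonomial x E ∈ W := by
  obtain ⟨m, hm, rfl⟩ := hE.exists_mask
  refine faceMonomial_mem_of_stepsValid hx W hθ
    [(mask [4], 3, 0), (mask [4], 7, 0), (mask [0, 4], 7, 2), (mask [4, 5], 9, 0),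
    (mask [4, 9], 3, 0), (mask [3, 4], 7, 0)]
    starMasksFour (by decide +kernel) hW m ?_
  exact (by decide +kernel : ∀ m ∈ smallMasks ++ facetMasks, m.testBit 4 →
    m ∈ starMasksFour ++ stepsOutput _) m hm (mem_faceOf.1 h)

theorem faceMonomial_mem_of_star_ten (W : AddSubgroup A)
    (hθ : ∀ w ∈ W, ∀ p q, w * (colorSum x p - colorSum x q) ∈ W)
    (hW : ∀ m ∈ starMasksTen, faceMonomial x (faceOf m) ∈ W) {E : Finset (Fin 11)} (hE : IsFace E)
    (h : 10 ∈ E) : faceMonomial x E ∈ W := by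
  obtain ⟨m, hm, rfl⟩ := hE.exists_mask
  refine faceMonomial_mem_of_stepsValid hx W hθ
    [(mask [10], 8, 3), (mask [10], 9, 2), (mask [6, 10], 7, 2), (mask [5, 10], 9, 3),
    (mask [7, 10], 8, 3), (mask [8, 10], 9, 3)]
    starMasksTen (by decide +kernel) hW m ?_
  exact (by decide +kernel : ∀ m ∈ smallMasks ++ facetMasks, m.testBit 10 →
    m ∈ starMasksTen ++ stepsOutput _) m hm (mem_faceOf.1 h)

end

end

section

/-! ### The face ring of the triangulation as a module over its parameter ring -/

open MvPolynomial

variable (K : Type u) [Field K]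

/-- The edge ideal of `G`. -/
noncomputable def edgeIdeal : Ideal (MvPolynomial (Fin 11) K) :=
  Ideal.span {f | ∃ p ∈ nonEdges, X p.1 * X p.2 = f}

/-- The quotient by the edge ideal of `G`, which is the face ring of the triangulation. -/
def EdgeRing : Type u := MvPolynomial (Fin 11) K ⧸ edgeIdeal K

namespace EdgeRing

noncomputable instance : CommRing (EdgeRing K) :=
  inferInstanceAs (CommRing (MvPolynomial (Fin 11) K ⧸ edgeIdeal K))

noncomputable instance : Algebra K (EdgeRing K) :=
  inferInstanceAs (Algebra K (MvPolynomial (Fin 11) K ⧸ edgeIdeal K))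

/-- The quotient map onto the face ring. -/
noncomputable def mk : MvPolynomial (Fin 11) K →ₐ[K] EdgeRing K :=
  Ideal.Quotient.mkₐ K (edgeIdeal K)

theorem mk_surjective : Function.Surjective (mk K) := Ideal.Quotient.mk_surjective

variable {K} in
theorem mk_eq_zero_iff {f : MvPolynomial (Fin 11) K} : mk K f = 0 ↔ f ∈ edgeIdeal K :=
  Ideal.Quotient.eq_zero_iff_mem

/-- The variables of the face ring. -/
noncomputable def x (i : Fin 11) : EdgeRing K := mk K (X i)

theorem mk_X (i : Fin 11) : mk K (X i) = x K i := rfl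

theorem x_mul_x : ∀ p ∈ nonEdges, x K p.1 * x K p.2 = 0 := fun p hp => by
  rw [x, x, ← map_mul]
  exact mk_eq_zero_iff.2 (Ideal.subset_span ⟨p, hp, rfl⟩)

/-- A linear system of parameters of the face ring. -/
noncomputable def linearParameter : Fin 3 → MvPolynomial (Fin 11) K :=
  ![colorSum X 1 - colorSum X 3 - 2 * (colorSum X 0 - colorSum X 3),
    colorSum X 2 - colorSum X 3 + (colorSum X 0 - colorSum X 3),
    colorSum X 0 - colorSum X 3]

/-- The preimages of `σ_p - σ_3` in the parameter ring. -/
noncomputable def colorParameter : Fin 4 → MvPolynomial (Fin 3) K :=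
  ![X 2, X 0 + 2 * X 2, X 1 - X 2, 0]

noncomputable instance : Algebra (MvPolynomial (Fin 3) K) (EdgeRing K) :=
  ((mk K).comp (aeval (linearParameter K))).toRingHom.toAlgebra

theorem algebraMap_X (i : Fin 3) : algebraMap (MvPolynomial (Fin 3) K) (EdgeRing K) (X i) =
    mk K (linearParameter K i) := by
  simp [RingHom.algebraMap_toAlgebra]

theorem mk_colorSum (p : Fin 4) :
    mk K (colorSum X p) = colorSum (x K) p := by
  simp [colorSum, x]

theorem algebraMap_colorParameter (p : Fin 4) : algebraMap (MvPolynomial (Fin 3) K) (EdgeRing K)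
    (colorParameter K p) = colorSum (x K) p - colorSum (x K) 3 := by
  have h2 : algebraMap (MvPolynomial (Fin 3) K) (EdgeRing K) 2 = 2 := map_ofNat _ 2
  have h3 : mk K 2 = 2 := map_ofNat _ 2
  fin_cases p <;>
    simp [colorParameter, algebraMap_X, linearParameter, mk_colorSum, h2, h3]

variable {K}

theorem algebraMap_C (c : K) : algebraMap (MvPolynomial (Fin 3) K) (EdgeRing K) (C c) =
    algebraMap K (EdgeRing K) c := by
  simp [RingHom.algebraMap_toAlgebra]

theorem mul_mem_of_forall_mul_x_mem (W : Submodule (MvPolynomial (Fin 3) K) (EdgeRing K))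
    (hW : ∀ w ∈ W, ∀ k, w * x K k ∈ W) {w : EdgeRing K} (hw : w ∈ W) (a : EdgeRing K) :
    w * a ∈ W := by
  obtain ⟨f, rfl⟩ := mk_surjective K a
  induction f using MvPolynomial.induction_on with
  | C c =>
    rw [← MvPolynomial.algebraMap_eq, AlgHom.commutes, ← algebraMap_C, mul_comm, ← Algebra.smul_def]
    exact W.smul_mem _ hw
  | add f g hf hg =>
    rw [map_add, mul_add]
    exact W.add_mem hf hg
  | mul_X f i hf =>
    rw [map_mul, mk_X, ← mul_assoc]
    exact hW _ hf i

theorem mul_colorSum_sub_mem (W : Submodule (MvPolynomial (Fin 3) K) (EdgeRing K)) :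
    ∀ w ∈ W.toAddSubgroup, ∀ p q, w * (colorSum (x K) p - colorSum (x K) q) ∈ W.toAddSubgroup := by
  intro w hw p q
  have h : colorSum (x K) p - colorSum (x K) q = algebraMap (MvPolynomial (Fin 3) K) (EdgeRing K)
      (colorParameter K p - colorParameter K q) := by
    rw [map_sub, algebraMap_colorParameter, algebraMap_colorParameter]
    ring
  rw [h, mul_comm, ← Algebra.smul_def]
  exact W.smul_mem _ hw

theorem mem_of_two_mul_mem [CharZero K] (W : Submodule (MvPolynomial (Fin 3) K) (EdgeRing K))
    (w : EdgeRing K) (hw : 2 * w ∈ W) : w ∈ W := by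
  have h := W.smul_mem (C (2⁻¹ : K)) hw
  rwa [Algebra.smul_def, algebraMap_C, ← mul_assoc, ← map_ofNat (algebraMap K (EdgeRing K)) 2,
    ← map_mul, inv_mul_cancel₀ two_ne_zero, map_one, one_mul] at h

/-- The face monomials with exponents in a list of masks. -/
noncomputable def maskMonomial (K : Type u) [Field K] (L : List ℕ) (i : Fin L.length) :
    EdgeRing K :=
  faceMonomial (x K) (faceOf (L.get i))

/-- The span of the monomials of a list of faces over the parameter ring. -/
noncomputable def maskSpan (K : Type u) [Field K] (L : List ℕ) :
    Submodule (MvPolynomial (Fin 3) K) (EdgeRing K) :=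
  Submodule.span _ (Set.range (maskMonomial K L))

theorem maskMonomial_mem_span (L : List ℕ) {m : ℕ} (hm : m ∈ L) :
    faceMonomial (x K) (faceOf m) ∈
      maskSpan K L := by
  obtain ⟨i, rfl⟩ := List.get_of_mem hm
  exact Submodule.subset_span ⟨i, rfl⟩

/-- A span of face monomials containing all faces containing `B` is an ideal. -/
theorem mul_mem_span (L : List ℕ) (B : Finset (Fin 11)) (hLB : ∀ m ∈ L, isFaceMask m ∧ B ⊆ faceOf m)
    (hL : ∀ E, IsFace E → B ⊆ E → faceMonomial (x K) E ∈
      maskSpan K L)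
    {w : EdgeRing K}
    (hw : w ∈ maskSpan K L)
    (a : EdgeRing K) :
    w * a ∈ maskSpan K L := by
  refine mul_mem_of_forall_mul_x_mem _ (fun w hw k => ?_) hw a
  induction hw using Submodule.span_induction with
  | mem w hw =>
    obtain ⟨i, rfl⟩ := hw
    obtain ⟨h1, h2⟩ := hLB _ (L.get_mem i)
    exact faceMonomial_mul_mem (x_mul_x K) (maskSpan K L).toAddSubgroup hL (mul_colorSum_sub_mem _)
      (isFace_faceOf.2 h1) h2 k
  | zero => rw [zero_mul]; exact zero_mem _
  | add v w _ _ hv hw => rw [add_mul]; exact add_mem hv hw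
  | smul t w _ hw => rw [smul_mul_assoc]; exact Submodule.smul_mem _ _ hw

theorem span_basisMasks [CharZero K] :
    maskSpan K basisMasks = ⊤ := by
  refine eq_top_iff.2 fun a _ => one_mul a ▸ ?_
  have h1 : ∀ E, IsFace E → faceMonomial (x K) E ∈
      maskSpan K basisMasks := fun E hE =>
    faceMonomial_mem_of_basisMasks (x_mul_x K) (maskSpan K basisMasks).toAddSubgroup
      (mem_of_two_mul_mem _) (mul_colorSum_sub_mem _) (fun m hm => maskMonomial_mem_span _ hm) hE
  refine mul_mem_span basisMasks ∅ (by decide +kernel) (fun E hE _ => h1 E hE) ?_ a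
  simpa [faceMonomial] using h1 ∅ (by decide +kernel)

theorem mem_span_starMasksFour (a : EdgeRing K) : x K 4 * a ∈
    maskSpan K starMasksFour := by
  have h1 : ∀ E, IsFace E → {4} ⊆ E → faceMonomial (x K) E ∈
      maskSpan K starMasksFour :=
    fun E hE h => faceMonomial_mem_of_star_four (x_mul_x K) (maskSpan K starMasksFour).toAddSubgroup
      (mul_colorSum_sub_mem _) (fun m hm => maskMonomial_mem_span _ hm) hE
      (Finset.singleton_subset_iff.1 h)
  refine mul_mem_span starMasksFour {4} (by decide +kernel) h1 ?_ a
  simpa [faceMonomial] using h1 {4} (by decide +kernel) subset_rfl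

theorem mem_span_starMasksTen (a : EdgeRing K) : x K 10 * a ∈
    maskSpan K starMasksTen := by
  have h1 : ∀ E, IsFace E → {10} ⊆ E → faceMonomial (x K) E ∈
      maskSpan K starMasksTen :=
    fun E hE h => faceMonomial_mem_of_star_ten (x_mul_x K) (maskSpan K starMasksTen).toAddSubgroup
      (mul_colorSum_sub_mem _) (fun m hm => maskMonomial_mem_span _ hm) hE
      (Finset.singleton_subset_iff.1 h)
  refine mul_mem_span starMasksTen {10} (by decide +kernel) h1 ?_ a
  simpa [faceMonomial] using h1 {10} (by decide +kernel) subset_rfl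

end EdgeRing

end

section

open MvPolynomial

namespace EdgeRing

variable (K : Type u) [Field K]

/-- The evaluation of the face ring at the facet `i`, with values in the parameter ring. -/
noncomputable def facetValue (i : Fin 20) (k : Fin 11) : MvPolynomial (Fin 3) K :=
  if k ∈ facet i then colorParameter K (color k) - colorParameter K (missingColor i) else 0

theorem aeval_facetValue_eq_zero (i : Fin 20) {f : MvPolynomial (Fin 11) K} (hf : f ∈ edgeIdeal K) :
    aeval (facetValue K i) f = 0 := by
  have h : edgeIdeal K ≤ RingHom.ker (aeval (facetValue K i) : _ →ₐ[K] MvPolynomial (Fin 3) K) := by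
    refine Ideal.span_le.2 ?_
    rintro _ ⟨p, hp, rfl⟩
    have := isFace_facet i p hp
    simp only [SetLike.mem_coe, RingHom.mem_ker, map_mul, aeval_X, facetValue]
    split_ifs <;> simp_all
  exact h hf

theorem sum_facetValue (i : Fin 20) (p : Fin 4) : colorSum (facetValue K i) p =
    colorParameter K p - colorParameter K (missingColor i) := by
  have h : ∀ i : Fin 20, ∀ p : Fin 4, p = missingColor i ∨
      ({k | color k = p ∧ k ∈ facet i} : Finset (Fin 11)).card = 1 := by decide +kernel
  have h1 : colorSum (facetValue K i) p = ∑ k with color k = p ∧ k ∈ facet i,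
      (colorParameter K p - colorParameter K (missingColor i)) := by
    rw [colorSum, ← Finset.filter_filter, Finset.sum_filter (fun k => k ∈ facet i)]
    refine Finset.sum_congr rfl fun k hk => ?_
    rw [facetValue, (Finset.mem_filter.1 hk).2]
  rw [h1, Finset.sum_const]
  rcases h i p with h | h
  · rw [h, sub_self, smul_zero]
  · rw [h, one_smul]

theorem aeval_facetValue_linearParameter (i : Fin 20) (j : Fin 3) :
    aeval (facetValue K i) (linearParameter K j) = X j := by
  have h (p : Fin 4) : aeval (facetValue K i) (colorSum (X : _ → MvPolynomial (Fin 11) K) p) =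
      colorParameter K p - colorParameter K (missingColor i) := by
    rw [← sum_facetValue, colorSum, colorSum, map_sum]
    simp
  fin_cases j <;> simp [linearParameter, h, -aeval_eq_bind₁] <;> simp [colorParameter]

/-- The evaluation of the face ring at a facet. -/
noncomputable def facetEval (i : Fin 20) :
    EdgeRing K →ₐ[MvPolynomial (Fin 3) K] MvPolynomial (Fin 3) K :=
  let φ : EdgeRing K →ₐ[K] MvPolynomial (Fin 3) K :=
    Ideal.Quotient.liftₐ (edgeIdeal K) (aeval (facetValue K i))
      fun _ hf => aeval_facetValue_eq_zero K i hf
  { φ with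
    commutes' := fun t => by
      have h : (φ.comp ((mk K).comp (aeval (linearParameter K)))) = AlgHom.id K _ := by
        ext1 j
        simp only [AlgHom.comp_apply, aeval_X, AlgHom.id_apply]
        exact aeval_facetValue_linearParameter K i j
      exact DFunLike.congr_fun h t }

theorem facetEval_x (i : Fin 20) (k : Fin 11) : facetEval K i (x K k) = facetValue K i k :=
  aeval_X _ _

theorem facetEval_faceMonomial_facet (i j : Fin 20) :
    facetEval K i (faceMonomial (x K) (facet j)) = if i = j then ∏ k ∈ facet i,
      (colorParameter K (color k) - colorParameter K (missingColor i)) else 0 := by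
  simp only [faceMonomial, map_prod, facetEval_x]
  split_ifs with h
  · subst h
    exact Finset.prod_congr rfl fun k hk => if_pos hk
  · have h1 : ∀ i j : Fin 20, i ≠ j → ∃ k ∈ facet j, k ∉ facet i := by decide +kernel
    obtain ⟨k, hk, hk'⟩ := h1 i j h
    exact Finset.prod_eq_zero hk (if_neg hk')

variable {K}

theorem coeff_eq_zero_of_facetEval {D : Type*} [CommRing D] [IsDomain D] {L : List ℕ}
    (s : Fin L.length → Fin 20) (hs : Function.Injective s)
    (hspan : ∀ j, faceMonomial (x K) (facet (s j)) ∈ maskSpan K L)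
    (ρ : MvPolynomial (Fin 3) K →+* D)
    (hρ : Function.Injective fun p => ρ (colorParameter K p))
    (c : Fin L.length → MvPolynomial (Fin 3) K)
    (hc : ∀ i, ρ (facetEval K (s i) (∑ j, c j • maskMonomial K L j)) = 0) (j) : ρ (c j) = 0 := by
  refine coeff_eq_zero_of_separating
    (ψ := fun i => (facetEval K (s i)).toLinearMap)
    (m := fun j => faceMonomial (x K) (facet (s j)))
    (c := fun i => ∏ k ∈ facet (s i),
      (colorParameter K (color k) - colorParameter K (missingColor (s i))))
    (fun i j => ?_) hspan ρ (fun i => ?_) c hc j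
  · simp [facetEval_faceMonomial_facet, hs.eq_iff]
  · have h : ∀ i : Fin 20, ∀ k ∈ facet i, color k ≠ missingColor i := by decide +kernel
    rw [map_prod]
    refine Finset.prod_ne_zero_iff.2 fun k hk => ?_
    rw [map_sub, sub_ne_zero]
    exact hρ.ne (h _ k hk)

theorem injective_aeval_colorParameter [CharZero K] {g : Fin 3 → MvPolynomial (Fin 3) K}
    (hg : ∀ i, eval ![0, 0, 1] (g i) = (![0, 0, 1] : Fin 3 → K) i) :
    Function.Injective fun p => (aeval g : _ →ₐ[K] MvPolynomial (Fin 3) K).toRingHom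
      (colorParameter K p) := by
  have h1 (p : Fin 4) : eval ![0, 0, 1] (aeval g (colorParameter K p)) =
      (((![1, 2, -1, 0] : Fin 4 → ℤ) p : ℤ) : K) := by
    have h2 := hg 0
    have h3 := hg 1
    have h4 := hg 2
    simp only [Matrix.cons_val] at h2 h3 h4
    fin_cases p <;> simp [colorParameter, h2, h3, h4, -aeval_eq_bind₁]
  intro p q hpq
  have h2 := congrArg (eval ![0, 0, 1]) hpq
  have h3 := (h1 p).symm.trans (h2.trans (h1 q))
  exact (by decide : Function.Injective (![1, 2, -1, 0] : Fin 4 → ℤ)) (Int.cast_injective h3)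

theorem sub_aeval_mem {σ R : Type*} [CommRing R] (P : Ideal (MvPolynomial σ R))
    (g : σ → MvPolynomial σ R) (hg : ∀ i, X i - g i ∈ P) (t : MvPolynomial σ R) :
    t - aeval g t ∈ P := by
  rw [← Ideal.Quotient.eq]
  have h : (Ideal.Quotient.mkₐ R P) = (Ideal.Quotient.mkₐ R P).comp (aeval g) := by
    ext i
    simpa using Ideal.Quotient.eq.2 (hg i)
  exact DFunLike.congr_fun h t

theorem facetEval_mem {P : Ideal (MvPolynomial (Fin 3) K)} (i : Fin 20) {z : EdgeRing K}
    (hz : z ∈ P.map (algebraMap _ (EdgeRing K))) : facetEval K i z ∈ P := by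
  have h : P.map (algebraMap _ (EdgeRing K)) ≤ P.comap (facetEval K i) := by
    refine Ideal.map_le_iff_le_comap.2 fun t ht => ?_
    simpa using ht
  exact h hz

theorem exists_mul_faceMonomial (K : Type u) [Field K] {v : Fin 11} {E : Finset (Fin 11)}
    (h : v ∈ E) : ∃ a, faceMonomial (x K) E = x K v * a := Finset.dvd_prod_of_mem _ h

theorem span_inf_map_le [CharZero K] {v : Fin 11} {L : List ℕ} (hL : ∀ m ∈ L, v ∈ faceOf m)
    (hv : ∀ a, x K v * a ∈ maskSpan K L) {s : Fin L.length → Fin 20} (hs : Function.Injective s)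
    (hsv : ∀ j, v ∈ facet (s j)) {P : Ideal (MvPolynomial (Fin 3) K)}
    {g : Fin 3 → MvPolynomial (Fin 3) K}
    (hg : ∀ i, eval ![0, 0, 1] (g i) = (![0, 0, 1] : Fin 3 → K) i)
    (hgP : ∀ i, X i - g i ∈ P) (hP : ∀ t ∈ P, aeval g t = 0) :
    Ideal.span {x K v} ⊓ P.map (algebraMap _ (EdgeRing K)) ≤
      P.map (algebraMap _ (EdgeRing K)) * Ideal.span {x K v} := by
  rintro z ⟨hz1, hz2⟩
  obtain ⟨a, rfl⟩ := Ideal.mem_span_singleton.1 hz1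
  obtain ⟨c, hc⟩ := (Submodule.mem_span_range_iff_exists_fun _).1 (hv a)
  have h1 (j) : c j ∈ P := by
    have h := coeff_eq_zero_of_facetEval s hs (fun j => ?_) (aeval g).toRingHom
      (injective_aeval_colorParameter hg) c (fun i => ?_) j
    · have := sub_aeval_mem P g hgP (c j)
      rwa [show aeval g (c j) = 0 from h, sub_zero] at this
    · obtain ⟨b, hb⟩ := exists_mul_faceMonomial K (hsv j)
      rw [hb]
      exact hv b
    · rw [hc]
      exact hP _ (facetEval_mem (s i) hz2)
  rw [← hc]
  refine Ideal.sum_mem _ fun j _ => ?_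
  obtain ⟨b, hb⟩ := exists_mul_faceMonomial K (hL _ (L.get_mem j))
  rw [maskMonomial, hb, Algebra.smul_def]
  exact Ideal.mul_mem_mul (Ideal.mem_map_of_mem _ (h1 j))
    (Ideal.mul_mem_right _ _ (Ideal.mem_span_singleton_self _))

variable (K) in
/-- The basis of the face ring over its parameter ring. -/
noncomputable def basis [CharZero K] :
    Module.Basis (Fin basisMasks.length) (MvPolynomial (Fin 3) K) (EdgeRing K) := by
  refine Module.Basis.mk (v := maskMonomial K basisMasks) ?_ span_basisMasks.ge
  rw [Fintype.linearIndependent_iff]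
  intro c hc j
  refine coeff_eq_zero_of_facetEval (L := basisMasks) id Function.injective_id
    (fun j => by rw [span_basisMasks]; trivial) (RingHom.id _) ?_ c (fun i => ?_) j
  · convert injective_aeval_colorParameter (K := K) (g := X) (by simp) using 2
    exact (aeval_X_left_apply _).symm
  · rw [hc, map_zero, map_zero]

instance [CharZero K] : Module.Free (MvPolynomial (Fin 3) K) (EdgeRing K) :=
  Module.Free.of_basis (basis K)

instance [CharZero K] : Module.Finite (MvPolynomial (Fin 3) K) (EdgeRing K) :=
  Module.Finite.of_basis (basis K)

theorem mem_map_of_faceMonomial [CharZero K] : faceMonomial (x K) (faceOf (mask [0, 4, 5])) ∈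
    (Ideal.span (Set.range X)).map (algebraMap (MvPolynomial (Fin 3) K) (EdgeRing K)) := by
  set J := (Ideal.span (Set.range X)).map (algebraMap (MvPolynomial (Fin 3) K) (EdgeRing K)) with hJ
  have hθ (w : EdgeRing K) (p q) : w * (colorSum (x K) p - colorSum (x K) q) ∈ J := by
    refine J.mul_mem_left _ ?_
    have h (i) : (X i : MvPolynomial (Fin 3) K) ∈ Ideal.span (Set.range X) :=
      Ideal.subset_span ⟨i, rfl⟩
    have h1 (p) : colorParameter K p ∈
        Ideal.span (Set.range (X : Fin 3 → MvPolynomial (Fin 3) K)) := by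
      fin_cases p
      · exact h 2
      · exact add_mem (h 0) (Ideal.mul_mem_left _ _ (h 2))
      · exact sub_mem (h 1) (h 2)
      · exact zero_mem _
    have h2 := sub_mem (Ideal.mem_map_of_mem (algebraMap _ (EdgeRing K)) (h1 p))
      (Ideal.mem_map_of_mem (algebraMap _ (EdgeRing K)) (h1 q))
    rwa [algebraMap_colorParameter, algebraMap_colorParameter, sub_sub_sub_cancel_right] at h2
  have h1 := two_mul_faceMonomial_mem (x_mul_x K) J.toAddSubgroup fun m _ _ p q => hθ _ p q
  have h2 : faceMonomial (x K) (faceOf (mask [0, 1, 5])) ∈ J :=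
    mem_of_two_mul_mem (J.restrictScalars _) _ h1
  have h3 : ∀ i ∈ faceOf (mask [0, 5]), color i ≠ color 4 ∧ color i ≠ 1 := by decide +kernel
  have h4 : ∀ j, j ≠ 4 → (color j = color 4 ∨ color j = 1) →
      IsFace (insert j (faceOf (mask [0, 5]))) → j = 1 := by decide +kernel
  have h5 := faceMonomial_mem_of_others (x_mul_x K) J.toAddSubgroup h3 (by decide) (hθ _ _ _)
    fun j hj hc hf => by
      obtain rfl := h4 j hj hc hf
      rw [insert_faceOf]
      exact h2
  rwa [insert_faceOf] at h5

end EdgeRing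

end

section

open MvPolynomial

namespace EdgeRing

variable {K : Type u} [Field K]

theorem injective_starFacetsFour :
    Function.Injective (![2, 3, 11, 12, 14] : Fin 5 → Fin 20) := by
  simp [Function.Injective, Fin.forall_fin_succ]

theorem injective_starFacetsTen :
    Function.Injective (![15, 16, 17, 18, 19] : Fin 5 → Fin 20) := by
  simp [Function.Injective, Fin.forall_fin_succ]

theorem exists_coeff_of_mem_map_mul {v : Fin 11} {L : List ℕ} (hv : ∀ a, x K v * a ∈ maskSpan K L)
    {P : Ideal (MvPolynomial (Fin 3) K)} {z : EdgeRing K}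
    (hz : z ∈ P.map (algebraMap _ (EdgeRing K)) * Ideal.span {x K v}) :
    ∃ c : Fin L.length → MvPolynomial (Fin 3) K, (∀ j, c j ∈ P) ∧
      ∑ j, c j • maskMonomial K L j = z := by
  rw [← Ideal.smul_eq_mul, ← Submodule.restrictScalars_mem (MvPolynomial (Fin 3) K),
    Ideal.smul_restrictScalars] at hz
  have h1 : (Ideal.span {x K v}).restrictScalars (MvPolynomial (Fin 3) K) ≤ maskSpan K L := by
    intro w hw
    obtain ⟨a, rfl⟩ := Ideal.mem_span_singleton.1 hw
    exact hv a
  obtain ⟨c, hc, hcz⟩ := (Submodule.mem_ideal_smul_span_iff_exists_sum _ _ _).1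
    (show _ ∈ P • Submodule.span _ _ from smul_mono_right P h1 hz)
  refine ⟨c, hc, ?_⟩
  exact (Finsupp.sum_fintype _ (fun j t => t • maskMonomial K L j) fun _ =>
    zero_smul _ _).symm.trans hcz

variable (K) [CharZero K]

theorem span_four_inf_map_le {P : Ideal (MvPolynomial (Fin 3) K)}
    {g : Fin 3 → MvPolynomial (Fin 3) K}
    (hg : ∀ i, eval ![0, 0, 1] (g i) = (![0, 0, 1] : Fin 3 → K) i)
    (hgP : ∀ i, X i - g i ∈ P) (hP : ∀ t ∈ P, aeval g t = 0) :
    Ideal.span {x K 4} ⊓ P.map (algebraMap _ (EdgeRing K)) ≤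
      P.map (algebraMap _ (EdgeRing K)) * Ideal.span {x K 4} :=
  span_inf_map_le (L := starMasksFour) (s := ![2, 3, 11, 12, 14]) (by decide +kernel)
    mem_span_starMasksFour injective_starFacetsFour (by decide +kernel) hg hgP hP

theorem span_ten_inf_map_le {P : Ideal (MvPolynomial (Fin 3) K)}
    {g : Fin 3 → MvPolynomial (Fin 3) K}
    (hg : ∀ i, eval ![0, 0, 1] (g i) = (![0, 0, 1] : Fin 3 → K) i)
    (hgP : ∀ i, X i - g i ∈ P) (hP : ∀ t ∈ P, aeval g t = 0) :
    Ideal.span {x K 10} ⊓ P.map (algebraMap _ (EdgeRing K)) ≤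
      P.map (algebraMap _ (EdgeRing K)) * Ideal.span {x K 10} :=
  span_inf_map_le (L := starMasksTen) (s := ![15, 16, 17, 18, 19]) (by decide +kernel)
    mem_span_starMasksTen injective_starFacetsTen (by decide +kernel) hg hgP hP

theorem faceMonomial_notMem_map_mul : faceMonomial (x K) (faceOf (mask [0, 4, 5])) ∉
    (Ideal.span (Set.range X)).map (algebraMap (MvPolynomial (Fin 3) K) (EdgeRing K)) *
      Ideal.span {x K 4} := by
  intro h
  obtain ⟨c, hc, hc'⟩ := exists_coeff_of_mem_map_mul mem_span_starMasksFour h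
  let l : Fin starMasksFour.length := ⟨4, by decide⟩
  have h1 : (Pi.single l 1 : _ → MvPolynomial (Fin 3) K) l - c l = 0 :=
    coeff_eq_zero_of_facetEval ![2, 3, 11, 12, 14] injective_starFacetsFour
      (fun j => by
        have h : ∀ j, 4 ∈ facet ((![2, 3, 11, 12, 14] : Fin 5 → Fin 20) j) := by decide +kernel
        obtain ⟨b, hb⟩ := exists_mul_faceMonomial K (h j)
        rw [hb]
        exact mem_span_starMasksFour b) (RingHom.id _)
      (by
        convert injective_aeval_colorParameter (K := K) (g := X) (by simp) using 2
        exact (aeval_X_left_apply _).symm)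
      (fun j => (Pi.single l 1 : _ → MvPolynomial (Fin 3) K) j - c j) (fun i => by
        have h2 : ∑ j, (Pi.single l 1 : _ → MvPolynomial (Fin 3) K) j •
            maskMonomial K starMasksFour j = maskMonomial K starMasksFour l := by
          simp only [Pi.single_apply, ite_smul, one_smul, zero_smul, Finset.sum_ite_eq',
            Finset.mem_univ, if_true]
        have h3 : maskMonomial K starMasksFour l =
          faceMonomial (x K) (faceOf (mask [0, 4, 5])) := rfl
        have h4 : ∑ j, ((Pi.single l 1 : _ → MvPolynomial (Fin 3) K) j - c j) •
            maskMonomial K starMasksFour j = 0 := by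
          simp only [sub_smul, Finset.sum_sub_distrib, hc', h2, h3, sub_self]
        rw [h4, map_zero, map_zero]) l
  rw [Pi.single_eq_same, sub_eq_zero] at h1
  have h2 : (Ideal.span (Set.range X) : Ideal (MvPolynomial (Fin 3) K)) ≤
      RingHom.ker (constantCoeff : MvPolynomial (Fin 3) K →+* K) := by
    refine Ideal.span_le.2 ?_
    rintro _ ⟨i, rfl⟩
    simp
  have h3 := h2 (hc l)
  rw [← h1] at h3
  simp at h3

end EdgeRing

end

section

/-! ### Regular pairs modulo an ideal -/

/-- The elements `a, b` form a weakly regular sequence on the quotient by `I`. -/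
def IsRegularPair {R : Type*} [CommRing R] (I : Ideal R) (a b : R) : Prop :=
  (∀ f, a * f ∈ I → f ∈ I) ∧ ∀ f g, b * f - a * g ∈ I → f ∈ I ⊔ Ideal.span {a}

namespace IsRegularPair

variable {R : Type*} [CommRing R] {a b : R}

theorem of_inf_span_le (h : IsRegularPair (⊥ : Ideal R) a b) {B : Ideal R}
    (ha : B ⊓ Ideal.span {a} ≤ Ideal.span {a} * B)
    (hab : B ⊓ Ideal.span {a, b} ≤ Ideal.span {a, b} * B) : IsRegularPair B a b := by
  refine ⟨fun f hf => ?_, fun f g hfg => ?_⟩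
  · obtain ⟨c, hc, hcf⟩ := Ideal.mem_span_singleton_mul.1
      (ha ⟨hf, Ideal.mul_mem_right _ _ (Ideal.mem_span_singleton_self a)⟩)
    have h1 : f - c = 0 := h.1 _ (by rw [mul_sub, hcf, sub_self]; exact zero_mem _)
    rwa [sub_eq_zero.1 h1]
  · have h1 : b * f - a * g ∈ Ideal.span {a, b} :=
      Ideal.mem_span_pair.2 ⟨-g, f, by ring⟩
    have h2 := hab ⟨hfg, h1⟩
    rw [Ideal.span_insert, Ideal.sup_mul, Submodule.mem_sup] at h2
    obtain ⟨_, hc, _, hd, hcd⟩ := h2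
    obtain ⟨c, hc, rfl⟩ := Ideal.mem_span_singleton_mul.1 hc
    obtain ⟨d, hdB, rfl⟩ := Ideal.mem_span_singleton_mul.1 hd
    have h3 := h.2 (f - d) (g + c) (by
      rw [Ideal.mem_bot]
      linear_combination -hcd)
    rw [bot_sup_eq] at h3
    have h4 := add_mem ((le_sup_left : B ≤ B ⊔ Ideal.span {a}) hdB) (Ideal.mem_sup_right h3)
    rwa [add_sub_cancel] at h4

theorem comap {S : Type*} [CommRing S] (φ : S →+* R) (hφ : Function.Surjective φ) {a b : S}
    {B : Ideal R} (h : IsRegularPair B (φ a) (φ b)) : IsRegularPair (B.comap φ) a b := by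
  refine ⟨fun f hf => h.1 _ (by rwa [← map_mul]), fun f g hfg => ?_⟩
  obtain ⟨c, hc, d, hd, hcd⟩ := Submodule.mem_sup.1 (h.2 (φ f) (φ g) (by
    rwa [← map_mul, ← map_mul, ← map_sub]))
  obtain ⟨e, rfl⟩ := Ideal.mem_span_singleton.1 hd
  obtain ⟨e, rfl⟩ := hφ e
  refine Submodule.mem_sup.2 ⟨f - a * e, ?_, a * e, Ideal.mem_span_singleton.2 ⟨e, rfl⟩, by ring⟩
  rw [Ideal.mem_comap, map_sub, map_mul, ← hcd, add_sub_cancel_right]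
  exact hc

variable {I I₁ I₂ : Ideal R} {c : R}

theorem of_colon (hc : ∀ f, c * f ∈ I ↔ f ∈ I₁) (hI : I ⊔ Ideal.span {c} = I₂)
    (h₁ : IsRegularPair I₁ a b) (h₂ : IsRegularPair I₂ a b) : IsRegularPair I a b := by
  have hle : I ≤ I₂ := hI ▸ le_sup_left
  have hmem {f : R} (hf : f ∈ I₂) : ∃ u, f - c * u ∈ I := by
    rw [← hI, sup_comm, Ideal.mem_span_singleton_sup] at hf
    obtain ⟨u, j, hj, rfl⟩ := hf
    exact ⟨u, by convert hj using 1; ring⟩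
  have hcI (u : R) : c * u ∈ I₂ :=
    hI ▸ Ideal.mem_sup_right (Ideal.mul_mem_right _ _ (Ideal.mem_span_singleton_self c))
  refine ⟨fun f hf => ?_, fun f g hfg => ?_⟩
  · obtain ⟨u, hu⟩ := hmem (h₂.1 f (hle hf))
    have h3 : c * (a * u) ∈ I := by
      convert sub_mem hf (I.mul_mem_left a hu) using 1
      ring
    have h4 := add_mem hu ((hc u).2 (h₁.1 _ ((hc _).1 h3)))
    rwa [sub_add_cancel] at h4
  · obtain ⟨v, hv⟩ : ∃ v, f - a * v ∈ I₂ := by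
      have := h₂.2 f g (hle hfg)
      rw [sup_comm, Ideal.mem_span_singleton_sup] at this
      obtain ⟨v, j, hj, rfl⟩ := this
      exact ⟨v, by convert hj using 1; ring⟩
    obtain ⟨u, hu⟩ := hmem hv
    obtain ⟨w, hw⟩ := hmem (h₂.1 (g - b * v) (by
      convert sub_mem (add_mem (I₂.mul_mem_left b (hle hu)) (hcI (b * u))) (hle hfg) using 1
      ring))
    have h3 : c * (b * u - a * w) ∈ I := by
      convert add_mem (sub_mem hfg (I.mul_mem_left b hu)) (I.mul_mem_left a hw) using 1
      ring
    have h4 := h₁.2 _ _ ((hc _).1 h3)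
    rw [sup_comm, Ideal.mem_span_singleton_sup] at h4
    obtain ⟨e, i, hi, rfl⟩ := h4
    rw [sup_comm, Ideal.mem_span_singleton_sup]
    refine ⟨v + c * e, f - a * v - c * (e * a + i) + c * i, add_mem hu ((hc i).2 hi), by ring⟩

theorem mem_sup_of_mul_mem (hc : ∀ f, c * f ∈ I ↔ f ∈ I₁) (hI : I ⊔ Ideal.span {c} = I₂)
    (h₂ : IsRegularPair I₂ a b) {f : R} (hf : c * f ∈ I ⊔ Ideal.span {a, b}) :
    f ∈ I₁ ⊔ Ideal.span {a, b} := by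
  have hle : I ≤ I₂ := hI ▸ le_sup_left
  have hmem {f : R} (hf : f ∈ I₂) : ∃ u, f - c * u ∈ I := by
    rw [← hI, sup_comm, Ideal.mem_span_singleton_sup] at hf
    obtain ⟨u, j, hj, rfl⟩ := hf
    exact ⟨u, by convert hj using 1; ring⟩
  have hcI (u : R) : c * u ∈ I₂ :=
    hI ▸ Ideal.mem_sup_right (Ideal.mul_mem_right _ _ (Ideal.mem_span_singleton_self c))
  obtain ⟨j, hj, k, hk, hjk⟩ := Submodule.mem_sup.1 hf
  obtain ⟨s, t, rfl⟩ := Ideal.mem_span_pair.1 hk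
  obtain ⟨v, hv⟩ : ∃ v, t - a * v ∈ I₂ := by
    have := h₂.2 t (-s) (by
      convert sub_mem (hcI f) (hle hj) using 1
      linear_combination hjk)
    rw [sup_comm, Ideal.mem_span_singleton_sup] at this
    obtain ⟨v, j, hj, rfl⟩ := this
    exact ⟨v, by convert hj using 1; ring⟩
  obtain ⟨u, hu⟩ := hmem hv
  obtain ⟨w, hw⟩ := hmem (h₂.1 (s + b * v) (by
    convert sub_mem (sub_mem (hcI f) (hle hj)) (I₂.mul_mem_left b hv) using 1
    linear_combination hjk))
  have h3 : f - (a * w + b * u) ∈ I₁ := (hc _).1 (by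
    convert add_mem (add_mem hj (I.mul_mem_left b hu)) (I.mul_mem_left a hw) using 1
    linear_combination -hjk)
  exact Submodule.mem_sup.2 ⟨_, h3, _, Ideal.mem_span_pair.2 ⟨w, u, by ring⟩, sub_add_cancel _ _⟩

end IsRegularPair

theorem Module.Basis.isRegularPair {T A ι : Type*} [CommRing T] [IsDomain T] [CommRing A]
    [Algebra T A] (e : Module.Basis ι T A) {a b : T} (ha : Prime a) (hb : ¬ a ∣ b) :
    IsRegularPair (⊥ : Ideal A) (algebraMap T A a) (algebraMap T A b) := by
  refine ⟨fun f hf => ?_, fun f g hfg => ?_⟩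
  · rw [Ideal.mem_bot, ← Algebra.smul_def] at hf
    rw [Ideal.mem_bot, ← e.repr.map_eq_zero_iff]
    ext i
    have h := DFunLike.congr_fun (congrArg e.repr hf) i
    simpa [ha.ne_zero] using h
  · rw [Ideal.mem_bot, sub_eq_zero, ← Algebra.smul_def, ← Algebra.smul_def] at hfg
    rw [bot_sup_eq]
    have h1 (i) : a ∣ e.repr f i := by
      have h := DFunLike.congr_fun (congrArg e.repr hfg) i
      simp only [map_smul, Finsupp.smul_apply, smul_eq_mul] at h
      exact (ha.dvd_or_dvd ⟨_, h⟩).resolve_left hb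
    rw [← e.linearCombination_repr f, Finsupp.linearCombination_apply]
    refine Ideal.sum_mem _ fun i _ => ?_
    obtain ⟨c, hc⟩ := h1 i
    simp only [hc, mul_smul, Algebra.smul_def a]
    exact Ideal.mul_mem_right _ _ (Ideal.mem_span_singleton_self _)

end

section

/-! ### The weighted edge ideal -/

open MvPolynomial

/-- The weight of the head of an oriented edge of `D₁`; the edge between `4` and `10` points
to `4`. -/
def weight (p : Fin 11 × Fin 11) : ℕ := if p.2 = 10 ∧ p.1 ≠ 4 then 2 else 1

variable (K : Type u) [Field K]

/-- The weighted edge ideal of `D₁`. -/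
noncomputable def weightedIdeal : Ideal (MvPolynomial (Fin 11) K) :=
  Ideal.span {f | ∃ p ∈ nonEdges, X p.1 * X p.2 ^ weight p = f}

variable {K}

theorem X_mul_X_pow_eq_monomial {σ R : Type*} [CommSemiring R] (i j : σ) (n : ℕ) :
    (X i * X j ^ n : MvPolynomial σ R) = monomial (Finsupp.single i 1 + Finsupp.single j n) 1 := by
  rw [X_pow_eq_monomial, X, monomial_mul, one_mul]

theorem single_add_single_le_iff {σ : Type*} {i j : σ} (h : i ≠ j) (n : ℕ) (m : σ →₀ ℕ) :
    Finsupp.single i 1 + Finsupp.single j n ≤ m ↔ m i ≠ 0 ∧ n ≤ m j := by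
  classical
  constructor
  · intro hm
    have hi := hm i
    have hj := hm j
    simp [h, h.symm] at hi hj
    exact ⟨by lia, hj⟩
  · rintro ⟨hi, hj⟩ k
    simp only [Finsupp.add_apply, Finsupp.single_apply]
    split_ifs with h1 h2 h2
    · exact absurd (h1.trans h2.symm) h
    · subst h1; lia
    · subst h2; lia
    · lia

theorem ne_of_mem_nonEdges : ∀ p ∈ nonEdges, p.1 ≠ p.2 := by decide +kernel

theorem mem_weightedIdeal_iff {f : MvPolynomial (Fin 11) K} : f ∈ weightedIdeal K ↔
    ∀ m ∈ f.support, ∃ p ∈ nonEdges, m p.1 ≠ 0 ∧ weight p ≤ m p.2 := by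
  have h : {f : MvPolynomial (Fin 11) K | ∃ p ∈ nonEdges, X p.1 * X p.2 ^ weight p = f} =
      (fun s => monomial s 1) ''
        {s | ∃ p ∈ nonEdges, Finsupp.single p.1 1 + Finsupp.single p.2 (weight p) = s} := by
    ext f
    simp only [X_mul_X_pow_eq_monomial, Set.mem_ofPred_eq, Set.mem_image]
    grind
  rw [weightedIdeal, h, mem_ideal_span_monomial_image]
  refine forall₂_congr fun m _ => ?_
  constructor
  · rintro ⟨_, ⟨p, hp, rfl⟩, h⟩
    exact ⟨p, hp, (single_add_single_le_iff (ne_of_mem_nonEdges p hp) _ _).1 h⟩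
  · rintro ⟨p, hp, h⟩
    exact ⟨_, ⟨p, hp, rfl⟩, (single_add_single_le_iff (ne_of_mem_nonEdges p hp) _ _).2 h⟩

theorem mem_edgeIdeal_sup_iff {v : Fin 11} {f : MvPolynomial (Fin 11) K} :
    f ∈ edgeIdeal K ⊔ Ideal.span {X v} ↔
    ∀ m ∈ f.support, m v ≠ 0 ∨ ∃ p ∈ nonEdges, m p.1 ≠ 0 ∧ m p.2 ≠ 0 := by
  have h : {f : MvPolynomial (Fin 11) K | ∃ p ∈ nonEdges, X p.1 * X p.2 = f} ∪ {X v} =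
      (fun s => monomial s 1) ''
        ({s | ∃ p ∈ nonEdges, Finsupp.single p.1 1 + Finsupp.single p.2 1 = s} ∪
          {Finsupp.single v 1}) := by
    have h1 (i j : Fin 11) : (X i * X j : MvPolynomial (Fin 11) K) =
      monomial (Finsupp.single i 1 + Finsupp.single j 1) 1 := by
        simpa using X_mul_X_pow_eq_monomial (R := K) i j 1
    rw [Set.image_union, Set.image_singleton]
    congr 1
    ext f
    simp only [h1, Set.mem_ofPred_eq, Set.mem_image]
    grind
  rw [edgeIdeal, ← Ideal.span_union, h, mem_ideal_span_monomial_image]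
  refine forall₂_congr fun m _ => ?_
  simp only [Set.mem_union, Set.mem_ofPred_eq, Set.mem_singleton_iff]
  constructor
  · rintro ⟨_, ⟨p, hp, rfl⟩ | rfl, h⟩
    · have := (single_add_single_le_iff (ne_of_mem_nonEdges p hp) _ _).1 h
      exact Or.inr ⟨p, hp, this.1, by lia⟩
    · exact Or.inl (by simpa [Nat.one_le_iff_ne_zero] using h)
  · rintro (h | ⟨p, hp, h⟩)
    · exact ⟨_, Or.inr rfl, by simpa [Nat.one_le_iff_ne_zero] using h⟩
    · exact ⟨_, Or.inl ⟨p, hp, rfl⟩, (single_add_single_le_iff (ne_of_mem_nonEdges p hp) _ _).2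
        ⟨h.1, by lia⟩⟩

theorem X_mul_mem_weightedIdeal_iff {f : MvPolynomial (Fin 11) K} :
    X 10 * f ∈ weightedIdeal K ↔ f ∈ edgeIdeal K ⊔ Ideal.span {X 4} := by
  rw [mem_weightedIdeal_iff, mem_edgeIdeal_sup_iff, support_X_mul]
  simp only [Finset.mem_map, addLeftEmbedding_apply, forall_exists_index, and_imp,
    forall_apply_eq_imp_iff₂, Finsupp.add_apply]
  refine forall₂_congr fun m _ => ?_
  have h1 : ∀ p ∈ nonEdges, p.1 ≠ 10 := by decide +kernel
  constructor
  · rintro ⟨p, hp, h2, h3⟩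
    rw [Finsupp.single_eq_of_ne (h1 p hp), zero_add] at h2
    by_cases h4 : p.2 = 10
    · by_cases h5 : p.1 = 4
      · exact Or.inl (h5 ▸ h2)
      · refine Or.inr ⟨p, hp, h2, ?_⟩
        rw [weight, if_pos ⟨h4, h5⟩, h4, Finsupp.single_eq_same] at h3
        rw [h4]
        lia
    · refine Or.inr ⟨p, hp, h2, ?_⟩
      rw [weight, if_neg fun h => h4 h.1, Finsupp.single_eq_of_ne h4] at h3
      lia
  · rintro (h | ⟨p, hp, h2, h3⟩)
    · refine ⟨(4, 10), by decide, ?_, ?_⟩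
      · simpa using h
      · simp [weight]
    · refine ⟨p, hp, by lia, ?_⟩
      rw [weight]
      split_ifs with h
      · rw [h.1, Finsupp.single_eq_same]
        rw [h.1] at h3
        lia
      · lia

theorem weightedIdeal_le : weightedIdeal K ≤ edgeIdeal K := by
  refine Ideal.span_le.2 ?_
  rintro _ ⟨p, hp, rfl⟩
  rw [weight]
  split_ifs
  · rw [pow_two, ← mul_assoc]
    exact Ideal.mul_mem_right _ _ (Ideal.subset_span ⟨p, hp, rfl⟩)
  · rw [pow_one]
    exact Ideal.subset_span ⟨p, hp, rfl⟩

theorem weightedIdeal_sup :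
    weightedIdeal K ⊔ Ideal.span {X 10} = edgeIdeal K ⊔ Ideal.span {X 10} := by
  refine le_antisymm (sup_le_sup_right weightedIdeal_le _) (sup_le ?_ le_sup_right)
  refine Ideal.span_le.2 ?_
  rintro _ ⟨p, hp, rfl⟩
  by_cases h : p.2 = 10
  · rw [h]
    exact Ideal.mem_sup_right (Ideal.mul_mem_left _ _ (Ideal.mem_span_singleton_self _))
  · refine Ideal.mem_sup_left (Ideal.subset_span ⟨p, hp, ?_⟩)
    rw [weight, if_neg fun h' => h h'.1, pow_one]

theorem edgeIdeal_le_radical : edgeIdeal K ≤ (weightedIdeal K).radical := by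
  refine Ideal.span_le.2 ?_
  rintro _ ⟨p, hp, rfl⟩
  refine ⟨2, ?_⟩
  have h : X p.1 * X p.2 ^ weight p ∣ (X p.1 * X p.2 : MvPolynomial (Fin 11) K) ^ 2 := by
    rw [mul_pow]
    refine mul_dvd_mul (dvd_pow_self _ two_ne_zero) (pow_dvd_pow _ ?_)
    rw [weight]
    split_ifs <;> lia
  exact Ideal.mem_of_dvd _ h (Ideal.subset_span ⟨p, hp, rfl⟩)

end

section

/-! ### Unmixedness of the weighted edge ideal -/

open MvPolynomial

theorem idealHeight_comap {R S : Type u} [CommRing R] [CommRing S] (e : R ≃+* S) (p : Ideal S) :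
    idealHeight (p.comap e) = idealHeight p := by
  have h {R S : Type u} [CommRing R] [CommRing S] (e : R ≃+* S) (p : Ideal S) :
      idealHeight p ≤ idealHeight (p.comap e) :=
    Order.krullDim_le_of_strictMono
      (fun q => ⟨PrimeSpectrum.comap (e : R →+* S) q.1, Ideal.comap_mono q.2⟩)
      fun q q' hq => (PrimeSpectrum.comapEquiv e.symm).strictMono hq
  refine le_antisymm ?_ (h e p)
  have h1 := h e.symm (p.comap e)
  have h2 : (p.comap e).comap e.symm = p := by
    ext
    simp only [Ideal.mem_comap, RingEquiv.apply_symm_apply]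
  rwa [h2] at h1

namespace MvPolynomial

variable {σ R : Type*} [CommRing R]

instance isPrime_span_X_image [IsDomain R] (s : Set σ) :
    (Ideal.span (X '' s : Set (MvPolynomial σ R))).IsPrime := by
  classical
  let g : σ → MvPolynomial σ R := fun i => if i ∈ s then 0 else X i
  suffices h : Ideal.span (X '' s : Set (MvPolynomial σ R)) = RingHom.ker (aeval (R := R) g) by
    rw [h]
    exact RingHom.ker_isPrime _
  refine le_antisymm (Ideal.span_le.2 ?_) fun f hf => ?_
  · rintro _ ⟨i, hi, rfl⟩
    simp [g, hi]
  · have h := EdgeRing.sub_aeval_mem (Ideal.span (X '' s)) g (fun i => ?_) f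
    · rwa [show aeval g f = 0 from hf, sub_zero] at h
    · by_cases hi : i ∈ s
      · simpa [g, hi] using Ideal.subset_span (Set.mem_image_of_mem _ hi)
      · simp [g, hi]

end MvPolynomial

theorem idealHeight_span_X_image {σ R : Type*} [CommRing R] [DecidableEq σ] [Fintype σ]
    {s t : Finset σ} (h : s.card = t.card) :
    idealHeight (Ideal.span (X '' (s : Set σ) : Set (MvPolynomial σ R))) =
      idealHeight (Ideal.span (X '' (t : Set σ) : Set (MvPolynomial σ R))) := by
  let e : Equiv.Perm σ := (Finset.equivOfCardEq h).extendSubtype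
  have he : e '' s = t := by
    refine Set.Subset.antisymm ?_ fun j hj => ?_
    · rintro _ ⟨i, hi, rfl⟩
      exact (Finset.equivOfCardEq h).extendSubtype_mem i hi
    · by_contra hj'
      refine (Finset.equivOfCardEq h).extendSubtype_not_mem (e.symm j) (fun hi => hj' ?_) ?_
      · exact ⟨_, hi, e.apply_symm_apply j⟩
      · rw [show (Finset.equivOfCardEq h).extendSubtype (e.symm j) = j from e.apply_symm_apply j]
        exact hj
  rw [← idealHeight_comap (renameEquiv R e).toRingEquiv.symm, Ideal.comap_symm, Ideal.map_span,
    ← he, ← Set.image_comp, ← Set.image_comp]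
  congr! 4
  ext1 i
  simp

/-- The prime ideal generated by the variables outside a facet. -/
noncomputable def facetIdeal (K : Type u) [Field K] (i : Fin 20) :
    Ideal (MvPolynomial (Fin 11) K) :=
  Ideal.span (X '' ((facet i)ᶜ : Finset (Fin 11)))

variable {K : Type u} [Field K]

instance (i : Fin 20) : (facetIdeal K i).IsPrime := isPrime_span_X_image _

theorem mem_facetIdeal_iff {i : Fin 20} {f : MvPolynomial (Fin 11) K} :
    f ∈ facetIdeal K i ↔ ∀ m ∈ f.support, ¬ m.support ⊆ facet i := by
  rw [facetIdeal, mem_ideal_span_X_image]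
  refine forall₂_congr fun m _ => ?_
  simp [Finset.subset_iff, and_comm]

theorem exists_facet_of_isFace {v : Fin 11} (hv : v = 4 ∨ v = 10) {E : Finset (Fin 11)}
    (hE : IsFace E) (hvE : v ∉ E) : ∃ i, v ∉ facet i ∧ E ⊆ facet i := by
  have h : ∀ v : Fin 11, v = 4 ∨ v = 10 → ∀ m ∈ smallMasks ++ facetMasks, v ∉ faceOf m →
      ∃ i : Fin 20, v ∉ facet i ∧ faceOf m ⊆ facet i := by decide +kernel
  obtain ⟨m, hm, rfl⟩ := hE.exists_mask
  exact h v hv m hm hvE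

theorem edgeIdeal_sup_eq_iInf {v : Fin 11} (hv : v = 4 ∨ v = 10) :
    edgeIdeal K ⊔ Ideal.span {X v} = ⨅ i : {i // v ∉ facet i}, facetIdeal K i := by
  ext f
  simp only [mem_edgeIdeal_sup_iff, Ideal.mem_iInf, mem_facetIdeal_iff, Subtype.forall]
  constructor
  · intro h i hi m hm hmi
    rcases h m hm with h1 | ⟨p, hp, h1, h2⟩
    · exact hi (hmi (Finsupp.mem_support_iff.2 h1))
    · exact isFace_facet i p hp ⟨hmi (Finsupp.mem_support_iff.2 h1),
        hmi (Finsupp.mem_support_iff.2 h2)⟩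
  · intro h m hm
    by_contra! hm'
    obtain ⟨i, hi, hmi⟩ := exists_facet_of_isFace hv (E := m.support)
      (fun p hp hpm => Finsupp.mem_support_iff.1 hpm.2
        (hm'.2 p hp (Finsupp.mem_support_iff.1 hpm.1))) (by simpa using hm'.1)
    exact h i hi m hm hmi

theorem eq_of_eq_colon_iInf {R ι : Type*} [CommRing R] [Finite ι] {P : ι → Ideal R}
    (hP : ∀ i, (P i).IsPrime) {p : Ideal R} (hp : p.IsPrime) {f : R}
    (h : ∀ g, g ∈ p ↔ g * f ∈ ⨅ i, P i) : ∃ i, p = P i := by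
  classical
  have := Fintype.ofFinite ι
  simp only [Ideal.mem_iInf] at h
  have h1 : Finset.inf {i | f ∉ P i} P ≤ p := by
    intro g hg
    refine (h g).2 fun i => ?_
    by_cases hi : f ∈ P i
    · exact Ideal.mul_mem_left _ _ hi
    · exact Ideal.mul_mem_right _ _ (Finset.inf_le (f := P) (by simpa using hi) hg)
  obtain ⟨i, hi, hip⟩ := hp.inf_le'.1 h1
  exact ⟨i, le_antisymm (fun g hg => ((hP i).mem_or_mem ((h g).1 hg i)).resolve_right
    (by simpa using hi)) hip⟩

theorem eq_facetIdeal_of_mem_associatedPrimes {p : Ideal (MvPolynomial (Fin 11) K)}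
    (hp : p ∈ associatedPrimes _ (MvPolynomial (Fin 11) K ⧸ weightedIdeal K)) :
    ∃ i, p = facetIdeal K i := by
  obtain ⟨hp1, y, hy⟩ := isAssociatedPrime_iff.1 hp
  obtain ⟨f, rfl⟩ := Ideal.Quotient.mk_surjective y
  have h1 (g) : g ∈ p ↔ g * f ∈ weightedIdeal K := by
    rw [hy, Submodule.mem_colon_singleton, Submodule.mem_bot, ← Ideal.Quotient.eq_zero_iff_mem,
      map_mul]
    rfl
  have h2 {v : Fin 11} (hv : v = 4 ∨ v = 10) {f}
      (hf : ∀ g, g ∈ p ↔ g * f ∈ edgeIdeal K ⊔ Ideal.span {X v}) : ∃ i, p = facetIdeal K i := by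
    obtain ⟨i, hi⟩ := eq_of_eq_colon_iInf (P := fun i : {i // v ∉ facet i} => facetIdeal K i)
      (fun _ => inferInstance) hp1 (fun g => by rw [hf, edgeIdeal_sup_eq_iInf hv])
    exact ⟨i, hi⟩
  by_cases h3 : ∀ g, g * f ∈ edgeIdeal K ⊔ Ideal.span {X 10} → g ∈ p
  · exact h2 (Or.inr rfl) fun g =>
      ⟨fun hg => Ideal.mem_sup_left (weightedIdeal_le ((h1 g).1 hg)), h3 g⟩
  · push Not at h3
    obtain ⟨g, hg, hgp⟩ := h3
    rw [← weightedIdeal_sup, sup_comm, Ideal.mem_span_singleton_sup] at hg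
    obtain ⟨u, j, hj, hu⟩ := hg
    refine h2 (Or.inl rfl) (f := u) fun r => ?_
    rw [← X_mul_mem_weightedIdeal_iff, ← (weightedIdeal K).add_mem_iff_left
      ((weightedIdeal K).mul_mem_left r hj), show X 10 * (r * u) + r * j = r * g * f by
        rw [mul_assoc r g f, ← hu]; ring, ← h1]
    exact ⟨fun h => p.mul_mem_right _ h, fun h => (hp1.mem_or_mem h).resolve_right hgp⟩

theorem isUnmixedIdeal_weightedIdeal : IsUnmixedIdeal (weightedIdeal K) := by
  intro p hp q hq
  obtain ⟨i, rfl⟩ := eq_facetIdeal_of_mem_associatedPrimes hp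
  obtain ⟨j, rfl⟩ := eq_facetIdeal_of_mem_associatedPrimes hq
  have h : ∀ i : Fin 20, (facet i)ᶜ.card = 8 := by decide +kernel
  exact idealHeight_span_X_image (R := K) ((h i).trans (h j).symm)

end

section

open MvPolynomial

variable (K : Type u) [Field K]

namespace EdgeRing

instance : IsNoetherianRing (EdgeRing K) :=
  inferInstanceAs (IsNoetherianRing (MvPolynomial (Fin 11) K ⧸ edgeIdeal K))

theorem isCohenMacaulayRing [CharZero K] : IsCohenMacaulayRing (EdgeRing K) :=
  isCohenMacaulayRing_of_finite_flat (T := MvPolynomial (Fin 3) K) (n := 3) (.mvPolynomial K 3)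
    (by simp [MvPolynomial.ringKrullDim_of_isNoetherianRing])

theorem isRegularPair_bot [CharZero K] : IsRegularPair (⊥ : Ideal (EdgeRing K))
    (mk K (linearParameter K 0)) (mk K (linearParameter K 1)) := by
  rw [← algebraMap_X, ← algebraMap_X]
  exact (basis K).isRegularPair (X_prime (R := K)) (by simp [X_dvd_X])

theorem span_inf_map_le_of_eq [CharZero K] {v : Fin 11} (hv : v = 4 ∨ v = 10)
    {P : Ideal (MvPolynomial (Fin 3) K)} {g : Fin 3 → MvPolynomial (Fin 3) K}
    (hg : ∀ i, eval ![0, 0, 1] (g i) = (![0, 0, 1] : Fin 3 → K) i)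
    (hgP : ∀ i, X i - g i ∈ P) (hP : ∀ t ∈ P, aeval g t = 0) :
    Ideal.span {x K v} ⊓ P.map (algebraMap _ (EdgeRing K)) ≤
      P.map (algebraMap _ (EdgeRing K)) * Ideal.span {x K v} := by
  rcases hv with rfl | rfl
  · exact span_four_inf_map_le K hg hgP hP
  · exact span_ten_inf_map_le K hg hgP hP

theorem span_inf_span_singleton_le [CharZero K] {v : Fin 11} (hv : v = 4 ∨ v = 10) :
    Ideal.span {x K v} ⊓ Ideal.span {mk K (linearParameter K 0)} ≤
      Ideal.span {mk K (linearParameter K 0)} * Ideal.span {x K v} := by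
  have h := span_inf_map_le_of_eq K hv (P := Ideal.span {X 0}) (g := ![0, X 1, X 2])
    (by simp [Fin.forall_fin_succ]) (by simp [Fin.forall_fin_succ]) fun t ht => by
      obtain ⟨c, rfl⟩ := Ideal.mem_span_singleton.1 ht
      simp [-aeval_eq_bind₁]
  rwa [Ideal.map_span, Set.image_singleton, algebraMap_X] at h

theorem span_inf_span_pair_le [CharZero K] {v : Fin 11} (hv : v = 4 ∨ v = 10) :
    Ideal.span {x K v} ⊓ Ideal.span {mk K (linearParameter K 0), mk K (linearParameter K 1)} ≤
      Ideal.span {mk K (linearParameter K 0), mk K (linearParameter K 1)} *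
        Ideal.span {x K v} := by
  have h0 : (X 0 : MvPolynomial (Fin 3) K) ∈ Ideal.span {X 0, X 1} := Ideal.subset_span (by simp)
  have h1 : (X 1 : MvPolynomial (Fin 3) K) ∈ Ideal.span {X 0, X 1} := Ideal.subset_span (by simp)
  have h := span_inf_map_le_of_eq K hv (P := Ideal.span {X 0, X 1}) (g := ![0, 0, X 2])
    (by simp [Fin.forall_fin_succ]) (by simp [Fin.forall_fin_succ, h0, h1]) fun t ht => by
      obtain ⟨c, d, rfl⟩ := Ideal.mem_span_pair.1 ht
      simp [-aeval_eq_bind₁]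
  rwa [Ideal.map_span, Set.image_pair, algebraMap_X, algebraMap_X] at h

theorem isRegularPair_span [CharZero K] {v : Fin 11} (hv : v = 4 ∨ v = 10) :
    IsRegularPair (Ideal.span {x K v}) (mk K (linearParameter K 0)) (mk K (linearParameter K 1)) :=
  (isRegularPair_bot K).of_inf_span_le (span_inf_span_singleton_le K hv)
    (span_inf_span_pair_le K hv)

theorem comap_mk_span (v : Fin 11) :
    (Ideal.span {x K v}).comap (mk K) = edgeIdeal K ⊔ Ideal.span {X v} := by
  have h : Ideal.span {x K v} = (Ideal.span {X v}).map (mk K) := by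
    rw [Ideal.map_span, Set.image_singleton]
    rfl
  rw [h, Ideal.comap_map_of_surjective _ (mk_surjective K), sup_comm]
  congr 1
  ext f
  exact mk_eq_zero_iff

theorem isRegularPair_sup [CharZero K] {v : Fin 11} (hv : v = 4 ∨ v = 10) :
    IsRegularPair (edgeIdeal K ⊔ Ideal.span {X v}) (linearParameter K 0) (linearParameter K 1) := by
  rw [← comap_mk_span]
  exact IsRegularPair.comap (mk K).toRingHom (mk_surjective K) (isRegularPair_span K hv)

end EdgeRing

open EdgeRing

theorem isRegularPair_weightedIdeal [CharZero K] :
    IsRegularPair (weightedIdeal K) (linearParameter K 0) (linearParameter K 1) :=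
  .of_colon (fun _ => X_mul_mem_weightedIdeal_iff) weightedIdeal_sup
    (isRegularPair_sup K (Or.inl rfl)) (isRegularPair_sup K (Or.inr rfl))

/-- The third parameter is a zero divisor modulo the weighted edge ideal and the first two. -/
theorem exists_mul_linearParameter_mem [CharZero K] : ∃ w : MvPolynomial (Fin 11) K,
    linearParameter K 2 * w ∈
        weightedIdeal K ⊔ Ideal.span {linearParameter K 0, linearParameter K 1} ∧
    w ∉ weightedIdeal K ⊔ Ideal.span {linearParameter K 0, linearParameter K 1} := by
  set y := faceMonomial (x K) (faceOf (mask [0, 4, 5])) with hy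
  obtain ⟨z, hz⟩ : ∃ z, y = x K 4 * z := exists_mul_faceMonomial K (by decide +kernel)
  have hyx : y ∈ Ideal.span {x K 4} := Ideal.mem_span_singleton.2 ⟨z, hz⟩
  obtain ⟨q, hq⟩ : ∃ q : Fin 3 → EdgeRing K, ∑ i, q i * mk K (linearParameter K i) = y := by
    have h := mem_map_of_faceMonomial (K := K)
    rw [Ideal.map_span, ← Set.range_comp, Ideal.mem_span_range_iff_exists_fun] at h
    obtain ⟨q, hq⟩ := h
    exact ⟨q, by simpa [algebraMap_X] using hq⟩
  choose Q hQ using fun i => mk_surjective K (q i)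
  refine ⟨X 10 * Q 2, ?_, fun h => ?_⟩
  · have h1 : ∑ i, Q i * linearParameter K i ∈ edgeIdeal K ⊔ Ideal.span {X 4} := by
      rw [← comap_mk_span, Ideal.mem_comap, map_sum]
      simpa only [map_mul, hQ, hq] using hyx
    rw [← X_mul_mem_weightedIdeal_iff, Fin.sum_univ_three] at h1
    refine Submodule.mem_sup.2 ⟨_, h1, _, Ideal.mem_span_pair.2
      ⟨-(X 10 * Q 0), -(X 10 * Q 1), rfl⟩, by ring⟩
  · have h1 := IsRegularPair.mem_sup_of_mul_mem (fun _ => X_mul_mem_weightedIdeal_iff)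
      weightedIdeal_sup (isRegularPair_sup K (Or.inr rfl)) h
    rw [← comap_mk_span] at h1
    obtain ⟨i, hi, j, hj, hij⟩ := Submodule.mem_sup.1 h1
    obtain ⟨d, hd⟩ := Ideal.mem_span_singleton.1 (Ideal.mem_comap.1 hi)
    obtain ⟨s, t, rfl⟩ := Ideal.mem_span_pair.1 hj
    have h2 := congrArg (mk K) hij
    simp only [map_add, map_mul, hQ, hd] at h2
    rw [Fin.sum_univ_three, ← h2] at hq
    have h3 : y - x K 4 * d * mk K (linearParameter K 2) ∈
        Ideal.span {mk K (linearParameter K 0), mk K (linearParameter K 1)} :=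
      Ideal.mem_span_pair.2 ⟨q 0 + mk K s * mk K (linearParameter K 2),
        q 1 + mk K t * mk K (linearParameter K 2), by rw [← hq]; ring⟩
    have h4 := span_inf_span_pair_le K (Or.inl rfl) ⟨sub_mem hyx (Ideal.mul_mem_right _ _
      (Ideal.mul_mem_right _ _ (Ideal.mem_span_singleton_self (x K 4)))), h3⟩
    have h5 (i) : mk K (linearParameter K i) ∈
        (Ideal.span (Set.range X)).map (algebraMap (MvPolynomial (Fin 3) K) (EdgeRing K)) := by
      rw [← algebraMap_X]
      exact Ideal.mem_map_of_mem _ (Ideal.subset_span ⟨i, rfl⟩)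
    have h6 : Ideal.span {mk K (linearParameter K 0), mk K (linearParameter K 1)} ≤
        (Ideal.span (Set.range X)).map (algebraMap (MvPolynomial (Fin 3) K) (EdgeRing K)) := by
      rw [Ideal.span_le, Set.pair_subset_iff]
      exact ⟨h5 0, h5 1⟩
    have h7 := add_mem (Ideal.mul_mono_left h6 h4) (Ideal.mul_mem_mul (h5 2)
      (Ideal.mul_mem_right d _ (Ideal.mem_span_singleton_self (x K 4))))
    rw [mul_comm (mk K (linearParameter K 2)), sub_add_cancel] at h7
    exact faceMonomial_notMem_map_mul K h7

end

section

open MvPolynomial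

section

variable {A : Type*} [CommRing A] {x : Fin 11 → A} (hx : ∀ p ∈ nonEdges, x p.1 * x p.2 = 0)

include hx

theorem mul_colorSum_color (k : Fin 11) : x k * colorSum x (color k) = x k ^ 2 := by
  rw [colorSum, Finset.mul_sum, Finset.sum_eq_single k, pow_two]
  · intro j hj hjk
    rcases mem_nonEdges_of_color_eq j k (Finset.mem_filter.1 hj).2 hjk with h | h
    · rw [mul_comm]
      exact hx _ h
    · exact hx _ h
  · simp

theorem prod_colorSum : ∏ p, colorSum x p = 0 := by
  simp only [colorSum]
  rw [Finset.prod_univ_sum]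
  refine Finset.sum_eq_zero fun φ hφ => ?_
  have h1 (p : Fin 4) : color (φ p) = p := by simpa using Fintype.mem_piFinset.1 hφ p
  have h2 : Function.Injective φ := fun p q h => by rw [← h1 p, h, h1]
  have h3 : ∏ p, x (φ p) = faceMonomial x (Finset.univ.image φ) := by
    rw [faceMonomial, Finset.prod_image h2.injOn]
  rw [h3]
  refine faceMonomial_eq_zero hx fun h => ?_
  have h4 := h.card_le
  rw [Finset.card_image_of_injective _ h2, Finset.card_univ, Fintype.card_fin] at h4
  lia

theorem pow_five_eq_zero (hσ : ∀ p, colorSum x p = colorSum x 3) (k : Fin 11) : x k ^ 5 = 0 := by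
  have h1 := mul_colorSum_color hx k
  have h2 := prod_colorSum hx
  rw [hσ] at h1
  simp only [hσ, Finset.prod_const, Finset.card_univ, Fintype.card_fin] at h2
  have h3 (n : ℕ) : x k ^ (n + 1) = x k * colorSum x 3 ^ n := by
    induction n with
    | zero => simp
    | succ n ih =>
      rw [pow_succ (x k), ih]
      linear_combination (-(colorSum x 3) ^ n) * h1
  rw [h3 4, h2, mul_zero]

end

variable {K : Type u} [Field K]

theorem X_mem_of_linearParameter_mem {M : Ideal (MvPolynomial (Fin 11) K)} (hM : M.IsRadical)
    (hG : edgeIdeal K ≤ M) (h : ∀ i, EdgeRing.linearParameter K i ∈ M) (k : Fin 11) : X k ∈ M := by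
  let φ := Ideal.Quotient.mk M
  have h0 (p : Fin 4) : φ (colorSum X p) = colorSum (fun i => φ (X i)) p := by
    rw [colorSum, map_sum]
    rfl
  have h1 : φ (colorSum X 1 - colorSum X 3 - 2 * (colorSum X 0 - colorSum X 3)) = 0 :=
    Ideal.Quotient.eq_zero_iff_mem.2 (h 0)
  have h2 : φ (colorSum X 2 - colorSum X 3 + (colorSum X 0 - colorSum X 3)) = 0 :=
    Ideal.Quotient.eq_zero_iff_mem.2 (h 1)
  have h3 : φ (colorSum X 0 - colorSum X 3) = 0 := Ideal.Quotient.eq_zero_iff_mem.2 (h 2)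
  simp only [map_sub, map_add, map_mul, map_ofNat, h0] at h1 h2 h3
  have h4 (p : Fin 4) :
      colorSum (fun i => φ (X i)) p = colorSum (fun i => φ (X i)) (3 : Fin 4) := by
    revert p
    refine Fin.forall_fin_succ.2 ⟨?_, Fin.forall_fin_succ.2 ⟨?_, Fin.forall_fin_succ.2 ⟨?_,
      Fin.forall_fin_one.2 rfl⟩⟩⟩
    · linear_combination h3
    · change colorSum _ (1 : Fin 4) = _
      linear_combination h1 + 2 * h3
    · change colorSum _ (2 : Fin 4) = _
      linear_combination h2 - h3
  have h5 := pow_five_eq_zero (x := fun i => φ (X i)) (fun p hp => by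
    rw [← map_mul]
    exact Ideal.Quotient.eq_zero_iff_mem.2 (hG (Ideal.subset_span ⟨p, hp, rfl⟩))) h4 k
  rw [← map_pow, Ideal.Quotient.eq_zero_iff_mem] at h5
  exact hM ⟨5, h5⟩

end

section

section

variable {B : Type u} [CommRing B] {I : Ideal B}

/-- Regular pairs are preserved by localization. -/
theorem IsRegularPair.localization {a b : B} (h : IsRegularPair (⊥ : Ideal B) a b)
    (M : Submonoid B) (R : Type*) [CommRing R] [Algebra B R] [IsLocalization M R] :
    IsRegularPair (⊥ : Ideal R) (algebraMap B R a) (algebraMap B R b) := by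
  simp only [IsRegularPair, Ideal.mem_bot, bot_sup_eq, sub_eq_zero] at h ⊢
  refine ⟨fun f hf => ?_, fun f g hfg => ?_⟩
  · obtain ⟨⟨x, s⟩, hx⟩ := IsLocalization.surj M f
    have h1 : algebraMap B R (a * x) = algebraMap B R 0 := by
      simp only at hx
      rw [map_mul, ← hx, ← mul_assoc, hf, zero_mul, map_zero]
    obtain ⟨c, hc⟩ := IsLocalization.exists_of_eq (M := M) h1
    have h2 := h.1 (c * x) (by linear_combination hc)
    have h3 : algebraMap B R c * (f * algebraMap B R s) = 0 := by
      rw [hx, ← map_mul, h2, map_zero]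
    rwa [(IsLocalization.map_units R c).mul_right_eq_zero,
      (IsLocalization.map_units R s).mul_left_eq_zero] at h3
  · obtain ⟨⟨x, s⟩, hx⟩ := IsLocalization.surj M f
    obtain ⟨⟨y, t⟩, hy⟩ := IsLocalization.surj M g
    simp only at hx hy
    have h1 : algebraMap B R (b * x * t) = algebraMap B R (a * y * s) := by
      simp only [map_mul, ← hx, ← hy]
      linear_combination algebraMap B R s * algebraMap B R t * hfg
    obtain ⟨c, hc⟩ := IsLocalization.exists_of_eq (M := M) h1
    have h2 := h.2 (c * x * t) (c * y * s) (by linear_combination hc)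
    obtain ⟨d, hd⟩ := Ideal.mem_span_singleton.1 h2
    have h3 : f * (algebraMap B R s * algebraMap B R c * algebraMap B R t) =
        algebraMap B R a * algebraMap B R d := by
      rw [← map_mul (algebraMap B R) a, ← hd, map_mul, map_mul, ← hx]
      ring
    have h4 : IsUnit (algebraMap B R s * algebraMap B R c * algebraMap B R t) :=
      ((IsLocalization.map_units R s).mul (IsLocalization.map_units R c)).mul
        (IsLocalization.map_units R t)
    rw [← Ideal.mul_unit_mem_iff_mem _ h4, h3]
    exact Ideal.mul_mem_right _ _ (Ideal.mem_span_singleton_self _)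

open IsLocalRing in
/-- If `a, b` is a regular pair and a maximal ideal of height at least `3` is the radical of an
annihilator in `B ⧸ (a, b)`, then `B` is not Cohen-Macaulay. -/
theorem IsRegularPair.not_isCohenMacaulayRing [IsNoetherianRing B] {a b w : B}
    (h : IsRegularPair (⊥ : Ideal B) a b) (n : Ideal B) [n.IsMaximal] (hn : 3 ≤ n.height)
    (hw : w ∉ Ideal.span {a, b}) (hnw : n ≤ ((Ideal.span {a, b}).colon {w}).radical) :
    ¬ IsCohenMacaulayRing B := by
  intro hCM
  let R := Localization.AtPrime n
  let φ := algebraMap B R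
  have h1 : 3 ≤ localRingDepth R := by
    have h2 := hCM n
    rw [IsLocalization.AtPrime.ringKrullDim_eq_height n R] at h2
    rw [WithBot.coe_inj.1 h2]
    exact hn
  obtain ⟨ha, hb⟩ := h.localization n.primeCompl R
  simp only [Ideal.mem_bot, bot_sup_eq, sub_eq_zero] at ha hb
  obtain ⟨r, hr, hreg⟩ := exists_regular_mod_pair h1 ha hb
  have hmap : (Ideal.span {a, b}).map φ = Ideal.span {φ a, φ b} := by
    rw [Ideal.map_span, Set.image_pair]
  have h2 : maximalIdeal R ≤ ((Ideal.span {φ a, φ b}).colon {φ w}).radical := by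
    rw [← Localization.AtPrime.map_eq_maximalIdeal, Ideal.map_le_iff_le_comap]
    intro x hx
    obtain ⟨k, hk⟩ := hnw hx
    refine ⟨k, ?_⟩
    rw [Submodule.mem_colon_singleton, smul_eq_mul] at hk ⊢
    rw [← map_pow, ← map_mul, ← hmap]
    exact Ideal.mem_map_of_mem _ hk
  obtain ⟨k, hk⟩ := h2 hr
  rw [Submodule.mem_colon_singleton, smul_eq_mul] at hk
  have h3 : φ w ∈ Ideal.span {φ a, φ b} := by
    clear hr h2
    induction k with
    | zero => simpa using hk
    | succ k ih =>
      rw [pow_succ', mul_assoc] at hk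
      exact ih (hreg _ hk)
  rw [← hmap, IsLocalization.algebraMap_mem_map_algebraMap_iff n.primeCompl] at h3
  obtain ⟨s, hs, hsw⟩ := h3
  have h4 : ((Ideal.span {a, b}).colon {w}).radical = ⊤ := by
    refine (Ideal.IsMaximal.out (I := n)).2 _ (lt_of_le_of_ne hnw ?_)
    intro h5
    refine hs ?_
    rw [h5]
    exact Ideal.le_radical (Submodule.mem_colon_singleton.2 hsw)
  rw [Ideal.radical_eq_top, Ideal.eq_top_iff_one, Submodule.mem_colon_singleton, one_smul] at h4
  exact hw h4

end

section

theorem Ideal.height_map_add_one_le {A B : Type*} [CommRing A] [CommRing B] {f : A →+* B}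
    (hf : Function.Surjective f) {P Q : Ideal A} [P.IsPrime] [Q.IsPrime]
    (hP : RingHom.ker f ≤ P) (h : P < Q) : (P.map f).height + 1 ≤ (Q.map f).height := by
  have h1 := Ideal.map_isPrime_of_surjective hf hP
  have h2 := Ideal.map_isPrime_of_surjective hf (hP.trans h.le)
  refine Ideal.height_add_one_le_of_lt_of_isPrime (lt_of_le_of_ne (Ideal.map_mono h.le) ?_)
  intro h3
  have h4 := congrArg (Ideal.comap f) h3
  rw [Ideal.comap_map_of_surjective' f hf, Ideal.comap_map_of_surjective' f hf,
    sup_of_le_left hP, sup_of_le_left (hP.trans h.le)] at h4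
  exact h.ne h4

open MvPolynomial EdgeRing

theorem MvPolynomial.span_X_image_lt {σ R : Type*} [CommRing R] [Nontrivial R] {s t : Set σ}
    (h : s ⊂ t) : Ideal.span (X '' s : Set (MvPolynomial σ R)) < Ideal.span (X '' t) := by
  refine lt_of_le_not_ge (Ideal.span_mono (Set.image_mono h.1)) fun h1 => h.2 fun i hi => ?_
  have h2 := h1 (Ideal.subset_span (Set.mem_image_of_mem _ hi))
  rw [mem_ideal_span_X_image] at h2
  obtain ⟨j, hj, hij⟩ := h2 (Finsupp.single i 1) (by simp)
  rwa [Finsupp.single_apply_ne_zero.1 hij |>.1] at hj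

theorem MvPolynomial.height_map_add_card_le {σ R B : Type*} [CommRing R] [IsDomain R] [CommRing B]
    {f : MvPolynomial σ R →+* B} (hf : Function.Surjective f) (E : Finset σ)
    (hE : RingHom.ker f ≤ Ideal.span (X '' (Eᶜ : Set σ))) :
    ((Ideal.span (X '' (Eᶜ : Set σ))).map f).height + E.card ≤
      ((Ideal.span (Set.range X)).map f).height := by
  classical
  induction E using Finset.induction_on with
  | empty => simp
  | insert a E ha ih =>
    have h1 : ((insert a E : Finset σ)ᶜ : Set σ) ⊂ (Eᶜ : Set σ) :=
      compl_lt_compl_iff_lt.2 (Finset.coe_ssubset.2 (Finset.ssubset_insert ha))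
    have h2 := span_X_image_lt (R := R) h1
    rw [Finset.card_insert_of_notMem ha, Nat.cast_add, Nat.cast_one, add_comm (E.card : ℕ∞),
      ← add_assoc]
    exact (add_le_add_left (Ideal.height_map_add_one_le hf hE h2) _).trans (ih (hE.trans h2.le))

theorem MvPolynomial.isMaximal_span_range_X {σ K : Type*} [Field K] :
    (Ideal.span (Set.range X) : Ideal (MvPolynomial σ K)).IsMaximal := by
  suffices h : Ideal.span (Set.range X) = RingHom.ker (constantCoeff (σ := σ) (R := K)) by
    rw [h]
    exact RingHom.ker_isMaximal_of_surjective _ fun c => ⟨C c, constantCoeff_C _ c⟩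
  ext f
  rw [← Set.image_univ, mem_ideal_span_X_image, RingHom.mem_ker, constantCoeff_eq,
    ← notMem_support_iff]
  refine ⟨fun h h0 => ?_, fun h m hm => ?_⟩
  · obtain ⟨i, -, hi⟩ := h 0 h0
    exact hi rfl
  · by_contra! hm'
    exact h (Finsupp.ext (f := m) (g := 0) (fun i => hm' i (Set.mem_univ i)) ▸ hm)

variable (K : Type u) [Field K]

theorem not_isCohenMacaulayRing_weightedIdeal [CharZero K] :
    ¬ IsCohenMacaulayRing (MvPolynomial (Fin 11) K ⧸ weightedIdeal K) := by
  let φ := Ideal.Quotient.mk (weightedIdeal K)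
  have hφ : Function.Surjective φ := Ideal.Quotient.mk_surjective
  have hker : RingHom.ker φ = weightedIdeal K := Ideal.mk_ker
  have hfacet : RingHom.ker φ ≤ facetIdeal K 0 := by
    rw [hker]
    refine (weightedIdeal_le.trans le_sup_left).trans
      ((edgeIdeal_sup_eq_iInf (K := K) (v := 10) (Or.inr rfl)).le.trans
        (iInf_le (fun i : {i // 10 ∉ facet i} => facetIdeal K i) ⟨0, by decide +kernel⟩))
  have hle : RingHom.ker φ ≤ Ideal.span (Set.range X) :=
    hfacet.trans (Ideal.span_mono (Set.image_subset_range _ _))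
  have hmax : ((Ideal.span (Set.range X)).map φ).IsMaximal :=
    have := isMaximal_span_range_X (σ := Fin 11) (K := K)
    Ideal.IsMaximal.map_of_surjective_of_ker_le hφ hle
  have hheight : 3 ≤ ((Ideal.span (Set.range X)).map φ).height := by
    have h1 := height_map_add_card_le hφ (facet 0) (by simpa [facetIdeal] using hfacet)
    rw [show (facet 0).card = 3 by decide +kernel] at h1
    exact le_add_self.trans h1
  have hmem (s : Set (MvPolynomial (Fin 11) K)) (f : MvPolynomial (Fin 11) K) :
      φ f ∈ Ideal.span (φ '' s) ↔ f ∈ weightedIdeal K ⊔ Ideal.span s := by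
    rw [← Ideal.map_span, ← Ideal.mem_comap, Ideal.comap_map_of_surjective' φ hφ, hker, sup_comm]
  have hpair : IsRegularPair (⊥ : Ideal (MvPolynomial (Fin 11) K ⧸ weightedIdeal K))
      (φ (linearParameter K 0)) (φ (linearParameter K 1)) := by
    obtain ⟨ha, hb⟩ := isRegularPair_weightedIdeal K
    refine ⟨fun f hf => ?_, fun f g hfg => ?_⟩
    · obtain ⟨f, rfl⟩ := hφ f
      rw [← map_mul] at hf
      exact Ideal.Quotient.eq_zero_iff_mem.2 (ha f (Ideal.Quotient.eq_zero_iff_mem.1 hf))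
    · obtain ⟨f, rfl⟩ := hφ f
      obtain ⟨g, rfl⟩ := hφ g
      rw [← map_mul, ← map_mul, ← map_sub] at hfg
      rw [bot_sup_eq, ← Set.image_singleton, hmem]
      exact hb f g (Ideal.Quotient.eq_zero_iff_mem.1 hfg)
  obtain ⟨w, hw, hw'⟩ := exists_mul_linearParameter_mem K
  rw [← hmem, Set.image_pair] at hw hw'
  refine hpair.not_isCohenMacaulayRing _ hheight hw' ?_
  rw [Ideal.map_le_iff_le_comap, Ideal.span_le]
  rintro _ ⟨k, rfl⟩
  refine X_mem_of_linearParameter_mem (Ideal.IsRadical.comap φ (Ideal.radical_isRadical _)) ?_ ?_ k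
  · intro f hf
    obtain ⟨m, hm⟩ := edgeIdeal_le_radical hf
    refine ⟨m, ?_⟩
    rw [← map_pow, Ideal.Quotient.eq_zero_iff_mem.2 hm]
    exact zero_mem _
  · refine fun i => Ideal.le_radical (Submodule.mem_colon_singleton.2 ?_)
    rw [smul_eq_mul]
    fin_cases i
    · exact Ideal.mul_mem_right _ _ (Ideal.subset_span (by simp))
    · exact Ideal.mul_mem_right _ _ (Ideal.subset_span (by simp))
    · rwa [map_mul] at hw

end

end

open MvPolynomial in
/-- Counterexample to the conjecture of Pitones, Reyes and Toledo: over a field `K` of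
characteristic `0`, for the edge ideal `I(G)` of the graph `G` coming from a triangulation
of the real projective plane and the vertex-weighted edge ideal `I(D₁)` of a suitable
orientation of `G` with weight `2` at `x_11` and weight `1` elsewhere, `S/I(G)` is
Cohen-Macaulay and `I(D₁)` is unmixed, but `S/I(D₁)` is not Cohen-Macaulay. -/
theorem counterexample_D1 (K : Type u) [Field K] [CharZero K] :
    IsCohenMacaulayRing (MvPolynomial (Fin 11) K ⧸
      Ideal.span ({X 0 * X 2,
    X 0 * X 3,
    X 0 * X 6,
    X 0 * X 9,
    X 0 * X 10,
    X 1 * X 3,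
    X 1 * X 4,
    X 1 * X 7,
    X 1 * X 9,
    X 1 * X 10,
    X 2 * X 4,
    X 2 * X 5,
    X 2 * X 7,
    X 2 * X 10,
    X 3 * X 5,
    X 3 * X 8,
    X 3 * X 10,
    X 4 * X 6,
    X 4 * X 8,
    X 4 * X 10,
    X 5 * X 7,
    X 5 * X 8,
    X 6 * X 8,
    X 6 * X 9,
    X 7 * X 9} : Set (MvPolynomial (Fin 11) K))) ∧
    IsUnmixedIdeal
      (Ideal.span ({X 0 * X 2,
    X 0 * X 3,
    X 0 * X 6,
    X 0 * X 9,
    X 0 * X 10 ^ 2,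
    X 1 * X 3,
    X 1 * X 4,
    X 1 * X 7,
    X 1 * X 9,
    X 1 * X 10 ^ 2,
    X 2 * X 4,
    X 2 * X 5,
    X 2 * X 7,
    X 2 * X 10 ^ 2,
    X 3 * X 5,
    X 3 * X 8,
    X 3 * X 10 ^ 2,
    X 4 * X 6,
    X 4 * X 8,
    X 4 * X 10,
    X 5 * X 7,
    X 5 * X 8,
    X 6 * X 8,
    X 6 * X 9,
    X 7 * X 9} : Set (MvPolynomial (Fin 11) K))) ∧
    ¬ IsCohenMacaulayRing (MvPolynomial (Fin 11) K ⧸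
      Ideal.span ({X 0 * X 2,
    X 0 * X 3,
    X 0 * X 6,
    X 0 * X 9,
    X 0 * X 10 ^ 2,
    X 1 * X 3,
    X 1 * X 4,
    X 1 * X 7,
    X 1 * X 9,
    X 1 * X 10 ^ 2,
    X 2 * X 4,
    X 2 * X 5,
    X 2 * X 7,
    X 2 * X 10 ^ 2,
    X 3 * X 5,
    X 3 * X 8,
    X 3 * X 10 ^ 2,
    X 4 * X 6,
    X 4 * X 8,
    X 4 * X 10,
    X 5 * X 7,
    X 5 * X 8,
    X 6 * X 8,
    X 6 * X 9,
    X 7 * X 9} : Set (MvPolynomial (Fin 11) K))) := by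
  have h1 : edgeIdeal K = Ideal.span
      {X 0 * X 2, X 0 * X 3, X 0 * X 6, X 0 * X 9, X 0 * X 10, X 1 * X 3, X 1 * X 4, X 1 * X 7,
        X 1 * X 9, X 1 * X 10, X 2 * X 4, X 2 * X 5, X 2 * X 7, X 2 * X 10, X 3 * X 5, X 3 * X
        8, X 3 * X 10, X 4 * X 6, X 4 * X 8, X 4 * X 10, X 5 * X 7, X 5 * X 8, X 6 * X 8, X 6 *
        X 9, X 7 * X 9} :=
    congrArg Ideal.span (Set.ext fun f => by simp [nonEdges, @eq_comm _ _ f])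
  have h2 : weightedIdeal K = Ideal.span
      {X 0 * X 2, X 0 * X 3, X 0 * X 6, X 0 * X 9, X 0 * X 10 ^ 2, X 1 * X 3, X 1 * X 4, X 1 * X
        7, X 1 * X 9, X 1 * X 10 ^ 2, X 2 * X 4, X 2 * X 5, X 2 * X 7, X 2 * X 10 ^ 2, X 3 * X
        5, X 3 * X 8, X 3 * X 10 ^ 2, X 4 * X 6, X 4 * X 8, X 4 * X 10, X 5 * X 7, X 5 * X 8, X
        6 * X 8, X 6 * X 9, X 7 * X 9} :=
    congrArg Ideal.span (Set.ext fun f => by simp [nonEdges, weight, @eq_comm _ _ f])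
  rw [← h1, ← h2]
  exact ⟨EdgeRing.isCohenMacaulayRing K, isUnmixedIdeal_weightedIdeal,
    not_isCohenMacaulayRing_weightedIdeal K⟩
end

section
/- Let K be a field of characteristic 0 and let S = K[x_1,…,x_11]. Let I(D_2) be the ideal generated by x_1x_3, x_1x_4, x_1x_7, x_1x_10, x_1x_11, x_2x_4, x_2x_5, x_2x_8, x_2x_10, x_2x_11, x_3x_5, x_3x_6, x_3x_8, x_3x_11, x_4x_6, x_4x_9, x_4x_11, x_5x_7, x_5x_9, x_5x_11, x_6x_8, x_6x_9, x_7^2x_9, x_7x_10, x_8x_10. Then I(D_2) is unmixed, but S/I(D_2) is not Cohen-Macaulay; moreover S/I(D_2) does not satisfy Serre's condition (S_2). -/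
universe u

open CategoryTheory in
/-- Every module has a projective resolution `P` in which the vanishing of `Ext^(n+1)` makes every
`(n+1)`-cocycle of `Hom(P, N)` a coboundary. -/
theorem exists_resolution_detecting_extMod (R : Type u) [CommRing R] (M : Type u) [AddCommGroup M]
    [Module R M] :
    ∃ (P : ℕ → ModuleCat.{u} R) (d : ∀ n, P (n + 1) →ₗ[R] P n) (π : P 0 →ₗ[R] M),
      (∀ n, Module.Projective R (P n)) ∧ Function.Surjective π ∧ Function.Exact (d 0) π ∧
      (∀ n, d n ∘ₗ d (n + 1) = 0) ∧
      ∀ (N : Type u) [AddCommGroup N] [Module R N] (n : ℕ),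
        Subsingleton (ExtMod R (n + 1) M N) →
        ∀ g : P (n + 1) →ₗ[R] N, g ∘ₗ d (n + 1) = 0 → ∃ h : P n →ₗ[R] N, h ∘ₗ d n = g := by
  let Q := ProjectiveResolution.of (ModuleCat.of R M : ModuleCat.{u} R)
  refine ⟨Q.complex.X, fun n => (Q.complex.d (n + 1) n).hom, (Q.π.f 0).hom, fun n => ?_, ?_, ?_,
    fun n => ?_, fun N _ _ n hN g hg => ?_⟩
  · exact (IsProjective.iff_projective _).2 (Q.projective n)
  · exact (ModuleCat.epi_iff_surjective (Q.π.f 0)).1 inferInstance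
  · have := Q.exact₀
    rw [ShortComplex.moduleCat_exact_iff_range_eq_ker] at this
    exact (LinearMap.exact_iff (f := (Q.complex.d 1 0).hom) (g := (Q.π.f 0).hom)).2 this.symm
  · rw [← ModuleCat.hom_comp, Q.complex.d_comp_d]
    rfl
  · have e := Q.isoExt (R := R) (n + 1) (ModuleCat.of R N)
    have hz : Limits.IsZero ((Q.complex.linearYonedaObj R (ModuleCat.of R N)).homology (n + 1)) :=
      Limits.IsZero.of_iso (@ModuleCat.isZero_of_subsingleton _ _ _ hN) e.symm
    rw [← HomologicalComplex.exactAt_iff_isZero_homology,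
      HomologicalComplex.exactAt_iff' _ n (n + 1) (n + 2) (by simp) (by simp),
      ShortComplex.moduleCat_exact_iff] at hz
    obtain ⟨h, hh⟩ := hz (ModuleCat.ofHom g : Q.complex.X (n + 1) ⟶ ModuleCat.of R N) (by
      change Q.complex.d (n + 2) (n + 1) ≫ ModuleCat.ofHom g = 0
      ext x
      exact LinearMap.congr_fun hg x)
    change Q.complex.X n ⟶ ModuleCat.of R N at h
    refine ⟨h.hom, ?_⟩
    change Q.complex.d (n + 1) n ≫ h = ModuleCat.ofHom g at hh
    rw [← ModuleCat.hom_comp, hh]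
    rfl

/-- If every degree-one cocycle with values in `N` of a projective resolution of the residue field
is a coboundary, then every linear map from the maximal ideal to `N` is given by an element. -/
theorem exists_smul_eq_of_cocycles_eq_coboundaries {A : Type u} [CommRing A] [IsLocalRing A]
    {P₀ P₁ P₂ N : Type u} [AddCommGroup P₀] [Module A P₀] [AddCommGroup P₁] [Module A P₁]
    [AddCommGroup P₂] [Module A P₂] [AddCommGroup N] [Module A N] [Module.Projective A P₀]
    {d₀ : P₁ →ₗ[A] P₀} {d₁ : P₂ →ₗ[A] P₁} {π : P₀ →ₗ[A] IsLocalRing.ResidueField A}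
    (hπ : Function.Surjective π) (hex : Function.Exact d₀ π) (hd : d₀ ∘ₗ d₁ = 0)
    (H : ∀ g : P₁ →ₗ[A] N, g ∘ₗ d₁ = 0 → ∃ h : P₀ →ₗ[A] N, h ∘ₗ d₀ = g)
    (φ : IsLocalRing.maximalIdeal A →ₗ[A] N) : ∃ n : N, ∀ a, φ a = (a : A) • n := by
  obtain ⟨α, hα⟩ := Module.projective_lifting_property
    (Algebra.linearMap A (IsLocalRing.ResidueField A)) π IsLocalRing.residue_surjective
  have hα' : ∀ x, IsLocalRing.residue A (α x) = π x := fun x => LinearMap.congr_fun hα x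
  have hmem : ∀ y, α (d₀ y) ∈ IsLocalRing.maximalIdeal A := fun y => by
    rw [← IsLocalRing.residue_eq_zero_iff, hα', hex.apply_apply_eq_zero]
  obtain ⟨h, hh⟩ := H (φ ∘ₗ (α ∘ₗ d₀).codRestrict _ hmem) (by
    ext x
    have hx : d₀ (d₁ x) = 0 := LinearMap.congr_fun hd x
    have : (α ∘ₗ d₀).codRestrict (IsLocalRing.maximalIdeal A) hmem (d₁ x) = 0 :=
      Subtype.ext (by simp [hx])
    simp [this])
  obtain ⟨x, hx⟩ := hπ 1
  have hu : IsUnit (α x) := by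
    by_contra hu
    have := (IsLocalRing.residue_eq_zero_iff (α x)).2 ((IsLocalRing.mem_maximalIdeal _).2 hu)
    rw [hα', hx] at this
    exact one_ne_zero this
  obtain ⟨u, hu⟩ := hu
  refine ⟨(↑u⁻¹ : A) • h x, fun a => ?_⟩
  obtain ⟨y, hy⟩ := (hex ((a : A) • x)).1 (by
    rw [map_smul, hx, Algebra.smul_def, mul_one]
    exact (IsLocalRing.residue_eq_zero_iff _).2 a.2)
  have h1 : (u : A) • φ a = (a : A) • h x := by
    rw [← map_smul, ← map_smul, ← hy, ← LinearMap.comp_apply h, hh]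
    refine congr_arg φ (Subtype.ext ?_)
    simp [hy, hu, mul_comm]
  rw [smul_comm, ← h1, smul_smul, Units.inv_mul, one_smul]

/-- If `Ext^1(k, N) = 0` over a local ring with residue field `k`, then every linear map from the
maximal ideal to `N` is given by an element. -/
theorem exists_smul_eq_of_subsingleton_extMod {A : Type u} [CommRing A] [IsLocalRing A]
    {N : Type u} [AddCommGroup N] [Module A N]
    (H : Subsingleton (ExtMod A 1 (IsLocalRing.ResidueField A) N))
    (φ : IsLocalRing.maximalIdeal A →ₗ[A] N) : ∃ n : N, ∀ a, φ a = (a : A) • n := by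
  obtain ⟨P, d, π, hP, hπ, hex, hd, hE⟩ :=
    exists_resolution_detecting_extMod A (IsLocalRing.ResidueField A)
  exact exists_smul_eq_of_cocycles_eq_coboundaries hπ hex (hd 0) (hE N 0 H) φ

/-- If `Ext^1(k, A) = Ext^2(k, A) = 0` and `t` is a nonzerodivisor of the local ring `A`, then every
linear map from the maximal ideal to `A ⧸ (t)` is given by an element. -/
theorem exists_smul_eq_of_subsingleton_extMod_two {A : Type u} [CommRing A] [IsLocalRing A]
    (H₁ : Subsingleton (ExtMod A 1 (IsLocalRing.ResidueField A) A))
    (H₂ : Subsingleton (ExtMod A 2 (IsLocalRing.ResidueField A) A))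
    {t : A} (ht : t ∈ nonZeroDivisors A)
    (φ : IsLocalRing.maximalIdeal A →ₗ[A] A ⧸ Ideal.span {t}) :
    ∃ n, ∀ a, φ a = (a : A) • n := by
  obtain ⟨P, d, π, hP, hπ, hex, hd, hE⟩ :=
    exists_resolution_detecting_extMod A (IsLocalRing.ResidueField A)
  refine exists_smul_eq_of_cocycles_eq_coboundaries hπ hex (hd 0) (fun g hg => ?_) φ
  have hinj : Function.Injective (LinearMap.mulLeft A t) := fun a b hab =>
    (mul_cancel_left_mem_nonZeroDivisors ht).1 hab
  obtain ⟨g', hg'⟩ := Module.projective_lifting_property (Ideal.span {t}).mkQ g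
    (Submodule.mkQ_surjective _)
  have hrange : ∀ x, (g' ∘ₗ d 1) x ∈ LinearMap.range (LinearMap.mulLeft A t) := fun x => by
    have h0 : (Ideal.span {t}).mkQ (g' (d 1 x)) = 0 := by
      rw [← LinearMap.comp_apply, hg']
      exact LinearMap.congr_fun hg x
    rw [Submodule.mkQ_apply, Submodule.Quotient.mk_eq_zero, Ideal.mem_span_singleton'] at h0
    obtain ⟨a, ha⟩ := h0
    exact ⟨a, by simpa [mul_comm] using ha⟩
  let c : P 2 →ₗ[A] A := (LinearEquiv.ofInjective _ hinj).symm.toLinearMap ∘ₗ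
    (g' ∘ₗ d 1).codRestrict _ hrange
  have hc : ∀ x, t * c x = g' (d 1 x) := fun x =>
    congr_arg Subtype.val ((LinearEquiv.ofInjective _ hinj).apply_symm_apply
      ((g' ∘ₗ d 1).codRestrict _ hrange x))
  obtain ⟨b, hb⟩ := hE A 1 H₂ c (by
    ext x
    refine hinj ?_
    have hx : d 1 (d 2 x) = 0 := LinearMap.congr_fun (hd 1) x
    simp [hc, hx])
  obtain ⟨h, hh⟩ := hE A 0 H₁ (g' - t • b) (by
    ext x
    have hx : b (d 1 x) = c x := LinearMap.congr_fun hb x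
    simp [hx, hc])
  refine ⟨(Ideal.span {t}).mkQ ∘ₗ h, ?_⟩
  rw [LinearMap.comp_assoc, hh, ← hg']
  ext x
  rw [LinearMap.comp_apply, LinearMap.comp_apply, LinearMap.sub_apply, map_sub, sub_eq_self,
    Submodule.mkQ_apply, Submodule.Quotient.mk_eq_zero]
  exact Ideal.mul_mem_right _ _ (Ideal.mem_span_singleton_self t)

theorem localRingDepth_le {A : Type u} [CommRing A] [IsLocalRing A] {n : ℕ}
    (h : ¬ Subsingleton (ExtMod A n (IsLocalRing.ResidueField A) A)) :
    localRingDepth A ≤ n :=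
  sInf_le ⟨n, rfl, not_subsingleton_iff_nontrivial.1 h⟩

open MvPolynomial

/-- A linear map from the maximal ideal to `A ⧸ w`, obtained by multiplying `e` with a ring
endomorphism `ρ`, which is not given by an element. -/
theorem exists_linearMap_forall_ne_smul {A : Type*} [CommRing A] [IsLocalRing A] {N : Type*}
    [AddCommGroup N] [Module A N] {w : Ideal A} {q : A →ₗ[A] N} (hq : Function.Surjective q)
    (hqw : LinearMap.ker q = w) {ρ : A →+* A} {e x y : A}
    (hlin : ∀ b, ∀ a ∈ IsLocalRing.maximalIdeal A, (b - ρ b) * (e * ρ a) ∈ w)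
    (hx : x ∈ IsLocalRing.maximalIdeal A) (hy : y ∈ IsLocalRing.maximalIdeal A)
    (hρx : ρ x = x) (hρy : ρ y = 0) {D E : Type*} [CommRing D] [CommRing E] {ψ₁ ψ₂ : A →+* D}
    {θ : D →+* E} (hw₁ : w ≤ RingHom.ker ψ₁) (hw₂ : w ≤ RingHom.ker ψ₂)
    (hx' : ψ₁ x ∈ nonZeroDivisors D) (hy' : ψ₂ y ∈ nonZeroDivisors D)
    (hθ : θ.comp ψ₁ = θ.comp ψ₂) (he : θ (ψ₁ e) ≠ 0) :
    ∃ φ : IsLocalRing.maximalIdeal A →ₗ[A] N, ¬ ∃ n, ∀ a, φ a = (a : A) • n := by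
  let φ : IsLocalRing.maximalIdeal A →ₗ[A] N :=
    { toFun := fun a => q (e * ρ a)
      map_add' := fun a b => by simp [mul_add]
      map_smul' := fun b a => by
        rw [← sub_eq_zero, RingHom.id_apply, ← map_smul, ← map_sub, ← LinearMap.mem_ker, hqw]
        convert w.neg_mem (hlin b a a.2) using 1
        simp only [SetLike.val_smul, smul_eq_mul, map_mul]
        ring }
  refine ⟨φ, fun ⟨n, hn⟩ => he ?_⟩
  obtain ⟨n, rfl⟩ := hq n
  have key : ∀ a ∈ IsLocalRing.maximalIdeal A, e * ρ a - a * n ∈ w := fun a ha => by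
    rw [← hqw, LinearMap.mem_ker, map_sub, sub_eq_zero, ← smul_eq_mul a, map_smul]
    exact hn ⟨a, ha⟩
  have h₁ : ψ₁ e = ψ₁ n := by
    have := hw₁ (key x hx)
    rw [RingHom.mem_ker, hρx, mul_comm e, ← mul_sub, map_mul] at this
    rw [← sub_eq_zero, ← map_sub]
    exact (mul_left_mem_nonZeroDivisors_eq_zero_iff hx').1 this
  have h₂ : ψ₂ n = 0 := by
    have := hw₂ (key y hy)
    rw [RingHom.mem_ker, hρy, mul_zero, zero_sub, map_neg, neg_eq_zero, map_mul] at this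
    exact (mul_left_mem_nonZeroDivisors_eq_zero_iff hy').1 this
  rw [h₁, ← RingHom.comp_apply, hθ, RingHom.comp_apply, h₂, map_zero]

/-- The vertex-weighted edge ideal `I(D₂)`, with variables indexed from `0`. -/
noncomputable def edgeIdealD₂ (K : Type*) [Field K] : Ideal (MvPolynomial (Fin 11) K) :=
  Ideal.span ({X 0 * X 2,
    X 0 * X 3,
    X 0 * X 6,
    X 0 * X 9,
    X 0 * X 10,
    X 1 * X 3,
    X 1 * X 4,
    X 1 * X 7,
    X 1 * X 9,
    X 1 * X 10,
    X 2 * X 4,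
    X 2 * X 5,
    X 2 * X 7,
    X 2 * X 10,
    X 3 * X 5,
    X 3 * X 8,
    X 3 * X 10,
    X 4 * X 6,
    X 4 * X 8,
    X 4 * X 10,
    X 5 * X 7,
    X 5 * X 8,
    X 6 ^ 2 * X 8,
    X 6 * X 9,
    X 7 * X 9} : Set (MvPolynomial (Fin 11) K))

namespace EdgeIdealD₂

variable {K : Type u} [Field K]

/-- The edges of the graph `G` whose generator has no weight. -/
def edges : List (Fin 11 × Fin 11) :=
  [(0, 2), (0, 3), (0, 6), (0, 9), (0, 10), (1, 3), (1, 4), (1, 7), (1, 9), (1, 10), (2, 4), (2, 5),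
    (2, 7), (2, 10), (3, 5), (3, 8), (3, 10), (4, 6), (4, 8), (4, 10), (5, 7), (5, 8), (6, 9),
    (7, 9)]

/-- A family of elements annihilated by the generators of `I(D₂)`. -/
def IsZero {B : Type*} [CommRing B] (g : Fin 11 → B) : Prop :=
  (∀ p ∈ edges, g p.1 * g p.2 = 0) ∧ g 6 ^ 2 * g 8 = 0

theorem IsZero.of_support {B : Type*} [CommRing B] {g : Fin 11 → B} (s : Finset (Fin 11))
    (hg : ∀ i ∉ s, g i = 0) (hs : ∀ p ∈ edges, p.1 ∉ s ∨ p.2 ∉ s)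
    (h6 : g 6 ^ 2 = 0 ∨ 6 ∉ s ∨ 8 ∉ s) : IsZero g := by
  refine ⟨fun p hp => ?_, ?_⟩
  · rcases hs p hp with h | h <;> simp [hg _ h]
  · rcases h6 with h | h | h
    · simp [h]
    · simp [hg _ h]
    · simp [hg _ h]

theorem le_ker_iff {B : Type*} [CommRing B] (f : MvPolynomial (Fin 11) K →+* B) :
    edgeIdealD₂ K ≤ RingHom.ker f ↔ IsZero (fun i => f (X i)) := by
  rw [edgeIdealD₂, Ideal.span_le, IsZero, edges]
  simp only [Set.insert_subset_iff, Set.singleton_subset_iff, SetLike.mem_coe, RingHom.mem_ker,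
    map_mul, map_pow, List.forall_mem_cons, List.not_mem_nil, false_imp_iff, implies_true,
    and_true]
  tauto

/-- The coordinate ring `S ⧸ I(D₂)`. -/
abbrev Coord (K : Type u) [Field K] : Type u := MvPolynomial (Fin 11) K ⧸ edgeIdealD₂ K

/-- The class of a variable in the coordinate ring. -/
noncomputable def x (i : Fin 11) : Coord K := Ideal.Quotient.mk _ (X i)

theorem isZero_x : IsZero (x (K := K)) :=
  (le_ker_iff (Ideal.Quotient.mk (edgeIdealD₂ K))).1 Ideal.mk_ker.ge

theorem ringHom_ext {B : Type*} [CommRing B] {f g : Coord K →+* B}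
    (hC : ∀ c, f (algebraMap K _ c) = g (algebraMap K _ c)) (hX : ∀ i, f (x i) = g (x i)) :
    f = g :=
  Ideal.Quotient.ringHom_ext (MvPolynomial.ringHom_ext hC hX)

/-- Evaluation of the coordinate ring at a zero of `I(D₂)`. -/
noncomputable def lift {B : Type*} [CommRing B] [Algebra K B] (g : Fin 11 → B) (hg : IsZero g) :
    Coord K →ₐ[K] B :=
  Ideal.Quotient.liftₐ _ (aeval g) ((le_ker_iff (aeval g : _ →ₐ[K] B).toRingHom).2 (by simpa))

@[simp]
theorem lift_x {B : Type*} [CommRing B] [Algebra K B] (g : Fin 11 → B) (hg : IsZero g)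
    (i : Fin 11) : lift (K := K) g hg (x i) = g i :=
  (Ideal.Quotient.lift_mk _ _ _).trans (aeval_X g i)

/-- Evaluation on the coordinate axis of the variable `x 8`. -/
noncomputable def axis {Z : Type*} [CommRing Z] [Algebra K Z] (z : Z) : Coord K →ₐ[K] Z :=
  lift (fun i => if i = 8 then z else 0)
    (.of_support {8} (fun i hi => if_neg (by simpa using hi)) (by decide +kernel)
      (.inr (by decide)))

theorem axis_x {Z : Type*} [CommRing Z] [Algebra K Z] (z : Z) (i : Fin 11) :
    axis (K := K) z (x i) = if i = 8 then z else 0 := lift_x _ _ _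

/-- The endomorphism of the coordinate ring projecting onto the coordinate space of `x 1`, `x 2`,
`x 8`. -/
noncomputable def proj : Coord K →ₐ[K] Coord K :=
  lift (fun i => if i ∈ ({1, 2, 8} : Finset (Fin 11)) then x i else 0)
    (.of_support {1, 2, 8} (fun i hi => if_neg hi) (by decide +kernel)
      (.inr (by decide)))

theorem proj_x (i : Fin 11) :
    proj (x (K := K) i) = if i ∈ ({1, 2, 8} : Finset (Fin 11)) then x i else 0 := lift_x _ _ _

theorem axis_proj {Z : Type*} [CommRing Z] [Algebra K Z] (z : Z) (r : Coord K) :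
    axis z (proj r) = axis z r := by
  have : ((axis z).comp proj : Coord K →ₐ[K] Z).toRingHom = (axis z).toRingHom :=
    ringHom_ext (fun c => by simp) fun i => by
      simp only [AlgHom.toRingHom_eq_coe, RingHom.coe_coe, AlgHom.comp_apply, proj_x, axis_x]
      fin_cases i <;> simp [axis_x]
  exact RingHom.congr_fun this r

/-- An infinitesimal branch of the coordinate ring: the variable `x 8` is sent to `z`, the variable
`x 6` to the infinitesimal `ε`, and `x i` to the formal variable. -/
noncomputable def branch {F : Type*} [Field F] [Algebra K F] (z : F) (i : Fin 11)
    (hi : i = 1 ∨ i = 7) : Coord K →ₐ[K] PowerSeries (DualNumber F) :=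
  lift (fun j => if j = i then PowerSeries.X else if j = 6 then PowerSeries.C DualNumber.eps
      else if j = 8 then PowerSeries.C (TrivSqZeroExt.inl z) else 0)
    (.of_support {i, 6, 8} (fun j hj => by
      simp only [Finset.mem_insert, Finset.mem_singleton, not_or] at hj
      simp [hj])
      (by rcases hi with rfl | rfl <;> decide +kernel)
      (.inl (by
        rcases hi with rfl | rfl <;>
          simp [sq, ← map_mul])))

theorem branch_x {F : Type*} [Field F] [Algebra K F] (z : F) (i : Fin 11)
    (hi : i = 1 ∨ i = 7) (j : Fin 11) : branch (K := K) z i hi (x j) =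
      if j = i then PowerSeries.X else if j = 6 then PowerSeries.C DualNumber.eps
      else if j = 8 then PowerSeries.C (TrivSqZeroExt.inl z) else 0 := lift_x _ _ _

theorem constantCoeff_branch_x {F : Type*} [Field F] [Algebra K F] (z : F) (i : Fin 11)
    (hi : i = 1 ∨ i = 7) (j : Fin 11) :
    PowerSeries.constantCoeff (branch (K := K) z i hi (x j)) =
      if j = 6 then DualNumber.eps else if j = 8 then TrivSqZeroExt.inl z else 0 := by
  rw [branch_x]
  rcases hi with rfl | rfl <;> fin_cases j <;> simp

theorem fst_constantCoeff_branch {Z F : Type*} [CommRing Z] [Algebra K Z] [Field F] [Algebra K F]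
    [Algebra Z F] [IsScalarTower K Z F] (z : Z) (i : Fin 11) (hi : i = 1 ∨ i = 7) (r : Coord K) :
    (PowerSeries.constantCoeff (branch (algebraMap Z F z) i hi r)).fst =
      algebraMap Z F (axis z r) := by
  have : ((TrivSqZeroExt.fstHom F F F).toRingHom.comp PowerSeries.constantCoeff).comp
      (branch (algebraMap Z F z) i hi).toRingHom =
      (algebraMap Z F).comp (axis (K := K) z).toRingHom :=
    ringHom_ext (fun c => by
      simp [← IsScalarTower.algebraMap_apply, PowerSeries.algebraMap_apply]) fun j => by
      simp only [RingHom.comp_apply, AlgHom.toRingHom_eq_coe, RingHom.coe_coe,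
        constantCoeff_branch_x, axis_x]
      fin_cases j <;> simp
  exact RingHom.congr_fun this r

open IsLocalRing in
/-- At a prime of the axis of `x 8`, the quotient of the local ring by the equation of the point on
the axis carries a linear map from the maximal ideal that is not given by an element. -/
theorem exists_linearMap_localization {Z : Type*} [CommRing Z] [IsDomain Z] [Algebra K Z] {z : Z}
    (hz : z ≠ 0) (σ : Z →ₐ[K] Coord K) (hσ : σ z = x 8 ∨ σ z = 1 ∧ z = 1)
    (P : Ideal (Coord K)) [P.IsPrime] (hP : P = RingHom.ker (axis (K := K) z)) (A : Type*)
    [CommRing A] [IsLocalRing A] [Algebra (Coord K) A] [IsLocalization.AtPrime A P]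
    (N : Type*) [AddCommGroup N] [Module A N] (q : A →ₗ[A] N) (hq : Function.Surjective q)
    (hqw : LinearMap.ker q = Ideal.span {algebraMap (Coord K) A (x 8 - σ z)}) :
    ∃ φ : maximalIdeal A →ₗ[A] N, ¬ ∃ n, ∀ a, φ a = (a : A) • n := by
  let F := FractionRing Z
  set t : Coord K := x 8 - σ z with ht
  have hmemP : ∀ r, r ∈ P ↔ axis z r = 0 := fun r => by rw [hP, RingHom.mem_ker]
  have hmax : ∀ r, algebraMap (Coord K) A r ∈ maximalIdeal A ↔ axis z r = 0 := fun r => by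
    rw [IsLocalization.AtPrime.to_map_mem_maximal_iff A P, hmemP]
  have hproj_t : proj t = t := by
    rcases hσ with h | ⟨h, -⟩ <;> simp [ht, h, proj_x]
  let ρ : A →+* A := IsLocalization.map A proj.toRingHom
    (show P.primeCompl ≤ P.primeCompl.comap proj.toRingHom from fun r hr => by
      simpa [Ideal.primeCompl, hmemP, axis_proj] using hr)
  have hρ : ∀ r, ρ (algebraMap (Coord K) A r) = algebraMap (Coord K) A (proj r) := fun r =>
    IsLocalization.map_eq _ r
  have hbranch : ∀ i (hi : i = 1 ∨ i = 7) (s : P.primeCompl),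
      IsUnit ((branch (K := K) (algebraMap Z F z) i hi).toRingHom s) := fun i hi s => by
    rw [PowerSeries.isUnit_iff_constantCoeff, TrivSqZeroExt.isUnit_iff_isUnit_fst]
    refine IsUnit.mk0 _ ?_
    have := fst_constantCoeff_branch (F := F) z i hi (s : Coord K)
    simp only [AlgHom.toRingHom_eq_coe, RingHom.coe_coe, this]
    rw [Ne, FaithfulSMul.algebraMap_eq_zero_iff, ← hmemP]
    exact s.2
  let ψ (i : Fin 11) (hi : i = 1 ∨ i = 7) : A →+* PowerSeries (DualNumber F) :=
    IsLocalization.lift (hbranch i hi)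
  have hψ : ∀ i hi r, ψ i hi (algebraMap (Coord K) A r) = branch (algebraMap Z F z) i hi r :=
    fun i hi r => IsLocalization.lift_eq _ r
  have hψt : ∀ i hi, Ideal.span {algebraMap (Coord K) A t} ≤ RingHom.ker (ψ i hi) := fun i hi => by
    rw [Ideal.span_singleton_le_iff_mem, RingHom.mem_ker, hψ]
    rcases hσ with h | ⟨-, h'⟩
    · simp [ht, h]
    · rcases hi with rfl | rfl <;> simp [ht, h', branch_x]
  have hx8 : IsUnit (algebraMap (Coord K) A (x 8)) :=
    IsLocalization.map_units A (⟨x 8, fun h => hz (by simpa [hmemP, axis_x] using h)⟩ :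
      P.primeCompl)
  have hzero : ∀ i j, (i, j) ∈ edges →
      algebraMap (Coord K) A (x i) * algebraMap (Coord K) A (x j) = 0 := fun i j h => by
    rw [← map_mul, isZero_x.1 _ h, map_zero]
  have hzero8 : ∀ i, (i, 8) ∈ edges → algebraMap (Coord K) A (x i) = 0 := fun i h =>
    hx8.mul_left_eq_zero.1 (hzero i 8 h)
  have hsq : algebraMap (Coord K) A (x 6) * algebraMap (Coord K) A (x 6) = 0 := by
    refine hx8.mul_left_eq_zero.1 ?_
    rw [← map_mul, ← map_mul, ← sq, isZero_x.2, map_zero]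
  let L : Ideal A := Ideal.span {algebraMap (Coord K) A (x 1), algebraMap (Coord K) A (x 2),
    algebraMap (Coord K) A t}
  have hL₁ : algebraMap (Coord K) A (x 1) ∈ L := Ideal.subset_span (by simp)
  have hL₂ : algebraMap (Coord K) A (x 2) ∈ L := Ideal.subset_span (by simp)
  have hLt : algebraMap (Coord K) A t ∈ L := Ideal.subset_span (by simp)
  have hcomp : ((Ideal.Quotient.mk L).comp (algebraMap (Coord K) A)).comp proj.toRingHom =
      (((Ideal.Quotient.mk L).comp (algebraMap (Coord K) A)).comp σ.toRingHom).comp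
        (axis z).toRingHom := by
    refine ringHom_ext (fun c => by simp) fun i => ?_
    simp only [RingHom.comp_apply, AlgHom.toRingHom_eq_coe, RingHom.coe_coe, axis_x]
    by_cases hi : i = 8
    · subst hi
      rw [if_pos rfl, Ideal.Quotient.eq, ← map_sub]
      rwa [proj_x, if_pos (by decide)]
    · rw [if_neg hi, map_zero, map_zero, map_zero, Ideal.Quotient.eq_zero_iff_mem, proj_x]
      split_ifs with h
      · simp only [Finset.mem_insert, Finset.mem_singleton, hi, or_false] at h
        rcases h with rfl | rfl
        exacts [hL₁, hL₂]
      · simp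
  have hmaxL : maximalIdeal A ≤ L.comap ρ := by
    rw [← IsLocalization.AtPrime.map_eq_maximalIdeal P A, Ideal.map_le_iff_le_comap]
    intro r hr
    rw [Ideal.mem_comap, Ideal.mem_comap, hρ, ← Ideal.Quotient.eq_zero_iff_mem]
    have := RingHom.congr_fun hcomp r
    simp only [RingHom.comp_apply, AlgHom.toRingHom_eq_coe, RingHom.coe_coe] at this
    rw [this, (hmemP r).1 hr]
    simp
  have hkill : ∀ i ∉ ({1, 2, 8} : Finset (Fin 11)),
      algebraMap (Coord K) A (x i) * algebraMap (Coord K) A (x 6) = 0 ∨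
      algebraMap (Coord K) A (x i) * algebraMap (Coord K) A (x 1) = 0 ∧
      algebraMap (Coord K) A (x i) * algebraMap (Coord K) A (x 2) = 0 := fun i hi => by
    have hedge : (i, 6) ∈ edges ∨ (6, i) ∈ edges ∨ (i, 8) ∈ edges ∨ i = 6 ∨
        (1, i) ∈ edges ∧ (2, i) ∈ edges := by
      revert i
      decide +kernel
    rcases hedge with h | h | h | rfl | ⟨h₁, h₂⟩
    · exact .inl (hzero _ _ h)
    · exact .inl (mul_comm _ _ |>.trans (hzero _ _ h))
    · simp [hzero8 i h]
    · exact .inl hsq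
    · exact .inr ⟨mul_comm _ _ |>.trans (hzero _ _ h₁), mul_comm _ _ |>.trans (hzero _ _ h₂)⟩
  let w : Ideal A := Ideal.span {algebraMap (Coord K) A t}
  have hlin : ∀ b, ∀ a ∈ maximalIdeal A,
      (b - ρ b) * (algebraMap (Coord K) A (x 6) * ρ a) ∈ w := fun b a ha => by
    let J : Ideal A := Submodule.comap
      (LinearMap.mulRight A (algebraMap (Coord K) A (x 6) * ρ a)) w
    have hJ : ∀ i ∉ ({1, 2, 8} : Finset (Fin 11)), algebraMap (Coord K) A (x i) ∈ J :=
      fun i hi => by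
        suffices h : L ≤ Submodule.comap (LinearMap.mulLeft A
            (algebraMap (Coord K) A (x i) * algebraMap (Coord K) A (x 6))) w by
          simpa [J, mul_assoc] using h (hmaxL ha)
        simp only [L, Ideal.span_le, Set.insert_subset_iff, Set.singleton_subset_iff,
          SetLike.mem_coe, Submodule.mem_comap, LinearMap.mulLeft_apply]
        refine ⟨?_, ?_, w.mul_mem_left _ (Ideal.mem_span_singleton_self _)⟩
        · rcases hkill i hi with h | ⟨h, -⟩
          · simp [h]
          · simp [mul_right_comm, h]
        · rcases hkill i hi with h | ⟨-, h⟩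
          · simp [h]
          · simp [mul_right_comm, h]
    have hρJ : (Ideal.Quotient.mk J).comp ρ = Ideal.Quotient.mk J := by
      refine IsLocalization.ringHom_ext P.primeCompl (ringHom_ext (fun c => ?_) fun i => ?_)
      · simp only [RingHom.comp_apply, hρ, AlgHom.commutes]
      · simp only [RingHom.comp_apply, hρ, proj_x]
        split_ifs with h
        · rfl
        · rw [map_zero, map_zero, eq_comm, Ideal.Quotient.eq_zero_iff_mem]
          exact hJ i h
    exact Ideal.Quotient.eq.1 (RingHom.congr_fun hρJ b).symm
  have hX : (PowerSeries.X : PowerSeries (DualNumber F)) ∈ nonZeroDivisors _ :=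
    mem_nonZeroDivisors_iff_right.2 fun f hf =>
      PowerSeries.X_mul_cancel (by rw [mul_comm, hf, mul_zero])
  refine exists_linearMap_forall_ne_smul (ψ₁ := ψ 1 (.inl rfl)) (ψ₂ := ψ 7 (.inr rfl))
    (x := algebraMap (Coord K) A (x 1)) (y := algebraMap (Coord K) A (x 7))
    (θ := PowerSeries.constantCoeff) hq hqw hlin ?_ ?_ ?_ ?_ (hψt _ _) (hψt _ _) ?_ ?_ ?_ ?_
  · simp [hmax, axis_x]
  · simp [hmax, axis_x]
  · simp [hρ, proj_x]
  · simp [hρ, proj_x]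
  · simpa [hψ, branch_x] using hX
  · simpa [hψ, branch_x] using hX
  · refine IsLocalization.ringHom_ext P.primeCompl (ringHom_ext (fun c => ?_) fun j => ?_)
    · simp only [RingHom.comp_apply, hψ]
      simp
    · simp only [RingHom.comp_apply, hψ, constantCoeff_branch_x]
  · rw [hψ, constantCoeff_branch_x, if_pos rfl]
    intro h
    simpa using congr_arg TrivSqZeroExt.snd h

/-- The restriction of functions on the coordinate ring to a coordinate subspace. -/
noncomputable def restrict (s : Finset (Fin 11)) (hs : ∀ p ∈ edges, p.1 ∉ s ∨ p.2 ∉ s)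
    (h6 : 6 ∉ s) : Coord K →ₐ[K] MvPolynomial (Fin 11) K :=
  lift (fun i => if i ∈ s then X i else 0)
    (.of_support s (fun _ hi => if_neg hi) hs (.inr (.inl h6)))

theorem restrict_x (s : Finset (Fin 11)) (hs : ∀ p ∈ edges, p.1 ∉ s ∨ p.2 ∉ s) (h6 : 6 ∉ s)
    (i : Fin 11) : restrict (K := K) s hs h6 (x i) = if i ∈ s then X i else 0 := lift_x _ _ _

theorem ker_restrict_lt (s : Finset (Fin 11)) (hs : ∀ p ∈ edges, p.1 ∉ s ∨ p.2 ∉ s) (h6 : 6 ∉ s)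
    {B : Type*} [CommRing B] [Algebra K B] (f : Coord K →ₐ[K] B) (hf : ∀ i ∉ s, f (x i) = 0)
    {r : Coord K} (hr : f r = 0) (hr' : restrict s hs h6 r ≠ 0) :
    RingHom.ker (restrict (K := K) s hs h6) < RingHom.ker f := by
  have hcomp : f.toRingHom = ((aeval fun i => f (x i) : MvPolynomial (Fin 11) K →ₐ[K] B).comp
      (restrict (K := K) s hs h6)).toRingHom :=
    ringHom_ext (fun c => by simp) fun i => by
      simp only [AlgHom.toRingHom_eq_coe, RingHom.coe_coe, AlgHom.comp_apply, restrict_x]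
      split_ifs with h
      · simp
      · simp [hf i h]
  refine lt_of_le_of_ne (fun a ha => ?_) fun h => hr' ?_
  · have := RingHom.congr_fun hcomp a
    simp only [AlgHom.toRingHom_eq_coe, RingHom.coe_coe, AlgHom.comp_apply] at this
    rw [RingHom.mem_ker, this, (RingHom.mem_ker).1 ha, map_zero]
  · rw [← RingHom.mem_ker, h]
    exact hr

theorem height_ker_add_one_le {B C : Type*} [CommRing B] [IsDomain B] [Algebra K B] [CommRing C]
    [IsDomain C] [Algebra K C] {f : Coord K →ₐ[K] B} {g : Coord K →ₐ[K] C}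
    (h : RingHom.ker f < RingHom.ker g) :
    (RingHom.ker f).height + 1 ≤ (RingHom.ker g).height := by
  have := RingHom.ker_isPrime f
  have := RingHom.ker_isPrime g
  exact Ideal.height_add_one_le_of_lt_of_isPrime h

theorem two_le_height_ker_axis {Z : Type*} [CommRing Z] [IsDomain Z] [Algebra K Z] (z : Z) :
    2 ≤ (RingHom.ker (axis (K := K) z)).height := by
  have h₁ := ker_restrict_lt (K := K) {1, 2, 8} (by decide +kernel) (by decide)
    (restrict {2, 8} (by decide +kernel) (by decide))
    (fun i hi => by rw [restrict_x, if_neg (by revert i; decide)])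
    (r := x 1) (by simp [restrict_x]) (by simp [restrict_x])
  have h₂ := ker_restrict_lt (K := K) {2, 8} (by decide +kernel) (by decide)
    (axis z) (fun i hi => by rw [axis_x, if_neg (by revert i; decide)])
    (r := x 2) (by simp [axis_x]) (by simp [restrict_x])
  calc (2 : ℕ∞) = 0 + 1 + 1 := by norm_num
    _ ≤ (RingHom.ker (restrict (K := K) {1, 2, 8} (by decide +kernel) (by decide))).height + 1 + 1 :=
      by gcongr; exact zero_le
    _ ≤ (RingHom.ker (restrict (K := K) {2, 8} (by decide +kernel) (by decide))).height + 1 := by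
      gcongr
      exact height_ker_add_one_le h₁
    _ ≤ _ := height_ker_add_one_le h₂

theorem three_le_height_ker_axis_one :
    3 ≤ (RingHom.ker (axis (K := K) (1 : K))).height := by
  have h : RingHom.ker (restrict (K := K) {8} (by decide +kernel) (by decide)) <
      RingHom.ker (axis (K := K) (1 : K)) :=
    ker_restrict_lt (K := K) {8} (by decide +kernel) (by decide)
      (axis 1) (fun i hi => by rw [axis_x, if_neg (by simpa using hi)])
      (r := x 8 - 1) (by simp [axis_x]) (by
        simp only [map_sub, map_one, restrict_x, Finset.mem_singleton, if_true]
        intro h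
        simpa using congr_arg (aeval fun _ => (0 : K)) h)
  have heq : restrict (K := K) {8} (by decide +kernel) (by decide) = axis (X 8) :=
    AlgHom.coe_ringHom_injective <| ringHom_ext (fun c => by simp) fun i => by
      simp only [RingHom.coe_coe, restrict_x, axis_x, Finset.mem_singleton]
      split_ifs with h
      · rw [h]
      · rfl
  rw [heq] at h
  calc (3 : ℕ∞) = 2 + 1 := by norm_num
    _ ≤ (RingHom.ker (axis (K := K) (X 8 : MvPolynomial (Fin 11) K))).height + 1 := by
      gcongr
      exact two_le_height_ker_axis _
    _ ≤ _ := height_ker_add_one_le h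

theorem not_serreCondition_two : ¬ SerreCondition 2 (Coord K) := fun h => by
  let P : Ideal (Coord K) := RingHom.ker (axis (K := K) (X 8 : MvPolynomial (Fin 11) K))
  have hP : P.IsPrime := RingHom.ker_isPrime (axis (K := K) (X 8 : MvPolynomial (Fin 11) K))
  have hdepth : localRingDepth (Localization.AtPrime P) ≤ 1 := by
    refine localRingDepth_le fun hE => ?_
    obtain ⟨φ, hφ⟩ := exists_linearMap_localization (X_ne_zero 8)
      (Ideal.Quotient.mkₐ K (edgeIdealD₂ K)) (.inl rfl) P rfl
      (Localization.AtPrime P) (Localization.AtPrime P) LinearMap.id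
      Function.surjective_id (by
        have : x 8 - Ideal.Quotient.mkₐ K (edgeIdealD₂ K) (X 8) = 0 := sub_self _
        rw [this, map_zero, Ideal.span_singleton_zero, LinearMap.ker_id])
    exact hφ (exists_smul_eq_of_subsingleton_extMod hE φ)
  have h₂ := h P
  rw [IsLocalization.AtPrime.ringKrullDim_eq_height P, min_eq_right] at h₂
  · have : (2 : ℕ∞) ≤ 1 := (WithBot.coe_le_coe.1 h₂).trans hdepth
    exact absurd this (by decide)
  · exact WithBot.coe_le_coe.2 (two_le_height_ker_axis _)

theorem exists_linearMap_quotient (P : Ideal (Coord K)) [P.IsPrime]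
    (hP : P = RingHom.ker (axis (K := K) (1 : K))) (A : Type*) [CommRing A] [IsLocalRing A]
    [Algebra (Coord K) A] [IsLocalization.AtPrime A P] :
    ∃ φ : IsLocalRing.maximalIdeal A →ₗ[A] A ⧸ Ideal.span {algebraMap (Coord K) A (x 8 - 1)},
      ¬ ∃ n, ∀ a, φ a = (a : A) • n :=
  exists_linearMap_localization one_ne_zero (Algebra.ofId K (Coord K)) (.inr ⟨map_one _, rfl⟩)
    P hP A _ (Submodule.mkQ _) (Submodule.mkQ_surjective _) (by
      rw [map_one]
      exact Submodule.ker_mkQ _)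

theorem not_isCohenMacaulayRing_of_mem_nonZeroDivisors
    (ht : (x 8 - 1 : Coord K) ∈ nonZeroDivisors _) : ¬ IsCohenMacaulayRing (Coord K) := fun h => by
  obtain ⟨P, hP⟩ : ∃ P, P = RingHom.ker (axis (K := K) (1 : K)) := ⟨_, rfl⟩
  have hmax : P.IsMaximal := hP ▸ RingHom.ker_isMaximal_of_surjective (axis (K := K) (1 : K))
    fun c => ⟨algebraMap K _ c, by simp⟩
  have hprime : P.IsPrime := hmax.isPrime
  have h₃ := h P
  rw [IsLocalization.AtPrime.ringKrullDim_eq_height P] at h₃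
  have hdepth : 3 ≤ localRingDepth (Localization.AtPrime P) := by
    rw [WithBot.coe_eq_coe.1 h₃, hP]
    exact three_le_height_ker_axis_one
  have hE : ∀ n : ℕ, n < 3 → Subsingleton (ExtMod (Localization.AtPrime P) n
      (IsLocalRing.ResidueField (Localization.AtPrime P)) (Localization.AtPrime P)) := fun n hn => by
    by_contra hE
    have := hdepth.trans (localRingDepth_le hE)
    exact absurd (Nat.cast_le.1 (show ((3 : ℕ) : ℕ∞) ≤ n from this)) (by omega)
  obtain ⟨φ, hφ⟩ := exists_linearMap_quotient P hP (Localization.AtPrime P)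
  exact hφ (exists_smul_eq_of_subsingleton_extMod_two (hE 1 (by norm_num)) (hE 2 (by norm_num))
    (IsLocalization.map_nonZeroDivisors_le P.primeCompl _ (Submonoid.mem_map_of_mem _ ht)) φ)

/-- The facets of the simplicial complex with Stanley-Reisner ideal `I(G)`, together with whether
the variable `x 6` survives as an infinitesimal in the corresponding primary component. -/
def facets : List (Finset (Fin 11) × Bool) :=
  [({0, 1, 5}, false), ({0, 1, 8}, false), ({0, 4, 5}, false), ({0, 4, 7}, false),
    ({0, 7, 8}, false), ({1, 2, 6}, false), ({1, 2, 8}, true), ({1, 5, 6}, false),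
    ({2, 3, 6}, false), ({2, 3, 9}, false), ({2, 8, 9}, false), ({3, 4, 7}, false),
    ({3, 4, 9}, false), ({3, 6, 7}, false), ({4, 5, 9}, false), ({5, 6, 10}, false),
    ({5, 9, 10}, false), ({6, 7, 10}, false), ({7, 8, 10}, true), ({8, 9, 10}, false)]

theorem facets_spec : ∀ p ∈ facets, p.1.card = 3 ∧
    (∀ q ∈ edges, q.1 ∉ (if p.2 then insert 6 p.1 else p.1) ∨
      q.2 ∉ (if p.2 then insert 6 p.1 else p.1)) ∧
    (if p.2 then 6 ∉ p.1 else 6 ∉ p.1 ∨ 8 ∉ p.1) := by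
  rw [← List.forall_iff_forall_mem]
  decide +kernel

theorem exists_facet (s : Finset (Fin 11)) (hs : ∀ p ∈ edges, p.1 ∉ s ∨ p.2 ∉ s) :
    (6 ∉ s ∨ 8 ∉ s → ∃ p ∈ facets, s ⊆ p.1) ∧
      ∃ p ∈ facets, s ⊆ if p.2 then insert 6 p.1 else p.1 := by
  simp only [← List.any_iff_exists_prop]
  revert s
  decide +kernel

/-- The evaluation whose kernel is the primary component of `I(D₂)` attached to a facet. -/
noncomputable def evalFacet (p : Finset (Fin 11) × Bool) :
    MvPolynomial (Fin 11) K →ₐ[K] DualNumber (MvPolynomial (Fin 11) K) :=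
  aeval fun i => if i ∈ p.1 then TrivSqZeroExt.inl (X i)
    else if i = 6 ∧ p.2 = true then DualNumber.eps else 0

/-- Restriction of polynomials to a coordinate subspace. -/
noncomputable def evalCoord (s : Finset (Fin 11)) :
    MvPolynomial (Fin 11) K →ₐ[K] MvPolynomial (Fin 11) K :=
  aeval fun i => if i ∈ s then X i else 0

theorem fst_evalFacet (p : Finset (Fin 11) × Bool) (f : MvPolynomial (Fin 11) K) :
    (evalFacet p f).fst = evalCoord p.1 f := by
  have : (TrivSqZeroExt.fstHom K _ _).comp (evalFacet p) = evalCoord (K := K) p.1 := by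
    ext1 i
    simp only [AlgHom.comp_apply, evalFacet, evalCoord, aeval_X]
    split_ifs <;> simp
  exact AlgHom.congr_fun this f

theorem edgeIdealD₂_le_ker_evalFacet {p : Finset (Fin 11) × Bool} (hp : p ∈ facets) :
    edgeIdealD₂ K ≤ RingHom.ker (evalFacet (K := K) p) := by
  refine (le_ker_iff (evalFacet (K := K) p : MvPolynomial (Fin 11) K →+*
    DualNumber (MvPolynomial (Fin 11) K))).2 ?_
  obtain ⟨-, hedges, h6⟩ := facets_spec p hp
  refine .of_support (if p.2 then insert 6 p.1 else p.1) (fun i hi => ?_) hedges ?_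
  · have h₁ : i ∉ p.1 := fun h => hi (by split_ifs <;> simp [h])
    have h₂ : ¬ (i = 6 ∧ p.2 = true) := fun h => hi (by simp [h])
    simp [evalFacet, h₁, h₂]
  · split_ifs at h6 with h
    · left
      simp [evalFacet, h, h6, sq]
    · right
      rwa [if_neg h]

/-- The exponents of the generators of the primary component of `I(D₂)` attached to a facet. -/
def facetExponents (p : Finset (Fin 11) × Bool) : Set (Fin 11 →₀ ℕ) :=
  {e | (∃ i ∉ p.1, ¬ (i = 6 ∧ p.2 = true) ∧ e = Finsupp.single i 1) ∨
    p.2 = true ∧ e = Finsupp.single 6 2}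

/-- The primary component of `I(D₂)` attached to a facet. -/
noncomputable def facetIdeal (p : Finset (Fin 11) × Bool) : Ideal (MvPolynomial (Fin 11) K) :=
  Ideal.span ((fun e => monomial e 1) '' facetExponents p)

theorem mem_facetIdeal_of_evalFacet_eq_zero {p : Finset (Fin 11) × Bool}
    {f : MvPolynomial (Fin 11) K} (hf : evalFacet p f = 0) :
    f ∈ facetIdeal p := by
  let e : MvPolynomial (Fin 11) K ⧸ facetIdeal (K := K) p :=
    Ideal.Quotient.mk _ (if p.2 then X 6 else 0)
  have he : e * e = 0 := by
    rw [← map_mul, Ideal.Quotient.eq_zero_iff_mem]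
    split_ifs with h
    · refine Ideal.subset_span ⟨_, .inr ⟨h, rfl⟩, ?_⟩
      rw [← sq, X_pow_eq_monomial]
    · simp
  have hτ : (DualNumber.lift ⟨(Ideal.Quotient.mkₐ K (facetIdeal p), e), he,
      fun _ => Commute.all _ _⟩).comp (evalFacet p) = Ideal.Quotient.mkₐ K (facetIdeal p) := by
    ext1 i
    rw [AlgHom.comp_apply, evalFacet, aeval_X]
    split_ifs with h₁ h₂
    · rw [DualNumber.lift_apply_inl]
    · rw [DualNumber.lift_apply_eps, h₂.1]
      exact congr_arg _ (if_pos h₂.2)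
    · rw [map_zero, eq_comm, Ideal.Quotient.mkₐ_eq_mk, Ideal.Quotient.eq_zero_iff_mem]
      exact Ideal.subset_span ⟨_, .inl ⟨i, h₁, h₂, rfl⟩, rfl⟩
  have := AlgHom.congr_fun hτ f
  rwa [AlgHom.comp_apply, hf, map_zero, eq_comm, Ideal.Quotient.mkₐ_eq_mk,
    Ideal.Quotient.eq_zero_iff_mem] at this

theorem monomial_mem_edgeIdealD₂ {a : Fin 11 →₀ ℕ} (c : K)
    (ha : (∃ q ∈ edges, a q.1 ≠ 0 ∧ a q.2 ≠ 0) ∨ 2 ≤ a 6 ∧ a 8 ≠ 0) :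
    monomial a c ∈ edgeIdealD₂ K := by
  have hx := isZero_x (K := K)
  rw [← Ideal.Quotient.eq_zero_iff_mem, monomial_eq, Finsupp.prod_fintype _ _ (by simp), map_mul,
    map_prod]
  refine mul_eq_zero_of_right _ ?_
  simp only [map_pow]
  have hne : ∀ q ∈ edges, q.1 ≠ q.2 := by
    rw [← List.forall_iff_forall_mem]
    decide +kernel
  have hdvd : ∀ i j, i ≠ j → ∀ m n, m ≤ a i → n ≤ a j → x (K := K) i ^ m * x j ^ n = 0 →
      ∏ k, Ideal.Quotient.mk (edgeIdealD₂ K) (X k) ^ a k = 0 := fun i j hij m n hm hn h => by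
    refine zero_dvd_iff.1 (h ▸ ?_)
    rw [← Finset.mul_prod_erase _ _ (Finset.mem_univ i),
      ← Finset.mul_prod_erase _ _ (Finset.mem_erase.2 ⟨hij.symm, Finset.mem_univ j⟩), ← mul_assoc]
    exact Dvd.dvd.mul_right (mul_dvd_mul (pow_dvd_pow _ hm) (pow_dvd_pow _ hn)) _
  rcases ha with ⟨q, hq, h₁, h₂⟩ | ⟨h₁, h₂⟩
  · exact hdvd _ _ (hne q hq) 1 1 (Nat.one_le_iff_ne_zero.2 h₁) (Nat.one_le_iff_ne_zero.2 h₂)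
      (by rw [pow_one, pow_one, hx.1 q hq])
  · exact hdvd 6 8 (by decide) 2 1 h₁ (Nat.one_le_iff_ne_zero.2 h₂) (by rw [pow_one, hx.2])

theorem mem_edgeIdealD₂_of_evalFacet_eq_zero {f : MvPolynomial (Fin 11) K}
    (hf : ∀ p ∈ facets, evalFacet p f = 0) : f ∈ edgeIdealD₂ K := by
  rw [← f.support_sum_monomial_coeff]
  refine Ideal.sum_mem _ fun a ha => monomial_mem_edgeIdealD₂ _ ?_
  by_contra! h
  obtain ⟨p, hp, hsub, h6⟩ : ∃ p ∈ facets, (a.support ⊆ if p.2 then insert 6 p.1 else p.1) ∧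
      (p.2 = true → a 6 ≤ 1) := by
    have hs := exists_facet a.support fun q hq => by
      simpa only [Finsupp.notMem_support_iff, or_iff_not_imp_left] using h.1 q hq
    rcases Nat.lt_or_ge 1 (a 6) with h6 | h6
    · obtain ⟨p, hp, hsub⟩ := hs.1 (.inr (by simpa using h.2 h6))
      refine ⟨p, hp, hsub.trans ?_, fun h => ?_⟩
      · split_ifs
        · exact Finset.subset_insert _ _
        · rfl
      · have := (facets_spec p hp).2.2
        rw [if_pos h] at this
        rw [Finsupp.notMem_support_iff.1 fun h => this (hsub h)]
        exact zero_le_one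
    · obtain ⟨p, hp, hsub⟩ := hs.2
      exact ⟨p, hp, hsub, fun _ => h6⟩
  obtain ⟨e, he, hle⟩ := mem_ideal_span_monomial_image.1
    (mem_facetIdeal_of_evalFacet_eq_zero (hf p hp)) a ha
  rcases he with ⟨i, hi, hi6, rfl⟩ | ⟨hp2, rfl⟩
  · have := hsub (Finsupp.mem_support_iff.2 (Nat.one_le_iff_ne_zero.1 (by simpa using hle i)))
    split_ifs at this with hp2
    · rcases Finset.mem_insert.1 this with h | h
      · exact hi6 ⟨h, hp2⟩
      · exact hi h
    · exact hi this
  · have := hle 6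
    rw [Finsupp.single_eq_same] at this
    have := h6 hp2
    omega

theorem mem_edgeIdealD₂_iff {f : MvPolynomial (Fin 11) K} :
    f ∈ edgeIdealD₂ K ↔ ∀ p ∈ facets, evalFacet p f = 0 :=
  ⟨fun h _ hp => edgeIdealD₂_le_ker_evalFacet hp h, mem_edgeIdealD₂_of_evalFacet_eq_zero⟩

theorem evalCoord_eq_zero_of_mul {p : Finset (Fin 11) × Bool} {g f : MvPolynomial (Fin 11) K}
    (h : evalFacet p (g * f) = 0) (hf : evalFacet p f ≠ 0) : evalCoord p.1 g = 0 := by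
  by_contra hg
  rw [map_mul] at h
  have h₁ := congr_arg TrivSqZeroExt.fst h
  have h₂ := congr_arg TrivSqZeroExt.snd h
  rw [TrivSqZeroExt.fst_mul, fst_evalFacet, TrivSqZeroExt.fst_zero, mul_eq_zero,
    or_iff_right hg] at h₁
  rw [TrivSqZeroExt.snd_mul, fst_evalFacet, h₁, TrivSqZeroExt.snd_zero, MulOpposite.op_zero,
    zero_smul, add_zero, smul_eq_mul, mul_eq_zero, or_iff_right hg] at h₂
  exact hf (TrivSqZeroExt.ext h₁ h₂)

theorem evalFacet_sq_eq_zero {p : Finset (Fin 11) × Bool} {g : MvPolynomial (Fin 11) K}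
    (hg : evalCoord p.1 g = 0) : evalFacet p (g ^ 2) = 0 := by
  rw [← fst_evalFacet] at hg
  rw [map_pow, sq]
  ext <;> simp [hg]

theorem x_sub_one_mem_nonZeroDivisors : (x 8 - 1 : Coord K) ∈ nonZeroDivisors _ := by
  rw [mem_nonZeroDivisors_iff_left]
  intro r hr
  obtain ⟨f, rfl⟩ := Ideal.Quotient.mk_surjective r
  rw [x, ← map_one (Ideal.Quotient.mk _), ← map_sub, ← map_mul, Ideal.Quotient.eq_zero_iff_mem,
    mem_edgeIdealD₂_iff] at hr
  rw [Ideal.Quotient.eq_zero_iff_mem, mem_edgeIdealD₂_iff]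
  intro p hp
  by_contra h
  have := evalCoord_eq_zero_of_mul (hr p hp) h
  rw [evalCoord, map_sub, aeval_X, map_one] at this
  have := congr_arg (aeval fun _ => (0 : K)) this
  split_ifs at this <;> simp at this

theorem exists_eq_ker_evalCoord {P : Ideal (MvPolynomial (Fin 11) K)}
    (hP : P ∈ associatedPrimes (MvPolynomial (Fin 11) K) (Coord K)) :
    ∃ p ∈ facets, P = RingHom.ker (evalCoord (K := K) p.1) := by
  obtain ⟨hprime, r, hr⟩ := Submodule.isAssociatedPrime_iff.1 (AssociatedPrimes.mem_iff.1 hP)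
  obtain ⟨f, rfl⟩ := Ideal.Quotient.mk_surjective r
  have hmem : ∀ g, g ∈ P ↔ ∀ p ∈ facets, evalFacet p (g * f) = 0 := fun g => by
    rw [hr, Submodule.mem_colon_singleton, Submodule.mem_bot, ← mem_edgeIdealD₂_iff,
      ← Ideal.Quotient.eq_zero_iff_mem, map_mul]
    rfl
  have hinf : facets.toFinset.inf (fun p => Submodule.colon (RingHom.ker (evalFacet (K := K) p))
      ({f} : Set (MvPolynomial (Fin 11) K))) ≤ P := fun g hg => by
    refine (hmem g).2 fun p hp => ?_
    have := Finset.inf_le (f := fun p => Submodule.colon (RingHom.ker (evalFacet (K := K) p))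
      ({f} : Set (MvPolynomial (Fin 11) K))) (List.mem_toFinset.2 hp) hg
    exact Submodule.mem_colon_singleton.1 this
  obtain ⟨p, hp, hle⟩ := (hprime.inf_le').1 hinf
  have hp := List.mem_toFinset.1 hp
  have hle' : ∀ g, evalFacet p (g * f) = 0 → g ∈ P := fun g hg =>
    hle (Submodule.mem_colon_singleton.2 hg)
  have hf : evalFacet p f ≠ 0 := fun h =>
    hprime.ne_top ((Ideal.eq_top_iff_one P).2 (hle' 1 (by rwa [one_mul])))
  refine ⟨p, hp, le_antisymm (fun g hg => evalCoord_eq_zero_of_mul ((hmem g).1 hg p hp) hf)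
    fun g hg => hprime.mem_of_pow_mem 2 (hle' _ ?_)⟩
  rw [map_mul, evalFacet_sq_eq_zero hg, zero_mul]

theorem idealHeight_comap {R S : Type*} [CommRing R] [CommRing S] (e : R ≃+* S) (I : Ideal S) :
    idealHeight (I.comap e) = idealHeight I := by
  refine Order.krullDim_eq_of_orderIso ⟨(PrimeSpectrum.comapEquiv e).toEquiv.subtypeEquiv
    fun q => ?_, fun {q q'} => (PrimeSpectrum.comapEquiv e).le_iff_le⟩
  change q.asIdeal ≤ I.comap e ↔ q.asIdeal.comap e.symm ≤ I
  rw [← Ideal.map_comap_of_equiv, Ideal.map_le_iff_le_comap]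
  rfl

theorem evalCoord_map_rename (s : Finset (Fin 11)) (σ : Equiv.Perm (Fin 11))
    (f : MvPolynomial (Fin 11) K) :
    evalCoord (s.map σ.toEmbedding) (rename σ f) = rename σ (evalCoord s f) := by
  have : (evalCoord (s.map σ.toEmbedding)).comp (rename σ : _ →ₐ[K] MvPolynomial (Fin 11) K) =
      (rename σ).comp (evalCoord s) := by
    ext1 i
    simp only [AlgHom.comp_apply, rename_X, evalCoord, aeval_X, Finset.mem_map_equiv,
      Equiv.symm_apply_apply]
    split_ifs <;> simp
  exact AlgHom.congr_fun this f

theorem idealHeight_ker_evalCoord {s t : Finset (Fin 11)} (h : s.card = t.card) :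
    idealHeight (RingHom.ker (evalCoord (K := K) s)) =
      idealHeight (RingHom.ker (evalCoord (K := K) t)) := by
  obtain ⟨σ, rfl⟩ := Equiv.Perm.exists_map_finset_eq s t h
  rw [← idealHeight_comap (renameEquiv K σ).toRingEquiv
    (RingHom.ker (evalCoord (K := K) (s.map σ.toEmbedding)))]
  refine congr_arg idealHeight (Ideal.ext fun f => ?_)
  rw [Ideal.mem_comap, RingHom.mem_ker, RingHom.mem_ker]
  refine Iff.trans ?_ (iff_of_eq (congr_arg (· = 0) (evalCoord_map_rename s σ f))).symm
  exact (map_eq_zero_iff _ (rename_injective σ σ.injective)).symm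

theorem isUnmixedIdeal : IsUnmixedIdeal (edgeIdealD₂ K) := fun P hP Q hQ => by
  obtain ⟨p, hp, rfl⟩ := exists_eq_ker_evalCoord hP
  obtain ⟨q, hq, rfl⟩ := exists_eq_ker_evalCoord hQ
  exact idealHeight_ker_evalCoord ((facets_spec p hp).1.trans (facets_spec q hq).1.symm)

end EdgeIdealD₂

open MvPolynomial in
/-- Over a field `K` of characteristic `0`, the vertex-weighted edge ideal `I(D₂)` of an
orientation of the graph coming from a triangulation of the real projective plane, with
weight `2` at `x_7` and weight `1` elsewhere, is unmixed, but `S/I(D₂)` is not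
Cohen-Macaulay; moreover `S/I(D₂)` does not satisfy Serre's condition `(S_2)`. -/
theorem counterexample_D2 (K : Type u) [Field K] [CharZero K] :
    IsUnmixedIdeal
      (Ideal.span ({X 0 * X 2,
    X 0 * X 3,
    X 0 * X 6,
    X 0 * X 9,
    X 0 * X 10,
    X 1 * X 3,
    X 1 * X 4,
    X 1 * X 7,
    X 1 * X 9,
    X 1 * X 10,
    X 2 * X 4,
    X 2 * X 5,
    X 2 * X 7,
    X 2 * X 10,
    X 3 * X 5,
    X 3 * X 8,
    X 3 * X 10,
    X 4 * X 6,
    X 4 * X 8,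
    X 4 * X 10,
    X 5 * X 7,
    X 5 * X 8,
    X 6 ^ 2 * X 8,
    X 6 * X 9,
    X 7 * X 9} : Set (MvPolynomial (Fin 11) K))) ∧
    ¬ IsCohenMacaulayRing (MvPolynomial (Fin 11) K ⧸
      Ideal.span ({X 0 * X 2,
    X 0 * X 3,
    X 0 * X 6,
    X 0 * X 9,
    X 0 * X 10,
    X 1 * X 3,
    X 1 * X 4,
    X 1 * X 7,
    X 1 * X 9,
    X 1 * X 10,
    X 2 * X 4,
    X 2 * X 5,
    X 2 * X 7,
    X 2 * X 10,
    X 3 * X 5,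
    X 3 * X 8,
    X 3 * X 10,
    X 4 * X 6,
    X 4 * X 8,
    X 4 * X 10,
    X 5 * X 7,
    X 5 * X 8,
    X 6 ^ 2 * X 8,
    X 6 * X 9,
    X 7 * X 9} : Set (MvPolynomial (Fin 11) K))) ∧
    ¬ SerreCondition 2 (MvPolynomial (Fin 11) K ⧸
      Ideal.span ({X 0 * X 2,
    X 0 * X 3,
    X 0 * X 6,
    X 0 * X 9,
    X 0 * X 10,
    X 1 * X 3,
    X 1 * X 4,
    X 1 * X 7,
    X 1 * X 9,
    X 1 * X 10,
    X 2 * X 4,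
    X 2 * X 5,
    X 2 * X 7,
    X 2 * X 10,
    X 3 * X 5,
    X 3 * X 8,
    X 3 * X 10,
    X 4 * X 6,
    X 4 * X 8,
    X 4 * X 10,
    X 5 * X 7,
    X 5 * X 8,
    X 6 ^ 2 * X 8,
    X 6 * X 9,
    X 7 * X 9} : Set (MvPolynomial (Fin 11) K))) :=
  ⟨EdgeIdealD₂.isUnmixedIdeal,
    EdgeIdealD₂.not_isCohenMacaulayRing_of_mem_nonZeroDivisors
      EdgeIdealD₂.x_sub_one_mem_nonZeroDivisors,
    EdgeIdealD₂.not_serreCondition_two⟩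
end
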